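/- Let k and ℓ be number fields, let a, b ∈ k and c, d ∈ ℓ be nonzero, and set K = k_{a,b} and L = ℓ_{c,d}. If there exists a Witt equivalence from K to L, then K is k-algebra isomorphic to the rational function field k(t) if and only if L is ℓ-algebra isomorphic to the rational function field ℓ(t). -/

import Mathlib

open MvPolynomial

noncomputable section

/-- The defining polynomial `a·x² + b·y² − 1` of the affine conic. -/
def conicPoly (k : Type*) [Field k] (a b : k) : MvPolynomial (Fin 2) k :=
  C a * X 0 ^ 2 + C b * X 1 ^ 2 - 1

/-- The coordinate ring `k[x,y]/(a·x² + b·y² − 1)` of the affine conic. -/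
abbrev ConicRing (k : Type*) [Field k] (a b : k) : Type _ :=
  MvPolynomial (Fin 2) k ⧸ Ideal.span {conicPoly k a b}

/-- `K` (together with the embedding `ι : k →+* K`) is a model of the function field
`k_{a,b}`, i.e. the quotient field of `k[x,y]/(a·x² + b·y² − 1)`. -/
def IsConicFunctionField (k : Type*) [Field k] (a b : k)
    (K : Type*) [Field K] (ι : k →+* K) : Prop :=
  ∃ f : ConicRing k a b →+* K,
    Function.Injective f ∧
    f.comp (algebraMap k (ConicRing k a b)) = ι ∧
    ∀ z : K, ∃ p q : ConicRing k a b, f q ≠ 0 ∧ z = f p / f q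

/-- The subgroup of squares in `Kˣ`. -/
def sqSubgroup (K : Type*) [Field K] : Subgroup Kˣ :=
  MonoidHom.range (powMonoidHom 2 : Kˣ →* Kˣ)

/-- The square class group `Kˣ/Kˣ²`. -/
abbrev SqClass (K : Type*) [Field K] := Kˣ ⧸ sqSubgroup K

/-- The square class of a unit. -/
def sqCl {K : Type*} [Field K] (u : Kˣ) : SqClass K := QuotientGroup.mk u

/-- `α : Kˣ/Kˣ² → Lˣ/Lˣ²` is a Witt equivalence: it sends `-1` to `-1` and preserves
binary value sets. -/
structure IsWittEquiv {K L : Type*} [Field K] [Field L]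
    (α : SqClass K ≃* SqClass L) : Prop where
  map_neg_one : α (sqCl (-1)) = sqCl (-1)
  represents : ∀ (a b c : Kˣ) (a' b' c' : Lˣ),
    α (sqCl a) = sqCl a' → α (sqCl b) = sqCl b' → α (sqCl c) = sqCl c' →
    ((∃ x y : K, (c : K) = (a : K) * x ^ 2 + (b : K) * y ^ 2) ↔
      (∃ x y : L, (c' : L) = (a' : L) * x ^ 2 + (b' : L) * y ^ 2))

/-- Two fields are Witt equivalent if there is a Witt equivalence between them. -/
def WittEquivalent (K L : Type*) [Field K] [Field L] : Prop :=
  ∃ α : SqClass K ≃* SqClass L, IsWittEquiv α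

/-- An ordering of a field `F`. -/
structure IsOrdering {F : Type*} [Field F] (P : Set F) : Prop where
  add_mem : ∀ x ∈ P, ∀ y ∈ P, x + y ∈ P
  mul_mem : ∀ x ∈ P, ∀ y ∈ P, x * y ∈ P
  total : ∀ x : F, x ∈ P ∨ -x ∈ P
  antisymm : ∀ x : F, x ∈ P → -x ∈ P → x = 0

noncomputable section

/-- A multiplicatively closed set of nonzero elements containing all nonzero squares;
such a set is a subgroup of the multiplicative group. -/
structure IsSqGroup {F : Type*} [Field F] (T : Set F) : Prop where
  ne_zero : ∀ {x}, x ∈ T → x ≠ 0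
  mul_mem : ∀ {x y}, x ∈ T → y ∈ T → x * y ∈ T
  sq_mem : ∀ {x}, x ≠ 0 → x ^ 2 ∈ T

namespace IsSqGroup

variable {F : Type*} [Field F] {T : Set F}

theorem one_mem (hT : IsSqGroup T) : (1 : F) ∈ T := by
  simpa using hT.sq_mem (one_ne_zero (α := F))

theorem mem_of_eq (hT : IsSqGroup T) {x y z : F} (hx : x ∈ T) (hz : z ≠ 0)
    (e : y = x * z ^ 2) : y ∈ T := e ▸ hT.mul_mem hx (hT.sq_mem hz)

theorem inv_mem (hT : IsSqGroup T) {x : F} (hx : x ∈ T) : x⁻¹ ∈ T := by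
  have h0 := hT.ne_zero hx
  exact hT.mem_of_eq hx (inv_ne_zero h0) (by field_simp)

theorem div_mem (hT : IsSqGroup T) {x y : F} (hx : x ∈ T) (hy : y ∈ T) : x / y ∈ T := by
  rw [div_eq_mul_inv]; exact hT.mul_mem hx (hT.inv_mem hy)

theorem of_mul_left (hT : IsSqGroup T) {x y : F} (hx : x ∈ T) (hxy : x * y ∈ T) : y ∈ T := by
  have h0 := hT.ne_zero hx
  have := hT.div_mem hxy hx
  rwa [mul_div_cancel_left₀ _ h0] at this

theorem of_mul_right (hT : IsSqGroup T) {x y : F} (hx : x ∈ T) (hxy : y * x ∈ T) : y ∈ T :=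
  hT.of_mul_left hx (mul_comm y x ▸ hxy)

theorem of_inv (hT : IsSqGroup T) {x : F} (hx : x⁻¹ ∈ T) : x ∈ T := by
  simpa using hT.inv_mem hx

end IsSqGroup

/-- `g` witnesses that rigidity with respect to `T` fails on the subgroup `H`. -/
structure NonrigidElt {F : Type*} [Field F] (T H : Set F) (g : F) : Prop where
  mem : g ∈ H
  notMem : g ∉ T
  neg_notMem : -g ∉ T
  one_add_ne : 1 + g ≠ 0
  one_add_notMem : 1 + g ∉ T
  mul_one_add_notMem : g * (1 + g) ∉ T

/-- A pair of subgroups `T ≤ H` with `H` of index two such that every element outside `H`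
is rigid with respect to `T`, while some element of `H` is not. -/
structure RigidPair {F : Type*} [Field F] (T H : Set F) : Prop where
  left : IsSqGroup T
  right : IsSqGroup H
  le : T ⊆ H
  neg_one : (-1 : F) ∈ H
  index : ∀ {x y : F}, x ≠ 0 → y ≠ 0 → x ∉ H → y ∉ H → x * y ∈ H
  nontrivial : ∃ x : F, x ≠ 0 ∧ x ∉ H
  rigid : ∀ {x : F}, x ≠ 0 → x ∉ H → 1 + x ∈ T ∨ x * (1 + x) ∈ T
  nonrigid : ∃ g, NonrigidElt T H g

namespace NonrigidElt

variable {F : Type*} [Field F] {T H : Set F} {g : F}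

theorem inv (hg : NonrigidElt T H g) (hT : IsSqGroup T) (hH : IsSqGroup H) :
    NonrigidElt T H g⁻¹ := by
  have h0 : g ≠ 0 := hH.ne_zero hg.mem
  refine ⟨hH.inv_mem hg.mem, fun h => hg.notMem (hT.of_inv h), fun h => hg.neg_notMem ?_, ?_,
    fun h => hg.mul_one_add_notMem ?_, fun h => hg.one_add_notMem ?_⟩
  · apply hT.of_inv; rwa [← neg_inv]
  · have := hg.one_add_ne
    intro h
    apply this
    field_simp at h
    linear_combination h
  · exact hT.mem_of_eq h h0 (by field_simp; ring)
  · exact hT.mem_of_eq h h0 (by field_simp; ring)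

end NonrigidElt

namespace RigidPair

variable {F : Type*} [Field F] {T H : Set F}

/-- The elements of odd value in the maximal ideal of the valuation attached to a rigid pair. -/
def oddPart (T H : Set F) : Set F := {x | x ≠ 0 ∧ x ∉ H ∧ 1 + x ∈ T}

/-- The elements of even value in the valuation ring attached to a rigid pair. -/
def evenPart (T H : Set F) : Set F := {a | a ∈ H ∧ ∀ x ∈ oddPart T H, a * x ∈ oddPart T H}

/-- The carrier of the valuation ring attached to a rigid pair. -/
def ringSet (T H : Set F) : Set F := oddPart T H ∪ evenPart T H ∪ {0}

variable (R : RigidPair T H)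
include R

theorem inv_mem_oddPart {x : F} (h0 : x ≠ 0) (hH : x ∉ H) (hx : x ∉ oddPart T H) :
    x⁻¹ ∈ oddPart T H := by
  rcases R.rigid h0 hH with h | h
  · exact absurd ⟨h0, hH, h⟩ hx
  · refine ⟨inv_ne_zero h0, fun h' => hH (R.right.of_inv h'), ?_⟩
    exact R.left.mem_of_eq h (inv_ne_zero h0) (by field_simp; ring)

theorem inv_notMem_oddPart {x : F} (hx : x ∈ oddPart T H) : x⁻¹ ∉ oddPart T H := by
  rintro ⟨-, -, h⟩
  have h0 := hx.1
  apply hx.2.1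
  apply R.le
  have h1 := R.left.mul_mem hx.2.2 h
  exact R.left.mem_of_eq h1 (z := x / (1 + x))
    (div_ne_zero h0 (R.left.ne_zero hx.2.2)) (by
      have := R.left.ne_zero hx.2.2
      field_simp; ring)

theorem mul_notMem_right {x y : F} (hx : x ∈ H) (hy : y ∉ H) : x * y ∉ H := fun h =>
  hy (R.right.of_mul_left hx h)

theorem add_rigid {s w : F} (hs : s ∈ T) (hw : w ≠ 0) (hwH : w ∉ H) :
    s + w ∈ T ∨ w * (s + w) ∈ T := by
  have h0 := R.left.ne_zero hs
  have h1 : s⁻¹ * w ∉ H := R.mul_notMem_right (R.right.inv_mem (R.le hs)) hwH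
  rcases R.rigid (mul_ne_zero (inv_ne_zero h0) hw) h1 with h | h
  · left
    have := R.left.mul_mem hs h
    rwa [show s * (1 + s⁻¹ * w) = s + w by field_simp] at this
  · right
    exact R.left.mem_of_eq h h0 (by field_simp)

theorem one_sub_mul_aux {x y : F} (hx : x ∈ oddPart T H) (hy : y ∈ oddPart T H) :
    1 - x * y ∈ T ∨ -x * (1 - x * y) ∈ T := by
  have h1 : -(x * (1 + y)) ∉ H := by
    rw [show -(x * (1 + y)) = (-1 * (1 + y)) * x by ring]
    exact R.mul_notMem_right (R.right.mul_mem R.neg_one (R.le hy.2.2)) hx.2.1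
  have hy0 := R.left.ne_zero hy.2.2
  have e : 1 + x + -(x * (1 + y)) = 1 - x * y := by ring
  rcases R.add_rigid hx.2.2 (neg_ne_zero.2 (mul_ne_zero hx.1 hy0)) h1 with h | h <;> rw [e] at h
  · exact Or.inl h
  · right
    apply R.left.of_mul_left hy.2.2
    rwa [show (1 + y) * (-x * (1 - x * y)) = -(x * (1 + y)) * (1 - x * y) by ring]

theorem one_sub_mul_of_notMem {x y : F} (hx : x ∈ oddPart T H) (hy : y ∈ oddPart T H)
    (hxy : x * y ∉ T) : 1 - x * y ∈ T := by
  rcases R.one_sub_mul_aux hx hy with h | h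
  · exact h
  rcases R.one_sub_mul_aux hy hx with h' | h'
  · rwa [mul_comm y x] at h'
  exfalso
  apply hxy
  have hne : 1 - x * y ≠ 0 := fun e => by simp [e] at h; exact R.left.ne_zero h rfl
  exact R.left.mem_of_eq (R.left.mul_mem h h') (inv_ne_zero hne) (by
    rw [mul_comm y x]; field_simp)

theorem neg_mem_oddPart {z : F} (hz : z ∈ oddPart T H) : -z ∈ oddPart T H := by
  by_contra hcon
  have hneg : ∀ {x : F}, x ∉ H → -x ∉ H := fun {x} hx => by
    rw [← neg_one_mul]; exact R.mul_notMem_right R.neg_one hx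
  have hz0 := hz.1
  have hz' := R.inv_mem_oddPart (neg_ne_zero.2 hz0) (hneg hz.2.1) hcon
  have good : ∀ x ∈ oddPart T H, x * z ∉ T → -(x * z) ∉ T → -x ∈ oddPart T H := by
    intro x hx h1 h2
    by_contra hbad
    have hx0 := hx.1
    have hx' := R.inv_mem_oddPart (neg_ne_zero.2 hx0) (hneg hx.2.1) hbad
    have a1 := R.one_sub_mul_of_notMem hx hz h1
    have a2 := R.one_sub_mul_of_notMem hx' hz' (fun h => h1 (by
      apply R.left.of_inv
      rwa [show (x * z)⁻¹ = (-x)⁻¹ * (-z)⁻¹ by field_simp]))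
    apply h2
    have b1 := R.left.ne_zero a1
    refine R.left.mem_of_eq (R.left.mul_mem a1 a2) (z := x * z / (1 - x * z))
      (div_ne_zero (mul_ne_zero hx0 hz0) b1) ?_
    field_simp
    ring
  obtain ⟨g, hg⟩ := R.nonrigid
  have hg0 : g ≠ 0 := R.right.ne_zero hg.mem
  have hxH : g / z ∉ H := by
    rw [div_eq_mul_inv]
    exact R.mul_notMem_right hg.mem fun h => hz.2.1 (R.right.of_inv h)
  by_cases hx : g / z ∈ oddPart T H
  · have e : g / z * z = g := by field_simp
    have h1 := good _ hx (by rw [e]; exact hg.notMem) (by rw [e]; exact hg.neg_notMem)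
    have h2 := R.one_sub_mul_of_notMem h1 hz (by rw [neg_mul, e]; exact hg.neg_notMem)
    apply hg.one_add_notMem
    rwa [neg_mul, e, sub_neg_eq_add] at h2
  · have hx' := R.inv_mem_oddPart (div_ne_zero hg0 hz0) hxH hx
    have h1 := good _ hx'
      (fun h => hg.notMem (R.left.mem_of_eq (R.left.inv_mem h) hz0 (by field_simp)))
      (fun h => hg.neg_notMem (R.left.mem_of_eq (R.left.inv_mem h) hz0 (by
        field_simp)))
    have h2 := R.one_sub_mul_of_notMem hx' hz' (fun h => hg.neg_notMem
      (R.left.mem_of_eq (R.left.inv_mem h) (one_ne_zero) (by field_simp)))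
    apply hg.mul_one_add_notMem
    refine R.left.mem_of_eq h2 hg0 ?_
    field_simp
    ring

theorem div_nonrigid_mem {g x : F} (hg : NonrigidElt T H g) (hx : x ∈ oddPart T H) :
    x / g ∈ oddPart T H := by
  have hg0 : g ≠ 0 := R.right.ne_zero hg.mem
  have hx0 := hx.1
  have hH : g / x ∉ H := by
    rw [div_eq_mul_inv]
    exact R.mul_notMem_right hg.mem fun h => hx.2.1 (R.right.of_inv h)
  by_cases hw : g / x ∈ oddPart T H
  · exfalso
    have e : g / x * -x = -g := by field_simp
    have h2 := R.one_sub_mul_of_notMem hw (R.neg_mem_oddPart hx) (by rw [e]; exact hg.neg_notMem)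
    apply hg.one_add_notMem
    rwa [e, sub_neg_eq_add] at h2
  · simpa using R.inv_mem_oddPart (div_ne_zero hg0 hx0) hH hw

theorem mul_nonrigid_mem {g x : F} (hg : NonrigidElt T H g) (hx : x ∈ oddPart T H) :
    x * g ∈ oddPart T H := by
  simpa using R.div_nonrigid_mem (hg.inv R.left R.right) hx

theorem one_sub_mul_mem {x y : F} (hx : x ∈ oddPart T H) (hy : y ∈ oddPart T H) :
    1 - x * y ∈ T := by
  obtain ⟨g, hg⟩ := R.nonrigid
  have hg0 : g ≠ 0 := R.right.ne_zero hg.mem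
  have hx0 := hx.1
  rcases R.one_sub_mul_aux hx hy with h | h
  · exact h
  have e : x * g * (y / g) = x * y := by field_simp
  rcases R.one_sub_mul_aux (R.mul_nonrigid_mem hg hx) (R.div_nonrigid_mem hg hy) with h' | h' <;>
    rw [e] at h'
  · exact h'
  exfalso
  apply hg.notMem
  have hne : 1 - x * y ≠ 0 := right_ne_zero_of_mul (R.left.ne_zero h)
  refine R.left.mem_of_eq (R.left.mul_mem h h') (z := (x * (1 - x * y))⁻¹)
    (inv_ne_zero (mul_ne_zero hx0 hne)) ?_
  field_simp

theorem mul_mul_mem {x y z : F} (hx : x ∈ oddPart T H) (hy : y ∈ oddPart T H)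
    (hz : z ∈ oddPart T H) : x * y * z ∈ oddPart T H := by
  obtain ⟨g, hg⟩ := R.nonrigid
  have hg0 : g ≠ 0 := R.right.ne_zero hg.mem
  have aux : ∀ {x y z : F}, x ∈ oddPart T H → y ∈ oddPart T H → z ∈ oddPart T H →
      1 + x * y * z ∈ T ∨ -x * (1 + x * y * z) ∈ T := by
    intro x y z hx hy hz
    have h1 := R.one_sub_mul_mem hy hz
    have h2 : -(x * (1 - y * z)) ∉ H := by
      rw [show -(x * (1 - y * z)) = (-1 * (1 - y * z)) * x by ring]
      exact R.mul_notMem_right (R.right.mul_mem R.neg_one (R.le h1)) hx.2.1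
    have e : 1 + x + -(x * (1 - y * z)) = 1 + x * y * z := by ring
    rcases R.add_rigid hx.2.2 (neg_ne_zero.2 (mul_ne_zero hx.1 (R.left.ne_zero h1))) h2
      with h | h <;> rw [e] at h
    · exact Or.inl h
    · right
      apply R.left.of_mul_left h1
      rwa [show (1 - y * z) * (-x * (1 + x * y * z)) =
        -(x * (1 - y * z)) * (1 + x * y * z) by ring]
  have hx0 := hx.1
  have hy0 := hy.1
  have hz0 := hz.1
  refine ⟨mul_ne_zero (mul_ne_zero hx0 hy0) hz0,
    R.mul_notMem_right (R.index hx0 hy0 hx.2.1 hy.2.1) hz.2.1, ?_⟩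
  rcases aux hx hy hz with h | h
  · exact h
  have e : x * g * (y / g) * z = x * y * z := by field_simp
  rcases aux (R.mul_nonrigid_mem hg hx) (R.div_nonrigid_mem hg hy) hz with h' | h' <;>
    rw [e] at h'
  · exact h'
  exfalso
  apply hg.notMem
  have hne : 1 + x * y * z ≠ 0 := right_ne_zero_of_mul (R.left.ne_zero h)
  refine R.left.mem_of_eq (R.left.mul_mem h h') (z := (x * (1 + x * y * z))⁻¹)
    (inv_ne_zero (mul_ne_zero hx0 hne)) ?_
  field_simp

theorem mul_mem_evenPart {x y : F} (hx : x ∈ oddPart T H) (hy : y ∈ oddPart T H) :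
    x * y ∈ evenPart T H :=
  ⟨R.index hx.1 hy.1 hx.2.1 hy.2.1, fun _ hz => R.mul_mul_mem hx hy hz⟩

theorem evenPart_mul {a b : F} (ha : a ∈ evenPart T H) (hb : b ∈ evenPart T H) :
    a * b ∈ evenPart T H :=
  ⟨R.right.mul_mem ha.1 hb.1, fun x hx => by rw [mul_assoc]; exact ha.2 _ (hb.2 _ hx)⟩

theorem neg_one_mem_evenPart : (-1 : F) ∈ evenPart T H :=
  ⟨R.neg_one, fun x hx => by rw [neg_one_mul]; exact R.neg_mem_oddPart hx⟩

theorem one_mem_evenPart : (1 : F) ∈ evenPart T H :=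
  ⟨R.right.one_mem, fun x hx => by rwa [one_mul]⟩

theorem nonrigid_mem_evenPart {g : F} (hg : NonrigidElt T H g) : g ∈ evenPart T H :=
  ⟨hg.mem, fun x hx => by rw [mul_comm]; exact R.mul_nonrigid_mem hg hx⟩

theorem exists_of_notMem_evenPart {a : F} (ha : a ∈ H) (h : a ∉ evenPart T H) :
    ∃ y ∈ oddPart T H, (a * y)⁻¹ ∈ oddPart T H := by
  have : ¬ ∀ x ∈ oddPart T H, a * x ∈ oddPart T H := fun h' => h ⟨ha, h'⟩
  push Not at this
  obtain ⟨y, hy, hay⟩ := this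
  exact ⟨y, hy, R.inv_mem_oddPart (mul_ne_zero (R.right.ne_zero ha) hy.1)
    (R.mul_notMem_right ha hy.2.1) hay⟩

theorem evenPart_total {a : F} (ha : a ∈ H) : a ∈ evenPart T H ∨ a⁻¹ ∈ evenPart T H := by
  by_cases h : a ∈ evenPart T H
  · exact Or.inl h
  obtain ⟨y, hy, hay⟩ := R.exists_of_notMem_evenPart ha h
  right
  have := R.mul_mem_evenPart hy hay
  have h0 := hy.1
  have h1 := R.right.ne_zero ha
  rwa [show y * (a * y)⁻¹ = a⁻¹ by field_simp] at this

theorem ringSet_total {x : F} : x ∈ ringSet T H ∨ x⁻¹ ∈ ringSet T H := by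
  by_cases h0 : x = 0
  · exact Or.inl (Or.inr h0)
  by_cases hH : x ∈ H
  · exact (R.evenPart_total hH).imp (fun h => Or.inl (Or.inr h)) (fun h => Or.inl (Or.inr h))
  by_cases hx : x ∈ oddPart T H
  · exact Or.inl (Or.inl (Or.inl hx))
  · exact Or.inr (Or.inl (Or.inl (R.inv_mem_oddPart h0 hH hx)))

theorem ringSet_mul {x y : F} (hx : x ∈ ringSet T H) (hy : y ∈ ringSet T H) :
    x * y ∈ ringSet T H := by
  rcases hx with (hx | hx) | hx
  · rcases hy with (hy | hy) | hy
    · exact Or.inl (Or.inr (R.mul_mem_evenPart hx hy))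
    · exact Or.inl (Or.inl (mul_comm x y ▸ hy.2 _ hx))
    · rw [show y = 0 from hy, mul_zero]; exact Or.inr rfl
  · rcases hy with (hy | hy) | hy
    · exact Or.inl (Or.inl (hx.2 _ hy))
    · exact Or.inl (Or.inr (R.evenPart_mul hx hy))
    · rw [show y = 0 from hy, mul_zero]; exact Or.inr rfl
  · rw [show x = 0 from hx, zero_mul]; exact Or.inr rfl

theorem one_add_mem_of_oddPart {x : F} (hx : x ∈ oddPart T H) : 1 + x ∈ evenPart T H := by
  by_contra hcon
  obtain ⟨y, hy, hb⟩ := R.exists_of_notMem_evenPart (R.le hx.2.2) hcon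
  have h := R.one_sub_mul_mem hy hb
  have h0 := R.left.ne_zero hx.2.2
  have hy0 := hy.1
  apply hx.2.1
  apply R.le
  have := R.left.mul_mem hx.2.2 h
  rwa [show (1 + x) * (1 - y * ((1 + x) * y)⁻¹) = x by field_simp; ring] at this

theorem one_add_mem_of_evenPart_notMem {a : F} (ha : a ∈ evenPart T H) (haT : a ∉ T) :
    1 + a ∈ ringSet T H := by
  by_contra hcon
  have he0 : 1 + a ≠ 0 := fun h => hcon (Or.inr h)
  have hb := R.ringSet_total.resolve_left hcon
  rcases hb with (hb | hb) | hb
  · have h1 := (R.neg_mem_oddPart hb).2.2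
    have h2 := ha.2 _ hb
    apply h2.2.1
    apply R.le
    rwa [show a * (1 + a)⁻¹ = 1 + -(1 + a)⁻¹ by field_simp; ring]
  · have heH : 1 + a ∈ H := R.right.of_inv hb.1
    obtain ⟨y, hy, hd⟩ := R.exists_of_notMem_evenPart heH (fun h => hcon (Or.inl (Or.inr h)))
    have hya := ha.2 _ hy
    have e1 : 1 + y + a * y = 1 + (1 + a) * y := by ring
    have e2 : 1 + a * y + y = 1 + (1 + a) * y := by ring
    have hne : 1 + (1 + a) * y ∉ T := fun h =>
      R.inv_notMem_oddPart hd (by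
        rw [inv_inv]
        exact ⟨mul_ne_zero he0 hy.1, R.mul_notMem_right heH hy.2.1, h⟩)
    have h1 := (R.add_rigid hy.2.2 hya.1 hya.2.1).resolve_left (by rwa [e1])
    have h2 := (R.add_rigid hya.2.2 hy.1 hy.2.1).resolve_left (by rwa [e2])
    rw [e1] at h1
    rw [e2] at h2
    apply haT
    have n1 : 1 + (1 + a) * y ≠ 0 := right_ne_zero_of_mul (R.left.ne_zero h2)
    have n2 := hy.1
    apply R.left.of_mul_right (R.left.sq_mem (mul_ne_zero n2 n1))
    have := R.left.mul_mem h1 h2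
    rwa [show a * y * (1 + (1 + a) * y) * (y * (1 + (1 + a) * y)) =
      a * (y * (1 + (1 + a) * y)) ^ 2 by ring] at this
  · exact inv_ne_zero he0 hb

theorem one_add_mem_of_evenPart {a : F} (ha : a ∈ evenPart T H) : 1 + a ∈ ringSet T H := by
  by_cases haT : a ∉ T
  · exact R.one_add_mem_of_evenPart_notMem ha haT
  rw [not_not] at haT
  by_contra hcon
  have he0 : 1 + a ≠ 0 := fun h => hcon (Or.inr h)
  have hb := R.ringSet_total.resolve_left hcon
  rcases hb with (hb | hb) | hb
  · have h1 := (R.neg_mem_oddPart hb).2.2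
    have h2 := ha.2 _ hb
    apply h2.2.1
    apply R.le
    rwa [show a * (1 + a)⁻¹ = 1 + -(1 + a)⁻¹ by field_simp; ring]
  · have heH : 1 + a ∈ H := R.right.of_inv hb.1
    obtain ⟨y, hy, hd⟩ := R.exists_of_notMem_evenPart heH (fun h => hcon (Or.inl (Or.inr h)))
    have hy0 := hy.1
    have key : ∀ q ∈ ringSet T H, 1 + (1 + a)⁻¹ * q ∈ T := by
      have e : (1 + a)⁻¹ = ((1 + a) * y)⁻¹ * y := by field_simp
      rintro q ((hq | hq) | hq)
      · have := (R.mul_mul_mem hd hy hq).2.2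
        rwa [e]
      · have := R.one_sub_mul_mem hd (R.neg_mem_oddPart (hq.2 _ hy))
        rw [e]
        rwa [show 1 - ((1 + a) * y)⁻¹ * -(q * y) = 1 + ((1 + a) * y)⁻¹ * y * q by ring] at this
      · rw [show q = 0 from hq, mul_zero, add_zero]; exact R.left.one_mem
    have heT : 1 + a ∈ T := by
      have := key (-1) (Or.inl (Or.inr R.neg_one_mem_evenPart))
      rw [show 1 + (1 + a)⁻¹ * -1 = a * (1 + a)⁻¹ by field_simp; ring] at this
      exact R.left.of_inv (R.left.of_mul_left haT this)
    obtain ⟨g, hg⟩ := R.nonrigid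
    have hg0 := R.right.ne_zero hg.mem
    have h1 : -1 * (a * g⁻¹) ∈ evenPart T H := R.evenPart_mul R.neg_one_mem_evenPart
      (R.evenPart_mul ha (R.nonrigid_mem_evenPart (hg.inv R.left R.right)))
    have h2 := R.one_add_mem_of_evenPart_notMem h1 (fun h => by
      apply hg.neg_notMem
      have ha0 := R.left.ne_zero haT
      exact R.left.mem_of_eq (R.left.mul_mem h haT) (z := g / a) (div_ne_zero hg0 ha0)
        (by field_simp))
    have h3 := R.ringSet_mul (Or.inl (Or.inr (R.nonrigid_mem_evenPart hg))) h2
    have h4 := R.left.mul_mem heT (key _ h3)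
    apply hg.one_add_notMem
    rwa [show (1 + a) * (1 + (1 + a)⁻¹ * (g * (1 + -1 * (a * g⁻¹)))) = 1 + g by
      field_simp; ring] at h4
  · exact inv_ne_zero he0 hb

theorem one_add_mem_ringSet {a : F} (ha : a ∈ ringSet T H) : 1 + a ∈ ringSet T H := by
  rcases ha with (ha | ha) | ha
  · exact Or.inl (Or.inr (R.one_add_mem_of_oddPart ha))
  · exact R.one_add_mem_of_evenPart ha
  · rw [show a = 0 from ha, add_zero]; exact Or.inl (Or.inr R.one_mem_evenPart)

theorem add_mem_ringSet {x y : F} (hx : x ∈ ringSet T H) (hy : y ∈ ringSet T H) :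
    x + y ∈ ringSet T H := by
  by_cases hx0 : x = 0
  · rwa [hx0, zero_add]
  by_cases hy0 : y = 0
  · rwa [hy0, add_zero]
  rcases R.ringSet_total (x := x / y) with h | h
  · have := R.ringSet_mul hy (R.one_add_mem_ringSet h)
    rwa [show y * (1 + x / y) = x + y by field_simp; ring] at this
  · have := R.ringSet_mul hx (R.one_add_mem_ringSet h)
    rwa [show x * (1 + (x / y)⁻¹) = x + y by field_simp] at this

/-- The valuation ring attached to a rigid pair. -/
def valuationSubring : ValuationSubring F where
  carrier := ringSet T H
  mul_mem' := R.ringSet_mul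
  one_mem' := Or.inl (Or.inr R.one_mem_evenPart)
  add_mem' := R.add_mem_ringSet
  zero_mem' := Or.inr rfl
  neg_mem' := fun {x} hx => by
    rw [← neg_one_mul]
    exact R.ringSet_mul (Or.inl (Or.inr R.neg_one_mem_evenPart)) hx
  mem_or_inv_mem' := fun _ => R.ringSet_total

theorem inv_notMem_ringSet {x : F} (hx : x ∈ oddPart T H) : x⁻¹ ∉ ringSet T H := by
  rintro ((h | h) | h)
  · exact R.inv_notMem_oddPart hx h
  · exact hx.2.1 (R.right.of_inv h.1)
  · exact inv_ne_zero hx.1 h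

/-- The valuation produced by a rigid pair. -/
theorem exists_valuationSubring : ∃ B : ValuationSubring F, B ≠ ⊤ ∧
    (∀ x, B.valuation x < 1 → 1 + x ∈ T) ∧ (∀ x, B.valuation x = 1 → x ∈ H) := by
  refine ⟨R.valuationSubring, ?_, ?_, ?_⟩
  · intro h
    obtain ⟨x, h0, hH⟩ := R.nontrivial
    have hall : ∀ z : F, z ∈ ringSet T H := fun z => by
      have : z ∈ R.valuationSubring := h ▸ ValuationSubring.mem_top z
      exact this
    by_cases hx : x ∈ oddPart T H
    · exact R.inv_notMem_ringSet hx (hall _)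
    · exact R.inv_notMem_ringSet (R.inv_mem_oddPart h0 hH hx) (hall _)
  · intro x hx
    have h1 : x ∈ ringSet T H := (ValuationSubring.valuation_le_one_iff _ _).1 hx.le
    by_cases h0 : x = 0
    · rw [h0, add_zero]; exact R.left.one_mem
    have h2 : x⁻¹ ∉ ringSet T H := fun h => by
      have : R.valuationSubring.valuation x⁻¹ ≤ 1 :=
        (ValuationSubring.valuation_le_one_iff _ _).2 h
      rw [map_inv₀] at this
      have h3 : R.valuationSubring.valuation x ≠ 0 := (Valuation.ne_zero_iff _).2 h0
      exact absurd ((inv_le_one₀ (zero_lt_iff.2 h3)).1 this) (not_le.2 hx)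
    rcases h1 with (h1 | h1) | h1
    · exact h1.2.2
    · obtain ⟨y, hy, hd⟩ := R.exists_of_notMem_evenPart (R.right.inv_mem h1.1)
        (fun h => h2 (Or.inl (Or.inr h)))
      have := R.one_sub_mul_mem hy (R.neg_mem_oddPart hd)
      have hy0 := hy.1
      rwa [show 1 - y * -(x⁻¹ * y)⁻¹ = 1 + x by field_simp; ring] at this
    · exact absurd h1 h0
  · intro x hx
    have h1 : x ∈ ringSet T H := (ValuationSubring.valuation_le_one_iff _ _).1 hx.le
    have h2 : x⁻¹ ∈ ringSet T H :=
      (ValuationSubring.valuation_le_one_iff R.valuationSubring _).1 (by rw [map_inv₀, hx, inv_one])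
    have h0 : x ≠ 0 := fun h => by simp [h] at hx
    rcases h1 with (h1 | h1) | h1
    · exact absurd h2 (R.inv_notMem_ringSet h1)
    · exact h1.1
    · exact absurd h1 h0

end RigidPair

end

noncomputable section

namespace ValuationSubring

variable {F : Type*} [Field F] (A : ValuationSubring F)

theorem valuation_lt_one_iff_inv_notMem {x : F} (hx : x ≠ 0) :
    A.valuation x < 1 ↔ x⁻¹ ∉ A := by
  rw [← A.valuation_le_one_iff, map_inv₀, not_le, one_lt_inv₀]
  exact zero_lt_iff.2 ((Valuation.ne_zero_iff _).2 hx)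

theorem one_lt_valuation_iff {x : F} : 1 < A.valuation x ↔ x ∉ A := by
  rw [← A.valuation_le_one_iff, not_le]

theorem valuation_pos {x : F} (hx : x ≠ 0) : 0 < A.valuation x :=
  zero_lt_iff.2 ((Valuation.ne_zero_iff _).2 hx)

theorem valuation_one_add {x : F} (hx : A.valuation x < 1) : A.valuation (1 + x) = 1 := by
  rw [Valuation.map_add_eq_of_lt_left _ (by simpa using hx), map_one]

theorem ne_zero_of_valuation_eq_one {x : F} (hx : A.valuation x = 1) : x ≠ 0 := by
  rintro rfl; simp at hx

theorem valuation_eq_one_of_sub {m : F} (hm : A.valuation (m - 1) < 1) : A.valuation m = 1 := by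
  have := A.valuation_one_add hm
  rwa [add_sub_cancel] at this

/-- Elements of the form (one-unit) times (nonzero square). -/
def oneUnitSq : Set F := {x | ∃ m y, A.valuation (m - 1) < 1 ∧ y ≠ 0 ∧ x = m * y ^ 2}

/-- Elements of the form (unit) times (nonzero square). -/
def unitSq : Set F := {x | ∃ u y, A.valuation u = 1 ∧ y ≠ 0 ∧ x = u * y ^ 2}

theorem isSqGroup_oneUnitSq : IsSqGroup A.oneUnitSq where
  ne_zero := by
    rintro _ ⟨m, y, hm, hy, rfl⟩
    exact mul_ne_zero (A.ne_zero_of_valuation_eq_one (A.valuation_eq_one_of_sub hm))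
      (pow_ne_zero _ hy)
  mul_mem := by
    rintro _ _ ⟨m, y, hm, hy, rfl⟩ ⟨n, z, hn, hz, rfl⟩
    refine ⟨m * n, y * z, ?_, mul_ne_zero hy hz, by ring⟩
    rw [show m * n - 1 = m * (n - 1) + (m - 1) by ring]
    apply Valuation.map_add_lt _ _ hm
    rwa [map_mul, A.valuation_eq_one_of_sub hm, one_mul]
  sq_mem := fun {x} hx => ⟨1, x, by simp, hx, by ring⟩

theorem isSqGroup_unitSq : IsSqGroup A.unitSq where
  ne_zero := by
    rintro _ ⟨m, y, hm, hy, rfl⟩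
    exact mul_ne_zero (A.ne_zero_of_valuation_eq_one hm) (pow_ne_zero _ hy)
  mul_mem := by
    rintro _ _ ⟨m, y, hm, hy, rfl⟩ ⟨n, z, hn, hz, rfl⟩
    exact ⟨m * n, y * z, by rw [map_mul, hm, hn, one_mul], mul_ne_zero hy hz, by ring⟩
  sq_mem := fun {x} hx => ⟨1, x, by simp, hx, by ring⟩

theorem oneUnitSq_subset : A.oneUnitSq ⊆ A.unitSq := by
  rintro _ ⟨m, y, hm, hy, rfl⟩
  exact ⟨m, y, A.valuation_eq_one_of_sub hm, hy, rfl⟩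

theorem mem_unitSq_of_valuation {u : F} (hu : A.valuation u = 1) : u ∈ A.unitSq :=
  ⟨u, 1, hu, one_ne_zero, by ring⟩

theorem one_add_mem_oneUnitSq {x : F} (hx : A.valuation x < 1) : 1 + x ∈ A.oneUnitSq :=
  ⟨1 + x, 1, by simpa using hx, one_ne_zero, by ring⟩

theorem neg_one_mem_unitSq : (-1 : F) ∈ A.unitSq := A.mem_unitSq_of_valuation (by simp)

theorem oneUnitSq_subset_iff {T : Set F} (hT : IsSqGroup T) :
    A.oneUnitSq ⊆ T ↔ ∀ x, A.valuation x < 1 → 1 + x ∈ T := by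
  refine ⟨fun h x hx => h (A.one_add_mem_oneUnitSq hx), fun h => ?_⟩
  rintro _ ⟨m, y, hm, hy, rfl⟩
  have := h _ hm
  rw [add_sub_cancel] at this
  exact hT.mul_mem this (hT.sq_mem hy)

theorem unitSq_subset_iff {T : Set F} (hT : IsSqGroup T) :
    A.unitSq ⊆ T ↔ ∀ x, A.valuation x = 1 → x ∈ T := by
  refine ⟨fun h x hx => h (A.mem_unitSq_of_valuation hx), fun h => ?_⟩
  rintro _ ⟨m, y, hm, hy, rfl⟩
  exact hT.mul_mem (h _ hm) (hT.sq_mem hy)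

theorem rigid_of_notMem_unitSq {x : F} (hx0 : x ≠ 0) (hx : x ∉ A.unitSq) :
    1 + x ∈ A.oneUnitSq ∨ x * (1 + x) ∈ A.oneUnitSq := by
  have h1 : A.valuation x ≠ 1 := fun h => hx (A.mem_unitSq_of_valuation h)
  rcases lt_or_gt_of_ne h1 with h | h
  · exact Or.inl (A.one_add_mem_oneUnitSq h)
  · right
    have h2 : A.valuation x⁻¹ < 1 := by
      rw [map_inv₀]; exact inv_lt_one_of_one_lt₀ h
    exact A.isSqGroup_oneUnitSq.mem_of_eq (A.one_add_mem_oneUnitSq h2) hx0 (by field_simp; ring)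

/-- The class of valuations to which the transfer theorem for Witt equivalences applies. -/
structure IsNice : Prop where
  arch : ∀ c, c ≠ 0 → A.valuation c < 1 → ∀ z, ∃ n : ℕ, A.valuation (z * c ^ n) ≤ 1
  index : ∀ {x y : F}, x ≠ 0 → y ≠ 0 → x ∉ A.unitSq → y ∉ A.unitSq → x * y ∈ A.unitSq
  nontrivial : ∃ x : F, x ≠ 0 ∧ x ∉ A.unitSq
  nonrigid : ∃ g, NonrigidElt A.oneUnitSq A.unitSq g

variable {A}

theorem IsNice.rigidPair (h : A.IsNice) : RigidPair A.oneUnitSq A.unitSq where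
  left := A.isSqGroup_oneUnitSq
  right := A.isSqGroup_unitSq
  le := A.oneUnitSq_subset
  neg_one := A.neg_one_mem_unitSq
  index := h.index
  nontrivial := h.nontrivial
  rigid := A.rigid_of_notMem_unitSq
  nonrigid := h.nonrigid

theorem IsNice.exists_forall_one_lt (h : A.IsNice) {y c : F} (hy : 1 < A.valuation y)
    (hc : c ≠ 0) : ∃ N : ℕ, ∀ n, N ≤ n → 1 < A.valuation (c * y ^ n) := by
  have hy0 : y ≠ 0 := by rintro rfl; simp at hy
  obtain ⟨n, hn⟩ := h.arch y⁻¹ (inv_ne_zero hy0)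
    (by rw [map_inv₀]; exact inv_lt_one_of_one_lt₀ hy) c⁻¹
  have h1 : 1 ≤ A.valuation (c * y ^ n) := by
    rw [show c⁻¹ * y⁻¹ ^ n = (c * y ^ n)⁻¹ by rw [mul_inv, inv_pow], map_inv₀] at hn
    exact (inv_le_one₀ (A.valuation_pos (mul_ne_zero hc (pow_ne_zero _ hy0)))).1 hn
  refine ⟨n + 1, fun m hm => ?_⟩
  obtain ⟨k, rfl⟩ := Nat.exists_eq_add_of_le hm
  rw [show c * y ^ (n + 1 + k) = (c * y ^ n) * (y * y ^ k) by ring, map_mul, map_mul _ y, map_pow _ y k]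
  have h2 : 1 < A.valuation y * A.valuation y ^ k :=
    lt_of_lt_of_le hy (le_mul_of_one_le_right' (one_le_pow_of_one_le' hy.le k))
  exact lt_of_lt_of_le h2 (le_mul_of_one_le_left' h1)

end ValuationSubring

/-- The relation that the square class of `x` is mapped to that of `y` for a Witt equivalence. -/
structure IsWittRel {K L : Type*} [Field K] [Field L] (R : K → L → Prop) : Prop where
  ne_left : ∀ {x y}, R x y → x ≠ 0
  ne_right : ∀ {x y}, R x y → y ≠ 0
  total_left : ∀ {x}, x ≠ 0 → ∃ y, R x y
  total_right : ∀ {y}, y ≠ 0 → ∃ x, R x y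
  mul : ∀ {x y x' y'}, R x y → R x' y' → R (x * x') (y * y')
  one : R 1 1
  neg_one : R (-1) (-1)
  sq_left : ∀ {x x' y}, R x y → R x' y → ∃ s, s ≠ 0 ∧ x' = x * s ^ 2
  sq_right : ∀ {x y y'}, R x y → R x y' → ∃ s, s ≠ 0 ∧ y' = y * s ^ 2
  mul_sq_left : ∀ {x y s}, R x y → s ≠ 0 → R (x * s ^ 2) y
  mul_sq_right : ∀ {x y s}, R x y → s ≠ 0 → R x (y * s ^ 2)
  represents : ∀ {a b c a' b' c'}, R a a' → R b b' → R c c' →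
    ((∃ x y, c = a * x ^ 2 + b * y ^ 2) ↔ (∃ x y, c' = a' * x ^ 2 + b' * y ^ 2))

theorem sqCl_eq_iff {K : Type*} [Field K] {u w : Kˣ} :
    sqCl u = sqCl w ↔ ∃ s : Kˣ, w = u * s ^ 2 := by
  unfold sqCl
  rw [QuotientGroup.eq]
  constructor
  · rintro ⟨s, hs⟩
    refine ⟨s, ?_⟩
    rw [show s ^ 2 = u⁻¹ * w from hs, mul_inv_cancel_left]
  · rintro ⟨s, rfl⟩
    exact ⟨s, by simp⟩

theorem IsWittEquiv.exists_rel {K L : Type*} [Field K] [Field L]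
    {α : SqClass K ≃* SqClass L} (h : IsWittEquiv α) :
    IsWittRel (fun (x : K) (y : L) => ∃ (u : Kˣ) (w : Lˣ), (u : K) = x ∧ (w : L) = y ∧
      α (sqCl u) = sqCl w) where
  ne_left := by rintro _ _ ⟨u, w, rfl, rfl, -⟩; exact u.ne_zero
  ne_right := by rintro _ _ ⟨u, w, rfl, rfl, -⟩; exact w.ne_zero
  total_left := by
    intro x hx
    obtain ⟨w, hw⟩ := QuotientGroup.mk_surjective (α (sqCl (Units.mk0 x hx)))
    exact ⟨w, Units.mk0 x hx, w, rfl, rfl, hw.symm⟩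
  total_right := by
    intro y hy
    obtain ⟨u, hu⟩ := QuotientGroup.mk_surjective (α.symm (sqCl (Units.mk0 y hy)))
    refine ⟨u, u, Units.mk0 y hy, rfl, rfl, ?_⟩
    rw [show sqCl u = α.symm (sqCl (Units.mk0 y hy)) from hu, MulEquiv.apply_symm_apply]
  mul := by
    rintro _ _ _ _ ⟨u, w, rfl, rfl, h1⟩ ⟨u', w', rfl, rfl, h2⟩
    refine ⟨u * u', w * w', by simp, by simp, ?_⟩
    rw [show sqCl (u * u') = sqCl u * sqCl u' from rfl, map_mul, h1, h2]; rfl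
  one := ⟨1, 1, rfl, rfl, map_one α⟩
  neg_one := ⟨-1, -1, by simp, by simp, h.map_neg_one⟩
  sq_left := by
    rintro _ _ _ ⟨u, w, rfl, rfl, h1⟩ ⟨u', w', rfl, h3, h2⟩
    obtain rfl : w' = w := Units.ext h3
    obtain ⟨s, rfl⟩ := sqCl_eq_iff.1 (α.injective (h1.trans h2.symm))
    exact ⟨s, s.ne_zero, by simp⟩
  sq_right := by
    rintro _ _ _ ⟨u, w, rfl, rfl, h1⟩ ⟨u', w', h3, rfl, h2⟩
    obtain rfl : u' = u := Units.ext h3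
    obtain ⟨s, rfl⟩ := sqCl_eq_iff.1 (h1.symm.trans h2)
    exact ⟨s, s.ne_zero, by simp⟩
  mul_sq_left := by
    rintro _ _ s ⟨u, w, rfl, rfl, h1⟩ hs
    refine ⟨u * Units.mk0 s hs ^ 2, w, by simp, rfl, ?_⟩
    rw [← h1, ← sqCl_eq_iff.2 ⟨Units.mk0 s hs, rfl⟩]
  mul_sq_right := by
    rintro _ _ s ⟨u, w, rfl, rfl, h1⟩ hs
    refine ⟨u, w * Units.mk0 s hs ^ 2, rfl, by simp, ?_⟩
    rw [h1, sqCl_eq_iff.2 ⟨Units.mk0 s hs, rfl⟩]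
  represents := by
    rintro _ _ _ _ _ _ ⟨a, a', rfl, rfl, h1⟩ ⟨b, b', rfl, rfl, h2⟩ ⟨c, c', rfl, rfl, h3⟩
    exact h.represents a b c a' b' c' h1 h2 h3

/-- The image of a set under a relation. -/
def relImage {K L : Type*} (R : K → L → Prop) (T : Set K) : Set L := {y | ∃ x ∈ T, R x y}

/-- Every element of `H` is represented by each binary form `t + x s` with `x ∈ H \ T`. -/
def IsUniversalPair {F : Type*} [Field F] (T H : Set F) : Prop :=
  ∀ x ∈ H, x ∉ T → ∀ c ∈ H, ∃ t s, (t ∈ T ∨ t = 0) ∧ (s ∈ T ∨ s = 0) ∧ c = t + x * s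

namespace IsWittRel

variable {K L : Type*} [Field K] [Field L] {R : K → L → Prop} (hR : IsWittRel R)
include hR

theorem flip : IsWittRel (fun y x => R x y) where
  ne_left := hR.ne_right
  ne_right := hR.ne_left
  total_left := hR.total_right
  total_right := hR.total_left
  mul := hR.mul
  one := hR.one
  neg_one := hR.neg_one
  sq_left := hR.sq_right
  sq_right := hR.sq_left
  mul_sq_left := hR.mul_sq_right
  mul_sq_right := hR.mul_sq_left
  represents := fun h1 h2 h3 => (hR.represents h1 h2 h3).symm

theorem mem_relImage {T : Set K} (hT : IsSqGroup T) {x : K} {y : L} (h : R x y) :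
    y ∈ relImage R T ↔ x ∈ T := by
  constructor
  · rintro ⟨x', hx', h'⟩
    obtain ⟨s, hs, rfl⟩ := hR.sq_left h' h
    exact hT.mul_mem hx' (hT.sq_mem hs)
  · exact fun hx => ⟨x, hx, h⟩

theorem isSqGroup_relImage {T : Set K} (hT : IsSqGroup T) : IsSqGroup (relImage R T) where
  ne_zero := by rintro y ⟨x, -, h⟩; exact hR.ne_right h
  mul_mem := by
    rintro y y' ⟨x, hx, h⟩ ⟨x', hx', h'⟩
    exact ⟨x * x', hT.mul_mem hx hx', hR.mul h h'⟩
  sq_mem := fun {y} hy => ⟨1, hT.one_mem, by simpa using hR.mul_sq_right hR.one hy⟩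

theorem relImage_flip {T : Set K} (hT : IsSqGroup T) :
    relImage (fun y x => R x y) (relImage R T) = T := by
  ext x
  constructor
  · rintro ⟨y, hy, h⟩
    exact (hR.mem_relImage hT h).1 hy
  · intro hx
    obtain ⟨y, hy⟩ := hR.total_left (hT.ne_zero hx)
    exact ⟨y, ⟨x, hx, hy⟩, hy⟩

theorem neg {x : K} {y : L} (h : R x y) : R (-x) (-y) := by
  simpa using hR.mul hR.neg_one h

theorem nonrigidElt {T H : Set K} (hT : IsSqGroup T) (hH : IsSqGroup H) {g : K}
    (hg : NonrigidElt T H g) :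
    ∃ g', NonrigidElt (relImage R T) (relImage R H) g' := by
  have hg0 := hH.ne_zero hg.mem
  obtain ⟨y, hy⟩ := hR.total_left hg.one_add_ne
  obtain ⟨g', hg'⟩ := hR.total_left hg0
  obtain ⟨X, Y, e⟩ := (hR.represents hR.one hg' hy).1 ⟨1, 1, by ring⟩
  have hy0 := hR.ne_right hy
  have hg'0 := hR.ne_right hg'
  have hT' := hR.isSqGroup_relImage hT
  have hX : X ≠ 0 := by
    rintro rfl
    apply hg.mul_one_add_notMem
    rw [← hR.mem_relImage hT (hR.mul hg' hy)]
    have hY : Y ≠ 0 := by rintro rfl; simp at e; exact hy0 e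
    rw [show g' * y = (g' * Y) ^ 2 by rw [e]; ring]
    exact hT'.sq_mem (mul_ne_zero hg'0 hY)
  have hY : Y ≠ 0 := by
    rintro rfl
    apply hg.one_add_notMem
    rw [← hR.mem_relImage hT hy, show y = X ^ 2 by rw [e]; ring]
    exact hT'.sq_mem hX
  have h1 : R g (g' * (Y / X) ^ 2) := hR.mul_sq_right hg' (div_ne_zero hY hX)
  have h2 : R (1 + g) (1 + g' * (Y / X) ^ 2) := by
    have := hR.mul_sq_right hy (inv_ne_zero hX)
    rwa [show y * X⁻¹ ^ 2 = 1 + g' * (Y / X) ^ 2 by rw [e]; field_simp] at this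
  exact ⟨_, (hR.mem_relImage hH h1).2 hg.mem, fun h => hg.notMem ((hR.mem_relImage hT h1).1 h),
    fun h => hg.neg_notMem ((hR.mem_relImage hT (hR.neg h1)).1 h), hR.ne_right h2,
    fun h => hg.one_add_notMem ((hR.mem_relImage hT h2).1 h),
    fun h => hg.mul_one_add_notMem ((hR.mem_relImage hT (hR.mul h1 h2)).1 h)⟩

theorem rigidPair {T H : Set K} (P : RigidPair T H) :
    RigidPair (relImage R T) (relImage R H) where
  left := hR.isSqGroup_relImage P.left
  right := hR.isSqGroup_relImage P.right
  le := by rintro y ⟨x, hx, h⟩; exact ⟨x, P.le hx, h⟩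
  neg_one := ⟨-1, P.neg_one, hR.neg_one⟩
  index := by
    intro y y' hy hy' h h'
    obtain ⟨x, hx⟩ := hR.total_right hy
    obtain ⟨x', hx'⟩ := hR.total_right hy'
    rw [hR.mem_relImage P.right hx] at h
    rw [hR.mem_relImage P.right hx'] at h'
    exact ⟨_, P.index (hR.ne_left hx) (hR.ne_left hx') h h', hR.mul hx hx'⟩
  nontrivial := by
    obtain ⟨x, hx, h⟩ := P.nontrivial
    obtain ⟨y, hy⟩ := hR.total_left hx
    exact ⟨y, hR.ne_right hy, by rwa [hR.mem_relImage P.right hy]⟩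
  nonrigid := by
    obtain ⟨g, hg⟩ := P.nonrigid
    exact hR.nonrigidElt P.left P.right hg
  rigid := by
    intro y hy h
    obtain ⟨x, hx⟩ := hR.total_right hy
    have hx0 := hR.ne_left hx
    rw [hR.mem_relImage P.right hx] at h
    have h1 : 1 + y ≠ 0 := by
      intro e
      have : y = -1 := by linear_combination e
      rw [this] at hx
      exact h ((hR.mem_relImage P.right hx).1 ⟨-1, P.neg_one, hR.neg_one⟩)
    obtain ⟨w, hw⟩ := hR.total_right h1
    have hw0 := hR.ne_left hw
    obtain ⟨X, Y, e⟩ := (hR.represents hR.one hx hw).2 ⟨1, 1, by ring⟩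
    suffices hs : w ∈ T ∨ x * w ∈ T from
      hs.imp (fun h => ⟨_, h, hw⟩) (fun h => ⟨_, h, hR.mul hx hw⟩)
    by_cases hX : X = 0
    · right
      have hY : Y ≠ 0 := by rintro rfl; simp [hX] at e; exact hw0 e
      rw [show x * w = (x * Y) ^ 2 by rw [e, hX]; ring]
      exact P.left.sq_mem (mul_ne_zero hx0 hY)
    by_cases hY : Y = 0
    · left
      rw [show w = X ^ 2 by rw [e, hY]; ring]
      exact P.left.sq_mem hX
    have h2 : x * (Y / X) ^ 2 ∉ H := fun h' =>
      h (P.right.of_mul_right (P.right.sq_mem (div_ne_zero hY hX)) h')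
    rcases P.rigid (mul_ne_zero hx0 (pow_ne_zero _ (div_ne_zero hY hX))) h2 with h3 | h3
    · left
      exact P.left.mem_of_eq h3 hX (by rw [e]; field_simp)
    · right
      exact P.left.mem_of_eq h3 (z := X ^ 2 / Y) (div_ne_zero (pow_ne_zero _ hX) hY)
        (by rw [e]; field_simp)

theorem isUniversalPair {T H : Set K} (hT : IsSqGroup T) (hU : IsUniversalPair T H) :
    IsUniversalPair (relImage R T) (relImage R H) := by
  rintro x' ⟨x, hx, h⟩ hx' c' ⟨c, hc, hcc⟩
  rw [hR.mem_relImage hT h] at hx'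
  have hT' := hR.isSqGroup_relImage hT
  have hx0 := hR.ne_right h
  have hc0 := hR.ne_left hcc
  obtain ⟨t, s, ht, hs, e⟩ := hU x hx hx' c hc
  rcases ht with ht | rfl
  · rcases hs with hs | rfl
    · obtain ⟨t', ht'⟩ := hR.total_left (hT.ne_zero ht)
      obtain ⟨s', hs'⟩ := hR.total_left (hT.ne_zero hs)
      obtain ⟨X, Y, e'⟩ := (hR.represents ht' (hR.mul h hs') hcc).1 ⟨1, 1, by rw [e]; ring⟩
      have aux : ∀ {t : K} {t' : L}, t ∈ T → R t t' → ∀ X : L,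
          t' * X ^ 2 ∈ relImage R T ∨ t' * X ^ 2 = 0 := by
        intro t t' ht ht' X
        by_cases hX : X = 0
        · right; simp [hX]
        · left; exact ⟨t, ht, hR.mul_sq_right ht' hX⟩
      exact ⟨t' * X ^ 2, s' * Y ^ 2, aux ht ht' X, aux hs hs' Y, by rw [e']; ring⟩
    · refine ⟨c', 0, Or.inl ⟨c, ?_, hcc⟩, Or.inr rfl, by ring⟩
      rw [e]; simpa using ht
  · rcases hs with hs | rfl
    · refine ⟨0, c' / x', Or.inr rfl, Or.inl ?_, by field_simp; ring⟩
      have : R (x * c) (x' * c') := hR.mul h hcc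
      have h2 : x' * c' ∈ relImage R T := by
        rw [hR.mem_relImage hT this]
        rw [show x * c = s * x ^ 2 by rw [e]; ring]
        exact hT.mul_mem hs (hT.sq_mem (hR.ne_left h))
      exact hT'.mem_of_eq h2 (inv_ne_zero hx0) (by field_simp)
    · simp at e; exact absurd e hc0

open ValuationSubring in
/-- A nice valuation is carried by a Witt equivalence to a nontrivial valuation with
corresponding group of (one-unit)-square classes. -/
theorem exists_transfer {A : ValuationSubring K} (hA : A.IsNice) :
    ∃ B : ValuationSubring L, B ≠ ⊤ ∧ B.oneUnitSq = relImage R A.oneUnitSq ∧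
      B.unitSq ⊆ relImage R A.unitSq := by
  have P := hA.rigidPair
  have P' := hR.rigidPair P
  obtain ⟨B, hB, h1, h2⟩ := P'.exists_valuationSubring
  rw [← B.oneUnitSq_subset_iff P'.left] at h1
  rw [← B.unitSq_subset_iff P'.right] at h2
  refine ⟨B, hB, subset_antisymm h1 ?_, h2⟩
  obtain ⟨g, hg⟩ := P'.nonrigid
  have Q : RigidPair B.oneUnitSq (relImage R A.unitSq) :=
    { left := B.isSqGroup_oneUnitSq
      right := P'.right
      le := B.oneUnitSq_subset.trans h2
      neg_one := P'.neg_one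
      index := P'.index
      nontrivial := P'.nontrivial
      rigid := fun hx0 hx => B.rigid_of_notMem_unitSq hx0 fun h => hx (h2 h)
      nonrigid := ⟨g, hg.mem, fun h => hg.notMem (h1 h), fun h => hg.neg_notMem (h1 h),
        hg.one_add_ne, fun h => hg.one_add_notMem (h1 h),
        fun h => hg.mul_one_add_notMem (h1 h)⟩ }
  have Q' := hR.flip.rigidPair Q
  obtain ⟨A₀, hA₀, h3, -⟩ := Q'.exists_valuationSubring
  have h4 : relImage (fun y x => R x y) B.oneUnitSq ⊆ A.oneUnitSq := by
    rintro x ⟨y, hy, h⟩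
    exact (hR.mem_relImage P.left h).1 (h1 hy)
  have hle : A₀ ≤ A := by
    intro y hyA₀
    by_contra hyA
    rw [← A.one_lt_valuation_iff] at hyA
    obtain ⟨z, hz0, hz⟩ := P.nontrivial
    apply hz
    apply P.le
    obtain ⟨w, hw⟩ : ∃ w, w ∉ A₀ := by
      by_contra hcon
      push Not at hcon
      exact hA₀ (SetLike.ext fun x => ⟨fun _ => mem_top x, fun _ => hcon x⟩)
    have hw0 : w ≠ 0 := by rintro rfl; exact hw A₀.zero_mem
    have hw1 : A₀.valuation w⁻¹ < 1 := by
      rwa [A₀.valuation_lt_one_iff_inv_notMem (inv_ne_zero hw0), inv_inv]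
    obtain ⟨c, hc0, hc, hcz⟩ : ∃ c, c ≠ 0 ∧ A₀.valuation c < 1 ∧ A₀.valuation (c * z) < 1 := by
      by_cases hzA : z ∈ A₀
      · refine ⟨w⁻¹, inv_ne_zero hw0, hw1, ?_⟩
        rw [map_mul]
        exact lt_of_le_of_lt (mul_le_of_le_one_right' ((A₀.valuation_le_one_iff _).2 hzA)) hw1
      · refine ⟨w⁻¹ * z⁻¹, mul_ne_zero (inv_ne_zero hw0) (inv_ne_zero hz0), ?_, ?_⟩
        · rw [map_mul]
          refine lt_of_le_of_lt (mul_le_of_le_one_right' ?_) hw1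
          exact (A₀.valuation_le_one_iff _).2 ((A₀.mem_or_inv_mem z).resolve_left hzA)
        · rwa [inv_mul_cancel_right₀ hz0]
    have key : ∀ c, c ≠ 0 → A₀.valuation c < 1 → ∃ N : ℕ, ∀ n, N ≤ n → c * y ^ n ∈ A.oneUnitSq := by
      intro c hc0 hc
      obtain ⟨N, hN⟩ := hA.exists_forall_one_lt hyA hc0
      refine ⟨N, fun n hn => ?_⟩
      have h5 := hN n hn
      have h6 : A₀.valuation (c * y ^ n) < 1 := by
        rw [map_mul, map_pow]
        exact lt_of_le_of_lt (mul_le_of_le_one_right'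
          (pow_le_one' ((A₀.valuation_le_one_iff _).2 hyA₀) n)) hc
      have h7 := h4 (h3 _ h6)
      have h8 : c * y ^ n ≠ 0 := by intro h; rw [h] at h5; simp at h5
      have h9 : A.valuation (c * y ^ n)⁻¹ < 1 := by
        rw [map_inv₀]; exact inv_lt_one_of_one_lt₀ h5
      have h10 := A.one_add_mem_oneUnitSq h9
      apply P.left.of_mul_left h10
      rwa [show (1 + (c * y ^ n)⁻¹) * (c * y ^ n) = 1 + c * y ^ n by
        rw [add_mul, inv_mul_cancel₀ h8]; ring]
    obtain ⟨N, hN⟩ := key c hc0 hc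
    obtain ⟨M, hM⟩ := key (c * z) (mul_ne_zero hc0 hz0) hcz
    apply P.left.of_mul_left (hN (max N M) (le_max_left _ _))
    have := hM (max N M) (le_max_right _ _)
    rwa [show c * z * y ^ max N M = c * y ^ max N M * z by ring] at this
  have h5 : A.oneUnitSq ⊆ relImage (fun y x => R x y) B.oneUnitSq := by
    rw [A.oneUnitSq_subset_iff Q'.left]
    intro x hx
    by_cases hx0 : x = 0
    · rw [hx0, add_zero]; exact Q'.left.one_mem
    apply h3
    rw [A₀.valuation_lt_one_iff_inv_notMem hx0]
    rw [A.valuation_lt_one_iff_inv_notMem hx0] at hx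
    exact fun h => hx (hle h)
  rintro y ⟨x, hx, h⟩
  exact (hR.flip.mem_relImage Q.left h).1 (h5 hx)

end IsWittRel

end

noncomputable section

/-- Some form `X ^ 2 + x Y ^ 2` with `± x` nonsquare fails to represent some nonzero element. -/
def HasNonuniversalForm (E : Type*) [Field E] : Prop :=
  ∃ x c : E, x ≠ 0 ∧ c ≠ 0 ∧ ¬ IsSquare x ∧ ¬ IsSquare (-x) ∧ ∀ X Y, c ≠ X ^ 2 + x * Y ^ 2

namespace ValuationSubring

open IsLocalRing

variable {F : Type*} [Field F] (A : ValuationSubring F)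

theorem exists_coe_eq {x : F} (hx : A.valuation x ≤ 1) : ∃ a : A, (a : F) = x :=
  ⟨⟨x, (A.valuation_le_one_iff x).1 hx⟩, rfl⟩

theorem residue_eq_zero_iff (a : A) : residue A a = 0 ↔ A.valuation (a : F) < 1 := by
  rw [IsLocalRing.residue_eq_zero_iff, A.valuation_lt_one_iff]

theorem residue_ne_zero_iff (a : A) : residue A a ≠ 0 ↔ A.valuation (a : F) = 1 := by
  rw [Ne, A.residue_eq_zero_iff, not_lt, le_antisymm_iff]
  exact ⟨fun h => ⟨A.valuation_le_one a, h⟩, fun h => h.2⟩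

theorem residue_eq_iff (a b : A) : residue A a = residue A b ↔ A.valuation (a - b : F) < 1 := by
  rw [← sub_eq_zero, ← map_sub, A.residue_eq_zero_iff]; rfl

theorem residue_eq_one_iff (a : A) : residue A a = 1 ↔ A.valuation (a - 1 : F) < 1 := by
  rw [← map_one (residue A), A.residue_eq_iff]; rfl

theorem valuation_eq_one_of_pow {y : F} {n : ℕ} (hn : n ≠ 0) (h : A.valuation (y ^ n) = 1) :
    A.valuation y = 1 := by
  rw [map_pow] at h
  rcases lt_trichotomy (A.valuation y) 1 with h1 | h1 | h1
  · exact absurd h (pow_lt_one' h1 hn).ne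
  · exact h1
  · exact absurd h (one_lt_pow' h1 hn).ne'

theorem valuation_eq_one_of_sq {y : F} (h : A.valuation (y ^ 2) = 1) : A.valuation y = 1 :=
  A.valuation_eq_one_of_pow two_ne_zero h

theorem mem_oneUnitSq_iff (a : A) : (a : F) ∈ A.oneUnitSq ∧ A.valuation (a : F) = 1 ↔
    residue A a ≠ 0 ∧ IsSquare (residue A a) := by
  constructor
  · rintro ⟨⟨m, y, hm, hy, e⟩, ha⟩
    refine ⟨(A.residue_ne_zero_iff a).2 ha, ?_⟩
    have h1 := A.valuation_eq_one_of_sub hm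
    rw [e, map_mul, h1, one_mul] at ha
    obtain ⟨m, rfl⟩ := A.exists_coe_eq h1.le
    obtain ⟨y, rfl⟩ := A.exists_coe_eq (A.valuation_eq_one_of_sq ha).le
    have : a = m * y ^ 2 := Subtype.ext (by simpa using e)
    rw [this, map_mul, (A.residue_eq_one_iff m).2 hm, one_mul, map_pow]
    exact ⟨residue A y, sq _⟩
  · rintro ⟨h0, r, hr⟩
    obtain ⟨q, rfl⟩ := residue_surjective r
    have hq : A.valuation (q : F) = 1 := by
      rw [← A.residue_ne_zero_iff]; intro h; apply h0; rw [hr, h, mul_zero]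
    have hq0 := A.ne_zero_of_valuation_eq_one hq
    refine ⟨⟨a / q ^ 2, q, ?_, hq0, by field_simp⟩, (A.residue_ne_zero_iff a).1 h0⟩
    rw [← map_mul, A.residue_eq_iff] at hr
    rw [show (a / q ^ 2 - 1 : F) = (a - (q * q : A)) / q ^ 2 by push_cast; field_simp,
      map_div₀, map_pow, hq, one_pow, div_one]
    exact hr

theorem mem_oneUnitSq_iff_isSquare {a : A} (ha : A.valuation (a : F) = 1) :
    (a : F) ∈ A.oneUnitSq ↔ IsSquare (residue A a) := by
  have := A.mem_oneUnitSq_iff a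
  rw [A.residue_ne_zero_iff] at this
  tauto

theorem not_isUniversalPair (h : HasNonuniversalForm (ResidueField A)) {H : Set F}
    (hH : A.unitSq ⊆ H) : ¬ IsUniversalPair A.oneUnitSq H := by
  obtain ⟨x, c, hx0, hc0, hx, hx', hc⟩ := h
  obtain ⟨x, rfl⟩ := residue_surjective x
  obtain ⟨c, rfl⟩ := residue_surjective c
  intro hU
  have vx := (A.residue_ne_zero_iff x).1 hx0
  have vc := (A.residue_ne_zero_iff c).1 hc0
  obtain ⟨t, s, ht, hs, e⟩ := hU x (hH (A.mem_unitSq_of_valuation vx))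
    (by rwa [A.mem_oneUnitSq_iff_isSquare vx]) c (hH (A.mem_unitSq_of_valuation vc))
  have aux : ∀ t : F, t ∈ A.oneUnitSq ∨ t = 0 →
      ∃ (m : A) (y : F), residue A m = 1 ∧ t = m * y ^ 2 := by
    rintro t (⟨m, y, hm, hy, rfl⟩ | rfl)
    · obtain ⟨m, rfl⟩ := A.exists_coe_eq (A.valuation_eq_one_of_sub hm).le
      exact ⟨m, y, (A.residue_eq_one_iff m).2 hm, rfl⟩
    · exact ⟨1, 0, map_one _, by simp⟩
  obtain ⟨m, y, hm, rfl⟩ := aux t ht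
  obtain ⟨n, z, hn, rfl⟩ := aux s hs
  have small : ∀ {y : F}, 1 < A.valuation y → ∃ w : A, (w : F) = y⁻¹ ∧ residue A w = 0 := by
    intro y hy
    have : A.valuation y⁻¹ < 1 := by rw [map_inv₀]; exact inv_lt_one_of_one_lt₀ hy
    obtain ⟨w, hw⟩ := A.exists_coe_eq this.le
    exact ⟨w, hw, by rwa [A.residue_eq_zero_iff, hw]⟩
  rcases le_total (A.valuation y) (A.valuation z) with hyz | hyz
  · by_cases hz : A.valuation z ≤ 1
    · obtain ⟨y, rfl⟩ := A.exists_coe_eq (hyz.trans hz)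
      obtain ⟨z, rfl⟩ := A.exists_coe_eq hz
      have : c = m * y ^ 2 + x * (n * z ^ 2) := Subtype.ext (by simpa using e)
      apply hc (residue A y) (residue A z)
      rw [this]; simp [hm, hn]
    · rw [not_le] at hz
      have hz0 : z ≠ 0 := by rintro rfl; simp at hz
      obtain ⟨w, hw, hw0⟩ := small hz
      obtain ⟨r, hr⟩ := A.exists_coe_eq (x := y / z) (by
        rw [map_div₀]; exact div_le_one_of_le₀ hyz zero_le)
      have : c * w ^ 2 = m * r ^ 2 + x * n := Subtype.ext (by
        push_cast
        rw [hw, hr, e]; field_simp)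
      have := congrArg (residue A) this
      simp [hm, hn, hw0] at this
      exact hx' ⟨residue A r, by linear_combination this⟩
  · by_cases hy : A.valuation y ≤ 1
    · obtain ⟨y, rfl⟩ := A.exists_coe_eq hy
      obtain ⟨z, rfl⟩ := A.exists_coe_eq (hyz.trans hy)
      have : c = m * y ^ 2 + x * (n * z ^ 2) := Subtype.ext (by simpa using e)
      apply hc (residue A y) (residue A z)
      rw [this]; simp [hm, hn]
    · rw [not_le] at hy
      have hy0 : y ≠ 0 := by rintro rfl; simp at hy
      obtain ⟨w, hw, hw0⟩ := small hy
      obtain ⟨r, hr⟩ := A.exists_coe_eq (x := z / y) (by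
        rw [map_div₀]; exact div_le_one_of_le₀ hyz zero_le)
      have : c * w ^ 2 = m + x * n * r ^ 2 := Subtype.ext (by
        push_cast
        rw [hw, hr, e]; field_simp)
      have := congrArg (residue A) this
      simp [hm, hn, hw0] at this
      have hr0 : residue A r ≠ 0 := by rintro h; simp [h] at this
      refine hx' ⟨(residue A r)⁻¹, ?_⟩
      field_simp
      linear_combination this

theorem hasNonuniversalForm {π : F} (hπ0 : π ≠ 0) (hπ : π ∉ A.unitSq) {ε : ResidueField A}
    (hε : ¬ IsSquare ε) : HasNonuniversalForm F := by
  obtain ⟨ε, rfl⟩ := residue_surjective ε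
  have hv : A.valuation (ε : F) = 1 := by
    rw [← A.residue_ne_zero_iff]; intro h; rw [h] at hε; exact hε IsSquare.zero
  refine ⟨π, ε, hπ0, A.ne_zero_of_valuation_eq_one hv, ?_, ?_, ?_⟩
  · rintro ⟨s, hs⟩
    apply hπ
    rw [hs, ← sq]
    exact A.isSqGroup_unitSq.sq_mem (by rintro rfl; simp at hs; exact hπ0 hs)
  · rintro ⟨s, hs⟩
    apply hπ
    have hs0 : s ≠ 0 := by rintro rfl; simp at hs; exact hπ0 hs
    exact A.isSqGroup_unitSq.mem_of_eq A.neg_one_mem_unitSq hs0 (by linear_combination -hs)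
  · intro X Y e
    have key : A.valuation (X ^ 2) < A.valuation (π * Y ^ 2) → False := by
      intro h
      have h1 := A.valuation.map_add_eq_of_lt_left h
      rw [add_comm, ← e, hv] at h1
      have hY0 : Y ≠ 0 := by rintro rfl; simp at h
      exact hπ (A.isSqGroup_unitSq.mem_of_eq (A.mem_unitSq_of_valuation h1.symm)
        (inv_ne_zero hY0) (by field_simp))
    have key2 : A.valuation (π * Y ^ 2) < A.valuation (X ^ 2) → False := by
      intro h
      have h1 := A.valuation.map_add_eq_of_lt_right h
      rw [add_comm, ← e, hv] at h1
      have h2 := A.valuation_eq_one_of_sq h1.symm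
      obtain ⟨X, rfl⟩ := A.exists_coe_eq h2.le
      apply hε
      refine ⟨residue A X, ?_⟩
      rw [← map_mul, A.residue_eq_iff, e]
      rw [← h1] at h
      convert h using 2
      push_cast; ring
    rcases lt_trichotomy (A.valuation (X ^ 2)) (A.valuation (π * Y ^ 2)) with h | h | h
    · exact key h
    · have h0 : A.valuation (X ^ 2) ≠ 0 := by
        intro h0
        have h1 := A.valuation.map_add (X ^ 2) (π * Y ^ 2)
        rw [← e, hv, ← h, h0] at h1
        simp at h1
      have hX : X ≠ 0 := by rintro rfl; simp at h0
      have hY : Y ≠ 0 := by rintro rfl; rw [h] at h0; simp at h0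
      apply hπ
      refine ⟨π * Y ^ 2 / X ^ 2, X / Y, ?_, div_ne_zero hX hY, by field_simp⟩
      rw [map_div₀, ← h, div_self h0]
    · exact key2 h

theorem unitSq_eq_of_subset {B : ValuationSubring F} {H : Set F} (hH : IsSqGroup H)
    (hBH : B.unitSq ⊆ H) (hne : ∃ x, x ≠ 0 ∧ x ∉ H)
    (hindex : ∀ {x y : F}, x ≠ 0 → y ≠ 0 → x ∉ B.unitSq → y ∉ B.unitSq → x * y ∈ B.unitSq) :
    B.unitSq = H := by
  refine subset_antisymm hBH fun y hy => ?_
  by_contra hyB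
  obtain ⟨x, hx0, hx⟩ := hne
  exact hx (hH.of_mul_left hy (hBH (hindex (hH.ne_zero hy) hx0 hyB fun h => hx (hBH h))))

/-- If the square class group of the residue field has at most two elements, then every
element is rigid. -/
theorem not_nonrigidElt {H : Set F} {g : F} (hg : NonrigidElt A.oneUnitSq H g)
    (hE : ∀ x y : ResidueField A, ¬ IsSquare x → ¬ IsSquare y → IsSquare (x * y)) : False := by
  have hT := A.isSqGroup_oneUnitSq
  have aux : ∀ {x y : F}, x ∈ A.unitSq → y ∈ A.unitSq → x ∉ A.oneUnitSq → y ∉ A.oneUnitSq →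
      x * y ∈ A.oneUnitSq := by
    rintro _ _ ⟨u, y, hu, hy, rfl⟩ ⟨w, z, hw, hz, rfl⟩ h1 h2
    obtain ⟨u, rfl⟩ := A.exists_coe_eq hu.le
    obtain ⟨w, rfl⟩ := A.exists_coe_eq hw.le
    have h1' : (u : F) ∉ A.oneUnitSq := fun h => h1 (hT.mul_mem h (hT.sq_mem hy))
    have h2' : (w : F) ∉ A.oneUnitSq := fun h => h2 (hT.mul_mem h (hT.sq_mem hz))
    rw [A.mem_oneUnitSq_iff_isSquare hu] at h1'
    rw [A.mem_oneUnitSq_iff_isSquare hw] at h2'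
    have h3 := hE _ _ h1' h2'
    have hv : A.valuation ((u * w : A) : F) = 1 := by push_cast; rw [map_mul, hu, hw, one_mul]
    rw [← map_mul, ← A.mem_oneUnitSq_iff_isSquare hv] at h3
    exact hT.mem_of_eq h3 (mul_ne_zero hy hz) (by push_cast; ring)
  have hg0 : g ≠ 0 := by
    rintro rfl
    apply hg.one_add_notMem
    simpa using hT.one_mem
  have h1 : g ∈ A.unitSq := by
    by_contra h
    rcases A.rigid_of_notMem_unitSq hg0 h with h | h
    · exact hg.one_add_notMem h
    · exact hg.mul_one_add_notMem h
  by_cases h2 : 1 + g ∈ A.unitSq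
  · exact hg.mul_one_add_notMem (aux h1 h2 hg.notMem hg.one_add_notMem)
  · have h3 : -(1 + g) ∉ A.unitSq := fun h => h2 (by
      have := A.isSqGroup_unitSq.mul_mem A.neg_one_mem_unitSq h
      simpa using this)
    rcases A.rigid_of_notMem_unitSq (neg_ne_zero.2 hg.one_add_ne) h3 with h | h
    · apply hg.neg_notMem
      simpa using h
    · apply hg.mul_one_add_notMem
      rwa [show -(1 + g) * (1 + -(1 + g)) = g * (1 + g) by ring] at h

end ValuationSubring

end

noncomputable section

namespace ValuationSubring

open IsLocalRing

variable {E : Type*} [Field E]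

/-- On the subfield `E₀` every value is a power of that of `π`, and the corresponding residues
lie in `k₀`. -/
structure IsUniformized (A : ValuationSubring E) (E₀ : Subfield E) (π : E)
    (k₀ : Subfield (ResidueField A)) : Prop where
  ne_zero : π ≠ 0
  lt_one : A.valuation π < 1
  exists_zpow : ∀ c ∈ E₀, c ≠ 0 →
    ∃ (k : ℤ) (u : A), c * π ^ k = u ∧ residue A u ∈ k₀ ∧ residue A u ≠ 0

namespace IsUniformized

variable {A : ValuationSubring E} {E₀ : Subfield E} {π : E} {k₀ : Subfield (ResidueField A)}
  (h : A.IsUniformized E₀ π k₀)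
include h

theorem finite_residueField [FiniteDimensional E₀ E] : FiniteDimensional k₀ (ResidueField A) := by
  classical
  have hπ := h.ne_zero
  obtain ⟨p, hp⟩ := A.exists_coe_eq h.lt_one.le
  have hp0 : residue A p = 0 := by rw [A.residue_eq_zero_iff, hp]; exact h.lt_one
  suffices hr : Module.rank k₀ (ResidueField A) ≤ (Module.finrank E₀ E : ℕ) from
    Module.rank_lt_aleph0_iff.1 (lt_of_le_of_lt hr (Cardinal.natCast_lt_aleph0))
  refine rank_le fun s hs => ?_
  choose g hg using residue_surjective (R := A)
  suffices hli : LinearIndependent E₀ (fun i : s => (g i : E)) by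
    simpa using hli.fintype_card_le_finrank
  rw [Fintype.linearIndependent_iff]
  by_contra hcon
  push Not at hcon
  obtain ⟨c, hsum, i₀, hi₀⟩ := hcon
  have hex : ∀ i : s, ∃ (k : ℤ) (u : A), c i ≠ 0 →
      ((c i : E) * π ^ k = u ∧ residue A u ∈ k₀ ∧ residue A u ≠ 0) := by
    intro i
    by_cases hc : c i = 0
    · exact ⟨0, 0, fun h => absurd hc h⟩
    · obtain ⟨k, u, hu⟩ := h.exists_zpow (c i) (c i).2 (by simpa using hc)
      exact ⟨k, u, fun _ => hu⟩
  choose k u hku using hex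
  obtain ⟨j, hj, hmax⟩ := Finset.exists_max_image (Finset.univ.filter (fun i : s => c i ≠ 0)) k
    ⟨i₀, by simpa using hi₀⟩
  simp only [Finset.mem_filter, Finset.mem_univ, true_and] at hj hmax
  have hd : ∀ i : s, ∃ d : A, (c i : E) * π ^ (k j) = d ∧ residue A d ∈ k₀ := by
    intro i
    by_cases hc : c i = 0
    · exact ⟨0, by simp [hc], by simp⟩
    obtain ⟨h1, h2, -⟩ := hku i hc
    obtain ⟨n, hn⟩ := Int.eq_ofNat_of_zero_le (sub_nonneg.2 (hmax i hc))
    refine ⟨u i * p ^ n, ?_, ?_⟩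
    · push_cast
      rw [hp, ← h1, mul_assoc, ← zpow_natCast, ← hn, ← zpow_add₀ hπ]
      congr 2; ring
    · rw [map_mul, map_pow, hp0]
      exact k₀.mul_mem h2 (k₀.pow_mem k₀.zero_mem n)
  choose d hd hdk using hd
  have hsum' : ∑ i, d i * g i = 0 := by
    apply Subtype.ext
    push_cast
    have : ∑ i, (c i : E) * (g i : E) = 0 := hsum
    calc ∑ i, (d i : E) * (g i : E) = ∑ i, ((c i : E) * (g i : E)) * π ^ (k j) := by
          refine Finset.sum_congr rfl fun i _ => ?_
          rw [← hd i]; ring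
      _ = 0 := by rw [← Finset.sum_mul, this, zero_mul]
  have h3 := congrArg (residue A) hsum'
  rw [map_sum, map_zero] at h3
  have h4 := Fintype.linearIndependent_iff.1 hs (fun i => ⟨residue A (d i), hdk i⟩) (by
    rw [← h3]
    refine Finset.sum_congr rfl fun i _ => ?_
    rw [map_mul, hg]; rfl) j
  have h5 : d j = u j := Subtype.ext (by rw [← hd j, (hku j hj).1])
  have h6 : residue A (d j) = 0 := congrArg Subtype.val h4
  rw [h5] at h6
  exact (hku j hj).2.2 h6

theorem exists_valuation_eq {ι : Type*} {s : Finset ι} {c w : ι → E} (hc : ∀ i ∈ s, c i ∈ E₀)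
    (hw : ∀ i ∈ s, w i ≠ 0) (hne : ∃ i ∈ s, c i ≠ 0) (hsum : ∑ i ∈ s, c i * w i = 0) :
    ∃ i ∈ s, ∃ j ∈ s, i ≠ j ∧ ∃ k l : ℤ, A.valuation (w i * π ^ k) = A.valuation (w j * π ^ l) := by
  classical
  have hπ := h.ne_zero
  obtain ⟨i₀, hi₀, hne⟩ := hne
  obtain ⟨i, hi, hmax⟩ := Finset.exists_max_image s (fun i => A.valuation (c i * w i)) ⟨i₀, hi₀⟩
  have hpos : 0 < A.valuation (c i * w i) :=
    lt_of_lt_of_le (A.valuation_pos (mul_ne_zero hne (hw _ hi₀))) (hmax i₀ hi₀)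
  obtain ⟨j, hj, hji, e⟩ : ∃ j ∈ s, j ≠ i ∧ A.valuation (c j * w j) = A.valuation (c i * w i) := by
    by_contra hcon
    push Not at hcon
    have := A.valuation.map_sum_eq_of_lt (f := fun i => c i * w i) hi (fun j hj => by
      simp only [Finset.mem_sdiff, Finset.mem_singleton] at hj
      exact lt_of_le_of_ne (hmax j hj.1) (hcon j hj.1 hj.2))
    rw [hsum, map_zero] at this
    exact hpos.ne this
  have key : ∀ i ∈ s, A.valuation (c i * w i) ≠ 0 →
      ∃ k : ℤ, A.valuation (c i * w i) = A.valuation (w i * π ^ k) := by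
    intro i hi h0
    have hci : c i ≠ 0 := by intro h; simp [h] at h0
    obtain ⟨k, u, h1, -, h2⟩ := h.exists_zpow _ (hc i hi) hci
    rw [A.residue_ne_zero_iff, ← h1] at h2
    refine ⟨-k, ?_⟩
    rw [← one_mul (A.valuation (w i * π ^ (-k))), ← h2, ← map_mul]
    congr 1
    rw [show c i * π ^ k * (w i * π ^ (-k)) = c i * w i * (π ^ k * π ^ (-k)) by ring,
      ← zpow_add₀ hπ, add_neg_cancel, zpow_zero, mul_one]
  obtain ⟨k, hk⟩ := key i hi hpos.ne'
  obtain ⟨l, hl⟩ := key j hj (by rw [e]; exact hpos.ne')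
  exact ⟨i, hi, j, hj, hji.symm, k, l, by rw [← hk, ← hl, e]⟩

theorem exists_pow_eq_one [Algebra.IsAlgebraic E₀ E] {y : E} (hy : y ≠ 0) :
    ∃ (n : ℕ) (k : ℤ), n ≠ 0 ∧ A.valuation (y ^ n * π ^ k) = 1 := by
  have hπ := h.ne_zero
  obtain ⟨P, hP0, hP⟩ := Algebra.IsAlgebraic.isAlgebraic (R := E₀) y
  rw [Polynomial.aeval_eq_sum_range] at hP
  obtain ⟨i, hi, j, hj, hij, k, l, e⟩ := h.exists_valuation_eq (s := Finset.range (P.natDegree + 1))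
    (c := fun i => (P.coeff i : E)) (w := fun i => y ^ i) (fun i _ => (P.coeff i).2)
    (fun i _ => pow_ne_zero _ hy)
    ⟨P.natDegree, by simp, by simpa using hP0⟩ hP
  have aux : ∀ {i j : ℕ} {k l : ℤ}, i < j →
      A.valuation (y ^ i * π ^ k) = A.valuation (y ^ j * π ^ l) →
      ∃ (n : ℕ) (k : ℤ), n ≠ 0 ∧ A.valuation (y ^ n * π ^ k) = 1 := by
    intro i j k l hij e
    obtain ⟨n, rfl⟩ := Nat.exists_eq_add_of_lt hij
    refine ⟨n + 1, l - k, by omega, ?_⟩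
    have h1 : A.valuation (y ^ i * π ^ k) ≠ 0 :=
      (A.valuation_pos (mul_ne_zero (pow_ne_zero _ hy) (zpow_ne_zero _ hπ))).ne'
    rw [← mul_right_inj' h1, mul_one, ← map_mul, e]
    congr 1
    rw [show y ^ i * π ^ k * (y ^ (n + 1) * π ^ (l - k)) =
      y ^ (i + n + 1) * (π ^ k * π ^ (l - k)) by ring, ← zpow_add₀ hπ]
    congr 2; ring
  rcases lt_or_gt_of_ne hij with hlt | hlt
  · exact aux hlt e
  · exact aux hlt e.symm

theorem arch [Algebra.IsAlgebraic E₀ E] {c : E} (hc0 : c ≠ 0) (hc : A.valuation c < 1) (z : E) :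
    ∃ n : ℕ, A.valuation (z * c ^ n) ≤ 1 := by
  by_cases hz : z = 0
  · exact ⟨0, by simp [hz]⟩
  have hπ := h.ne_zero
  have hq0 : A.valuation π ≠ 0 := (A.valuation_pos hπ).ne'
  obtain ⟨a, j, ha, h1⟩ := h.exists_pow_eq_one hc0
  obtain ⟨b, l, hb, h2⟩ := h.exists_pow_eq_one hz
  have hj : j < 0 := by
    by_contra hj
    rw [not_lt] at hj
    obtain ⟨m, rfl⟩ := Int.eq_ofNat_of_zero_le hj
    rw [map_mul, map_pow, zpow_natCast, map_pow] at h1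
    exact absurd h1 (mul_lt_one_of_lt_of_le (pow_lt_one' hc ha) (pow_le_one' h.lt_one.le m)).ne
  obtain ⟨m, hm⟩ := Int.eq_ofNat_of_zero_le (show 0 ≤ -j - 1 by omega)
  obtain rfl : j = -((m : ℤ) + 1) := by omega
  have hca : A.valuation (c ^ a) = A.valuation (π ^ (m + 1)) := by
    rw [show c ^ a = c ^ a * π ^ (-((m : ℤ) + 1)) * π ^ (m + 1) by
      rw [← zpow_natCast π, mul_assoc, ← zpow_add₀ hπ]; simp, map_mul, h1, one_mul]
  refine ⟨a * l.natAbs, ?_⟩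
  have h3 : A.valuation ((z * c ^ (a * l.natAbs)) ^ b) ≤ 1 := by
    have e1 : (z * c ^ (a * l.natAbs)) ^ b = z ^ b * π ^ l * π ^ (-l) * (c ^ a) ^ (l.natAbs * b) := by
      rw [mul_assoc (z ^ b), ← zpow_add₀ hπ, add_neg_cancel, zpow_zero, mul_one, mul_pow]
      ring
    obtain ⟨r, hr⟩ : ∃ r : ℕ, ((m + 1) * (l.natAbs * b) : ℕ) + (-l) = (r : ℤ) := by
      refine Int.eq_ofNat_of_zero_le ?_
      have : l.natAbs ≤ (m + 1) * (l.natAbs * b) := by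
        calc l.natAbs = 1 * (l.natAbs * 1) := by ring
          _ ≤ _ := Nat.mul_le_mul (by omega) (Nat.mul_le_mul le_rfl (Nat.one_le_iff_ne_zero.2 hb))
      omega
    rw [e1, map_mul, map_mul, h2, one_mul, map_pow, hca, ← map_pow, ← map_mul, ← pow_mul, mul_comm,
      ← zpow_natCast π, ← zpow_add₀ hπ, hr, zpow_natCast, map_pow]
    exact pow_le_one' h.lt_one.le r
  by_contra hcon
  rw [not_le] at hcon
  rw [map_pow] at h3
  exact absurd h3 (not_le.2 (one_lt_pow' hcon hb))

theorem index [Algebra.IsAlgebraic E₀ E] {x y : E} (hx : x ≠ 0) (hy : y ≠ 0) (hxA : x ∉ A.unitSq)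
    (hyA : y ∉ A.unitSq) : x * y ∈ A.unitSq := by
  have hπ := h.ne_zero
  obtain ⟨a, j, ha, h1⟩ := h.exists_pow_eq_one hx
  obtain ⟨b, l, hb, h2⟩ := h.exists_pow_eq_one hy
  have of_v : ∀ {m : ℤ} {n : ℤ}, A.valuation (x ^ m * y ^ n) = 1 → IsCoprime m n →
      x * y ∈ A.unitSq := by
    intro m n hv hmn
    rcases Int.even_or_odd' m with ⟨m, rfl | rfl⟩
    · rcases Int.even_or_odd' n with ⟨n, rfl | rfl⟩
      · obtain ⟨r, s, e⟩ := hmn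
        exfalso
        have : (2 : ℤ) ∣ 1 := ⟨r * m + s * n, by linear_combination -e⟩
        omega
      · exfalso
        refine hyA ⟨_, (x ^ m * y ^ n)⁻¹, hv, inv_ne_zero
          (mul_ne_zero (zpow_ne_zero _ hx) (zpow_ne_zero _ hy)), ?_⟩
        rw [zpow_add₀ hy, zpow_mul', zpow_mul' y, zpow_one]
        have := zpow_ne_zero m hx
        have := zpow_ne_zero n hy
        norm_cast
        field_simp
    · rcases Int.even_or_odd' n with ⟨n, rfl | rfl⟩
      · exfalso
        refine hxA ⟨_, (x ^ m * y ^ n)⁻¹, hv, inv_ne_zero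
          (mul_ne_zero (zpow_ne_zero _ hx) (zpow_ne_zero _ hy)), ?_⟩
        rw [zpow_add₀ hx, zpow_mul', zpow_mul' y, zpow_one]
        have := zpow_ne_zero m hx
        have := zpow_ne_zero n hy
        norm_cast
        field_simp
      · refine ⟨_, (x ^ m * y ^ n)⁻¹, hv, inv_ne_zero
          (mul_ne_zero (zpow_ne_zero _ hx) (zpow_ne_zero _ hy)), ?_⟩
        rw [zpow_add₀ hx, zpow_add₀ hy, zpow_mul', zpow_mul' y, zpow_one, zpow_one]
        have := zpow_ne_zero m hx
        have := zpow_ne_zero n hy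
        norm_cast
        field_simp
  by_cases hj : j = 0
  · subst hj
    rw [zpow_zero, mul_one] at h1
    exact absurd (A.mem_unitSq_of_valuation (A.valuation_eq_one_of_pow ha h1)) hxA
  have hrel : A.valuation (x ^ ((a : ℤ) * l) * y ^ (-((b : ℤ) * j))) = 1 := by
    have e : x ^ ((a : ℤ) * l) * y ^ (-((b : ℤ) * j)) =
        (x ^ a * π ^ j) ^ l * (y ^ b * π ^ l) ^ (-j) := by
      rw [mul_zpow, mul_zpow, ← zpow_natCast, ← zpow_natCast, ← zpow_mul, ← zpow_mul, ← zpow_mul,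
        ← zpow_mul]
      rw [show x ^ ((a : ℤ) * l) * π ^ (j * l) * (y ^ ((b : ℤ) * -j) * π ^ (l * -j)) =
        x ^ ((a : ℤ) * l) * y ^ ((b : ℤ) * -j) * (π ^ (j * l) * π ^ (l * -j)) by ring,
        ← zpow_add₀ hπ, show j * l + l * -j = 0 by ring, zpow_zero, mul_one, mul_neg]
    rw [e, map_mul, map_zpow₀, map_zpow₀, h1, h2, one_zpow, one_zpow, one_mul]
  have hg : 0 < Int.gcd ((a : ℤ) * l) (-((b : ℤ) * j)) := by
    apply Int.gcd_pos_of_ne_zero_right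
    simp [hb, hj]
  obtain ⟨m, n, hmn, e1, e2⟩ := Int.exists_gcd_one hg
  refine of_v (m := m) (n := n) (A.valuation_eq_one_of_pow hg.ne' ?_)
    (Int.isCoprime_iff_gcd_eq_one.2 hmn)
  rw [mul_pow, ← zpow_natCast, ← zpow_natCast, ← zpow_mul, ← zpow_mul, ← e1, ← e2]
  exact hrel

theorem exists_notMem_unitSq [FiniteDimensional E₀ E] : ∃ y, y ≠ 0 ∧ y ∉ A.unitSq := by
  by_contra hcon
  push Not at hcon
  have hπ := h.ne_zero
  have hroot : ∀ n : ℕ, ∃ z, z ≠ 0 ∧ A.valuation (z ^ 2 ^ n) = A.valuation π := by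
    intro n
    induction n with
    | zero => exact ⟨π, hπ, by simp⟩
    | succ n ih =>
      obtain ⟨z, hz, e⟩ := ih
      obtain ⟨u, y, hu, hy, rfl⟩ := hcon z hz
      refine ⟨y, hy, ?_⟩
      rw [← e, mul_pow, map_mul, map_pow _ u, hu, one_pow, one_mul, pow_succ', pow_mul]
  obtain ⟨z, hz, e⟩ := hroot (Module.finrank E₀ E)
  set N := 2 ^ Module.finrank E₀ E with hN
  have hlt : Module.finrank E₀ E < N := Nat.lt_two_pow_self
  have hnli : ¬ LinearIndependent E₀ (fun i : Fin N => z ^ (i : ℕ)) := by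
    intro hli
    have := hli.fintype_card_le_finrank
    simp at this
    omega
  rw [Fintype.linearIndependent_iff] at hnli
  push Not at hnli
  obtain ⟨c, hsum, i₀, hi₀⟩ := hnli
  obtain ⟨i, -, j, -, hij, k, l, e2⟩ := h.exists_valuation_eq (s := Finset.univ)
    (c := fun i => (c i : E)) (w := fun i : Fin N => z ^ (i : ℕ)) (fun i _ => (c i).2)
    (fun i _ => pow_ne_zero _ hz) ⟨i₀, by simp, by simpa using hi₀⟩ hsum
  have e3 : A.valuation π ^ ((i : ℤ) + N * k) = A.valuation π ^ ((j : ℤ) + N * l) := by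
    have hv0 : A.valuation π ≠ 0 := (A.valuation_pos hπ).ne'
    have aux : ∀ (i : ℕ) (k : ℤ), A.valuation (z ^ i * π ^ k) ^ N =
        A.valuation π ^ ((i : ℤ) + N * k) := by
      intro i k
      rw [← map_pow, mul_pow, ← pow_mul, mul_comm i, pow_mul, map_mul, map_pow _ (z ^ N), e,
        ← zpow_natCast (π ^ k), ← zpow_mul, map_zpow₀, ← zpow_natCast, ← zpow_add₀ hv0,
        mul_comm k]
    rw [← aux, ← aux, e2]
  have hinj := (zpow_right_strictAnti₀ (A.valuation_pos hπ) h.lt_one).injective e3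
  apply hij
  have h1 := i.2
  have h2 := j.2
  have h3 : (i : ℤ) = j := by
    have h4 : ((i : ℤ) + N * k) % N = ((j : ℤ) + N * l) % N := by rw [hinj]
    rw [Int.add_mul_emod_self_left, Int.add_mul_emod_self_left, Int.emod_eq_of_lt (by omega) (by omega),
      Int.emod_eq_of_lt (by omega) (by omega)] at h4
    exact h4
  exact Fin.ext (by exact_mod_cast h3)

end IsUniformized

end ValuationSubring

end

noncomputable section

theorem map_aeval_int {R S : Type*} [CommRing R] [CommRing S] (φ : R →+* S) (r : R)
    (f : Polynomial ℤ) : φ (Polynomial.aeval r f) = Polynomial.aeval (φ r) f :=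
  (Polynomial.aeval_algHom_apply φ.toIntAlgHom r f).symm

/-- `s` is transcendental over the prime field. -/
def IsAbsTranscendental {E : Type*} [Field E] (s : E) : Prop :=
  ∀ f : Polynomial ℤ, Polynomial.aeval s f = 0 → ∀ n, ((f.coeff n : ℤ) : E) = 0

/-- Any element transcendental over the prime field generates a subfield over which the
field is finite. -/
def IsAbsFunctionField (E : Type*) [Field E] : Prop :=
  ∀ s : E, IsAbsTranscendental s → FiniteDimensional (Subfield.closure {s}) E

theorem mem_subringClosure_singleton_iff {E : Type*} [Field E] {s x : E} :
    x ∈ Subring.closure {s} ↔ ∃ f : Polynomial ℤ, Polynomial.aeval s f = x := by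
  have h : x ∈ Algebra.adjoin ℤ {s} ↔ x ∈ Subring.closure {s} := by
    rw [Algebra.adjoin_int]; rfl
  rw [← h, Algebra.adjoin_singleton_eq_range_aeval]
  rfl

theorem mem_closure_singleton_iff {E : Type*} [Field E] {s x : E} :
    x ∈ Subfield.closure {s} ↔
      ∃ f g : Polynomial ℤ, Polynomial.aeval s f / Polynomial.aeval s g = x := by
  rw [Subfield.mem_closure_iff]
  constructor
  · rintro ⟨y, hy, z, hz, e⟩
    obtain ⟨f, rfl⟩ := mem_subringClosure_singleton_iff.1 hy
    obtain ⟨g, rfl⟩ := mem_subringClosure_singleton_iff.1 hz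
    exact ⟨f, g, e⟩
  · rintro ⟨f, g, e⟩
    exact ⟨_, mem_subringClosure_singleton_iff.2 ⟨f, rfl⟩, _,
      mem_subringClosure_singleton_iff.2 ⟨g, rfl⟩, e⟩

theorem charP_of_natCast_eq_zero {E : Type*} [Ring E] [Nontrivial E] {p : ℕ} (hp : p.Prime) (hpE : (p : E) = 0) : CharP E p := by
  have hd : ringChar E ∣ p := (ringChar.spec E p).1 hpE
  rcases (Nat.dvd_prime hp).1 hd with h1 | h1
  · exact absurd h1 (CharP.ringChar_ne_one)
  · exact h1 ▸ ringChar.charP E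

theorem intCast_eq_zero_iff_dvd {E : Type*} [Ring E] [Nontrivial E] {p : ℕ} (hp : p.Prime)
    (h : (p : E) = 0) (n : ℤ) : (n : E) = 0 ↔ (p : ℤ) ∣ n := by
  have := charP_of_natCast_eq_zero hp h
  exact CharP.intCast_eq_zero_iff E p n

theorem IsAbsTranscendental.aeval_ne_zero {E : Type*} [Field E] {s : E} {p : ℕ} (hp : p.Prime)
    (hpE : (p : E) = 0) (hs : IsAbsTranscendental s) {f : Polynomial ℤ}
    (hf : ¬ Polynomial.C (p : ℤ) ∣ f) : Polynomial.aeval s f ≠ 0 := by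
  intro h
  apply hf
  rw [Polynomial.C_dvd_iff_dvd_coeff]
  intro n
  exact (intCast_eq_zero_iff_dvd hp hpE _).1 (hs f h n)

namespace ValuationSubring

open IsLocalRing

variable {F : Type*} [Field F]

theorem natCast_residue_eq_zero (B : ValuationSubring F) {p : ℕ} (hB : B.valuation p < 1) :
    (p : ResidueField B) = 0 := by
  have := (B.residue_eq_zero_iff (p : B)).2 (by simpa using hB)
  simpa using this

theorem isUniformized_of_forall (A : ValuationSubring F) {t π : F} (k₀ : Subfield (ResidueField A))
    (hπ : π ≠ 0) (hπ1 : A.valuation π < 1)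
    (h : ∀ f : Polynomial ℤ, Polynomial.aeval t f ≠ 0 → ∃ (k : ℕ) (u : A),
      Polynomial.aeval t f = π ^ k * u ∧ residue A u ∈ k₀ ∧ residue A u ≠ 0) :
    A.IsUniformized (Subfield.closure {t}) π k₀ where
  ne_zero := hπ
  lt_one := hπ1
  exists_zpow := by
    intro c hc hc0
    obtain ⟨f, g, rfl⟩ := mem_closure_singleton_iff.1 hc
    obtain ⟨hf, hg⟩ := div_ne_zero_iff.1 hc0
    obtain ⟨k, u, e, h1, h2⟩ := h f hf
    obtain ⟨l, w, e', h1', h2'⟩ := h g hg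
    have hw : IsUnit w := by
      by_contra hw
      exact h2' ((IsLocalRing.residue_eq_zero_iff w).2 ((mem_maximalIdeal w).2 hw))
    obtain ⟨w, rfl⟩ := hw
    have hw0 : ((w : A) : F) ≠ 0 := by
      intro h; rw [h, mul_zero] at e'; exact hg e'
    have e3 : ((↑w⁻¹ : A) : F) * ((w : A) : F) = 1 := by
      rw [← MulMemClass.coe_mul]; simp
    have e4 : residue A (↑w⁻¹ : A) = (residue A w)⁻¹ := by
      refine eq_inv_of_mul_eq_one_left ?_; rw [← map_mul]; simp
    refine ⟨l - k, u * ↑w⁻¹, ?_, ?_, ?_⟩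
    · rw [e, e', MulMemClass.coe_mul, eq_inv_of_mul_eq_one_left e3, zpow_sub₀ hπ, zpow_natCast,
        zpow_natCast]
      field_simp
    · rw [map_mul, e4]; exact k₀.mul_mem h1 (k₀.inv_mem h1')
    · rw [map_mul, e4]; exact mul_ne_zero h2 (inv_ne_zero h2')

theorem isUniformized_natCast [CharZero F] (B : ValuationSubring F) {p : ℕ} (hp : p.Prime)
    (hB : B.valuation p < 1) (t : B) (hs : IsAbsTranscendental (residue B t)) :
    B.IsUniformized (Subfield.closure {(t : F)}) p (Subfield.closure {residue B t}) := by
  refine B.isUniformized_of_forall _ (by exact_mod_cast hp.ne_zero) hB fun f hf => ?_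
  have hf0 : f ≠ 0 := by rintro rfl; simp at hf
  have hfin : FiniteMultiplicity (Polynomial.C (p : ℤ)) f := by
    refine FiniteMultiplicity.of_not_isUnit ?_ hf0
    rw [Polynomial.isUnit_C, Int.isUnit_iff]
    have := hp.two_le
    omega
  obtain ⟨g, hg, hgd⟩ := hfin.exists_eq_pow_mul_and_not_dvd
  refine ⟨multiplicity (Polynomial.C (p : ℤ)) f, Polynomial.aeval t g, ?_, ?_, ?_⟩
  · conv_lhs => rw [hg]
    rw [map_mul, map_pow, Polynomial.aeval_C]
    congr 1
    · simp
    · exact (map_aeval_int B.subtype t g).symm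
  · rw [map_aeval_int]
    exact mem_closure_singleton_iff.2 ⟨g, 1, by simp⟩
  · rw [map_aeval_int]
    exact hs.aeval_ne_zero hp (B.natCast_residue_eq_zero hB) hgd

end ValuationSubring

section CharP

open IsLocalRing

variable {E : Type*} [Field E]

theorem exists_isUniformized_bot {p : ℕ} (hp : p.Prime) (hpE : (p : E) = 0) {s : E}
    (hs : IsAbsTranscendental s) :
    ∃ A : ValuationSubring E, A.IsUniformized (Subfield.closure {s}) s ⊥ := by
  have hs0 : s ≠ 0 := by
    rintro rfl
    have := hs Polynomial.X (by simp) 1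
    simp at this
  let s' : Subring.closure {s} := ⟨s, Subring.subset_closure rfl⟩
  obtain ⟨A, hA, hsA⟩ := Ideal.image_subset_nonunits_valuationSubring
    (A := Subring.closure {s}) (Ideal.span {s'}) (by
      rw [Ne, Ideal.span_singleton_eq_top]
      intro hu
      obtain ⟨w, hw⟩ := hu.exists_right_inv
      obtain ⟨f, hf⟩ := mem_subringClosure_singleton_iff.1 w.2
      have hw' : s * (w : E) = 1 := congrArg Subtype.val hw
      have := hs (Polynomial.X * f - 1) (by simp [hf, hw']) 0
      simp at this)
  have hs1 : A.valuation s < 1 := by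
    rw [← ValuationSubring.mem_nonunits_iff]
    exact hsA ⟨s', Ideal.mem_span_singleton_self _, rfl⟩
  refine ⟨A, A.isUniformized_of_forall _ hs0 hs1 fun f hf => ?_⟩
  have hsm : s ∈ A := (A.valuation_le_one_iff s).1 hs1.le
  have hres : residue A ⟨s, hsm⟩ = 0 := (A.residue_eq_zero_iff _).2 hs1
  have hpk : (p : ResidueField A) = 0 := by
    have := congrArg (residue A) (show (p : A) = 0 from Subtype.ext (by simpa using hpE))
    simpa using this
  have main : ∀ (n : ℕ) (f : Polynomial ℤ), f.natDegree ≤ n → Polynomial.aeval s f ≠ 0 →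
      ∃ (k : ℕ) (g : Polynomial ℤ), Polynomial.aeval s f = s ^ k * Polynomial.aeval s g ∧
        ((g.coeff 0 : ℤ) : E) ≠ 0 := by
    intro n
    induction n with
    | zero =>
      intro f hf hne
      rw [Nat.le_zero] at hf
      rw [Polynomial.eq_C_of_natDegree_eq_zero hf] at hne
      refine ⟨0, f, by simp, ?_⟩
      simpa using hne
    | succ n ih =>
      intro f hf hne
      by_cases h0 : ((f.coeff 0 : ℤ) : E) = 0
      · have e : Polynomial.aeval s f = s * Polynomial.aeval s f.divX := by
          conv_lhs => rw [← Polynomial.divX_mul_X_add f]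
          simp [h0, mul_comm]
        obtain ⟨k, g, hg, hg0⟩ := ih f.divX (by
          rw [Polynomial.natDegree_divX_eq_natDegree_tsub_one]; omega) (by
          intro h; rw [e, h, mul_zero] at hne; exact hne rfl)
        exact ⟨k + 1, g, by rw [e, hg, pow_succ']; ring, hg0⟩
      · exact ⟨0, f, by simp, h0⟩
  obtain ⟨k, g, hg, hg0⟩ := main _ f le_rfl hf
  have hr : residue A (Polynomial.aeval (⟨s, hsm⟩ : A) g) = ((g.coeff 0 : ℤ) : ResidueField A) := by
    rw [map_aeval_int, hres, Polynomial.aeval_def, Polynomial.eval₂_at_zero]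
    simp
  refine ⟨k, Polynomial.aeval (⟨s, hsm⟩ : A) g, ?_, ?_, ?_⟩
  · rw [hg]; congr 1
    exact (map_aeval_int A.subtype ⟨s, hsm⟩ g).symm
  · rw [hr]; exact intCast_mem _ _
  · rw [hr, Ne, intCast_eq_zero_iff_dvd hp hpk, ← intCast_eq_zero_iff_dvd hp hpE]
    exact hg0

theorem exists_not_isSquare {p : ℕ} (hp : p.Prime) (hpE : (p : E) = 0) {s : E}
    (hs : IsAbsTranscendental s) [FiniteDimensional (Subfield.closure {s}) E] :
    ∃ y : E, ¬ IsSquare y := by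
  obtain ⟨A, hA⟩ := exists_isUniformized_bot hp hpE hs
  obtain ⟨y, hy0, hy⟩ := hA.exists_notMem_unitSq
  refine ⟨y, ?_⟩
  rintro ⟨z, rfl⟩
  exact hy ⟨1, z, by simp, by rintro rfl; simp at hy0, by ring⟩

theorem hasNonuniversalForm_of_charP {p : ℕ} (hp : p.Prime) (hp2 : p ≠ 2) (hpE : (p : E) = 0) {s : E}
    (hs : IsAbsTranscendental s) [FiniteDimensional (Subfield.closure {s}) E] :
    HasNonuniversalForm E := by
  obtain ⟨A, hA⟩ := exists_isUniformized_bot hp hpE hs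
  obtain ⟨y, hy0, hy⟩ := hA.exists_notMem_unitSq
  have hpk : (p : ResidueField A) = 0 := by
    have := congrArg (residue A) (show (p : A) = 0 from Subtype.ext (by simpa using hpE))
    simpa using this
  have := hA.finite_residueField
  have := Fact.mk hp
  have := charP_of_natCast_eq_zero hp hpk
  have : Finite (⊥ : Subfield (ResidueField A)) :=
    Nat.finite_of_card_ne_zero (by rw [Subfield.card_bot (ResidueField A) p]; exact hp.ne_zero)
  have : Finite (ResidueField A) := Module.finite_of_finite (⊥ : Subfield (ResidueField A))
  obtain ⟨ε, hε⟩ := FiniteField.exists_nonsquare (F := ResidueField A)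
    (by rwa [ringChar.eq (ResidueField A) p])
  exact A.hasNonuniversalForm hy0 hy hε

theorem isSquare_mul_of_not_isAbsTranscendental {p : ℕ} (hp : p.Prime) (hpE : (p : E) = 0)
    (hE : ∀ s : E, ¬ IsAbsTranscendental s) {x y : E} (hx : ¬ IsSquare x) (hy : ¬ IsSquare y) :
    IsSquare (x * y) := by
  classical
  have := Fact.mk hp
  have := charP_of_natCast_eq_zero hp hpE
  let := ZMod.algebra E p
  have halg : ∀ s : E, IsIntegral (ZMod p) s := by
    intro s
    have := hE s
    unfold IsAbsTranscendental at this
    push Not at this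
    obtain ⟨f, hf, n, hn⟩ := this
    rw [← isAlgebraic_iff_isIntegral]
    refine ⟨f.map (algebraMap ℤ (ZMod p)), ?_, ?_⟩
    · intro h
      apply hn
      have := congrArg (fun q => algebraMap (ZMod p) E (Polynomial.coeff q n)) h
      simpa using this
    · rw [Polynomial.aeval_map_algebraMap]; exact hf
  let M := IntermediateField.adjoin (ZMod p) {x, y}
  have : FiniteDimensional (ZMod p) M :=
    IntermediateField.finiteDimensional_adjoin fun s _ => halg s
  have : Finite M := Module.finite_of_finite (ZMod p)
  have := Fintype.ofFinite M
  have hxM : x ∈ M := IntermediateField.subset_adjoin _ _ (by simp)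
  have hyM : y ∈ M := IntermediateField.subset_adjoin _ _ (by simp)
  have hns : ∀ {z : E} (hz : z ∈ M), ¬ IsSquare z → ¬ IsSquare (⟨z, hz⟩ : M) := by
    rintro z hz hn ⟨w, hw⟩
    exact hn ⟨w, congrArg Subtype.val hw⟩
  have h1 := hns hxM hx
  have h2 := hns hyM hy
  have hch : ringChar M ≠ 2 := fun h => h1 (FiniteField.isSquare_of_char_two h _)
  have h3 : quadraticChar M (⟨x, hxM⟩ * ⟨y, hyM⟩) = 1 := by
    rw [map_mul, (quadraticChar_neg_one_iff_not_isSquare).2 h1,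
      (quadraticChar_neg_one_iff_not_isSquare).2 h2]; norm_num
  have h4 : IsSquare ((⟨x, hxM⟩ * ⟨y, hyM⟩ : M)) := by
    by_contra h
    rw [(quadraticChar_neg_one_iff_not_isSquare).2 h] at h3
    norm_num at h3
  obtain ⟨w, hw⟩ := h4
  exact ⟨w, congrArg Subtype.val hw⟩

end CharP

end

noncomputable section

theorem mem_closure_singleton_charTwo {E : Type*} [Field E] [CharP E 2] {s x : E}
    (hx : x ∈ Subfield.closure {s}) :
    ∃ a ∈ (Subfield.closure {s}).map (frobenius E 2), ∃ b ∈ (Subfield.closure {s}).map (frobenius E 2),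
      x = a + b * s := by
  set S := (Subfield.closure {s}).map (frobenius E 2) with hS
  have hss : s ∈ Subfield.closure {s} := Subfield.subset_closure rfl
  have hsq : ∀ y ∈ Subfield.closure {s}, y ^ 2 ∈ S := fun y hy => ⟨y, hy, rfl⟩
  induction hx using Subfield.closure_induction with
  | mem x hx =>
    rw [Set.mem_singleton_iff] at hx
    exact ⟨0, S.zero_mem, 1, S.one_mem, by rw [hx]; ring⟩
  | one => exact ⟨1, S.one_mem, 0, S.zero_mem, by ring⟩
  | add x y _ _ h1 h2 =>
    obtain ⟨a, ha, b, hb, e⟩ := h1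
    obtain ⟨c, hc, d, hd, e'⟩ := h2
    exact ⟨a + c, S.add_mem ha hc, b + d, S.add_mem hb hd, by rw [e, e']; ring⟩
  | neg x _ h1 =>
    obtain ⟨a, ha, b, hb, e⟩ := h1
    exact ⟨-a, S.neg_mem ha, -b, S.neg_mem hb, by rw [e]; ring⟩
  | inv x hx h1 =>
    obtain ⟨a, ha, b, hb, e⟩ := h1
    have hx2 := S.inv_mem (hsq x hx)
    refine ⟨a * (x ^ 2)⁻¹, S.mul_mem ha hx2, b * (x ^ 2)⁻¹, S.mul_mem hb hx2, ?_⟩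
    by_cases h0 : x = 0
    · simp [h0]
    · rw [show a * (x ^ 2)⁻¹ + b * (x ^ 2)⁻¹ * s = (a + b * s) * (x ^ 2)⁻¹ by ring, ← e]
      field_simp
  | mul x y _ _ h1 h2 =>
    obtain ⟨a, ha, b, hb, e⟩ := h1
    obtain ⟨c, hc, d, hd, e'⟩ := h2
    exact ⟨a * c + b * d * s ^ 2, S.add_mem (S.mul_mem ha hc) (S.mul_mem (S.mul_mem hb hd) (hsq s hss)),
      a * d + b * c, S.add_mem (S.mul_mem ha hd) (S.mul_mem hb hc), by rw [e, e']; ring⟩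

theorem exists_eq_sq_add_mul_sq {E : Type*} [Field E] [CharP E 2] {s : E}
    [FiniteDimensional (Subfield.closure {s}) E] {x : E} (hx : ¬ IsSquare x) (c : E) :
    ∃ X Y, c = X ^ 2 + x * Y ^ 2 := by
  by_contra hc
  push Not at hc
  set S₁ := Subfield.closure {s} with hS₁
  set S := S₁.map (frobenius E 2) with hS
  set n := Module.finrank S₁ E with hn
  have hnpos : 0 < n := Module.finrank_pos
  let e : Module.Basis (Fin n) S₁ E := Module.finBasis S₁ E
  have h2 : ∀ z : E, z + z = 0 := fun z => CharTwo.add_self_eq_zero z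
  have hspan : ⊤ ≤ Submodule.span S (Set.range (fun i : Fin n × Fin 2 => e i.1 * s ^ (i.2 : ℕ))) := by
    rintro z -
    rw [← e.sum_repr z]
    refine Submodule.sum_mem _ fun i _ => ?_
    obtain ⟨a, ha, b, hb, hab⟩ := mem_closure_singleton_charTwo (e.repr z i).2
    have : e.repr z i • e i = (⟨a, ha⟩ : S) • (e i * s ^ 0) + (⟨b, hb⟩ : S) • (e i * s ^ 1) := by
      simp only [Subfield.smul_def, smul_eq_mul]
      rw [hab]; ring
    rw [this]
    exact Submodule.add_mem _ (Submodule.smul_mem _ _ (Submodule.subset_span ⟨(i, 0), by simp⟩))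
      (Submodule.smul_mem _ _ (Submodule.subset_span ⟨(i, 1), by simp⟩))
  have hfin : Module.Finite S E := ⟨Submodule.fg_def.2 ⟨_, Set.finite_range _, top_le_iff.1 hspan⟩⟩
  have hle : Module.finrank S E ≤ n * 2 := by
    have := finrank_le_of_span_eq_top (top_le_iff.1 hspan)
    simpa using this
  have hli : LinearIndependent S (fun i : Fin n × Fin 3 => e i.1 ^ 2 * (![1, x, c] i.2)) := by
    rw [Fintype.linearIndependent_iff]
    intro g hg
    have hroot : ∀ i, ∃ r : S₁, (g i : E) = (r : E) ^ 2 := by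
      intro i
      obtain ⟨r, hr, e⟩ := (g i).2
      exact ⟨⟨r, hr⟩, e.symm⟩
    choose r hr using hroot
    let h : Fin 3 → E := fun j => ∑ i : Fin n, r (i, j) • e i
    have hsum : h 0 ^ 2 + x * h 1 ^ 2 + c * h 2 ^ 2 = 0 := by
      have key : ∀ j, h j ^ 2 = ∑ i, (g (i, j) : E) * e i ^ 2 := by
        intro j
        rw [CharTwo.sum_sq]
        refine Finset.sum_congr rfl fun i _ => ?_
        rw [hr, Subfield.smul_def, smul_eq_mul, mul_pow]
      rw [← hg, Fintype.sum_prod_type_right, Fin.sum_univ_three, key, key, key, Finset.mul_sum,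
        Finset.mul_sum]
      congr 1
      · congr 1
        · refine Finset.sum_congr rfl fun i _ => ?_
          simp [Subfield.smul_def]
        · refine Finset.sum_congr rfl fun i _ => ?_
          simp [Subfield.smul_def]; ring
      · refine Finset.sum_congr rfl fun i _ => ?_
        simp [Subfield.smul_def]; ring
    have hh2 : h 2 = 0 := by
      by_contra h0
      apply hc (h 0 / h 2) (h 1 / h 2)
      field_simp
      linear_combination hsum - h2 (h 0 ^ 2 + x * h 1 ^ 2)
    have hh1 : h 1 = 0 := by
      by_contra h0
      apply hx
      refine ⟨h 0 / h 1, ?_⟩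
      field_simp
      rw [hh2] at hsum
      linear_combination hsum - h2 (h 0 ^ 2)
    have hh0 : h 0 = 0 := by
      rw [hh1, hh2] at hsum
      simpa using hsum
    have hall : ∀ j, h j = 0 := by
      intro j; fin_cases j
      exacts [hh0, hh1, hh2]
    rintro ⟨i, j⟩
    have := Fintype.linearIndependent_iff.1 e.linearIndependent (fun i => r (i, j)) (hall j) i
    apply Subtype.ext
    rw [hr, this]; simp
  have := hli.fintype_card_le_finrank
  simp at this
  omega

namespace ValuationSubring

open IsLocalRing

variable {F : Type*} [Field F] (B : ValuationSubring F)

theorem mul_sq_mem_oneUnitSq_iff {u y : F} (hy : y ≠ 0) :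
    u * y ^ 2 ∈ B.oneUnitSq ↔ u ∈ B.oneUnitSq := by
  constructor
  · intro h
    exact B.isSqGroup_oneUnitSq.of_mul_right (B.isSqGroup_oneUnitSq.sq_mem hy) h
  · intro h
    exact B.isSqGroup_oneUnitSq.mul_mem h (B.isSqGroup_oneUnitSq.sq_mem hy)

theorem isUniversalPair_of_residueField
    (h : ∀ x : ResidueField B, ¬ IsSquare x → ∀ c, ∃ X Y, c = X ^ 2 + x * Y ^ 2) :
    IsUniversalPair B.oneUnitSq B.unitSq := by
  rintro _ ⟨u, y, hu, hy, rfl⟩ hx _ ⟨w, z, hw, hz, rfl⟩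
  rw [B.mul_sq_mem_oneUnitSq_iff hy] at hx
  obtain ⟨u, rfl⟩ := B.exists_coe_eq hu.le
  obtain ⟨w, rfl⟩ := B.exists_coe_eq hw.le
  rw [B.mem_oneUnitSq_iff_isSquare hu] at hx
  obtain ⟨α, β, e⟩ := h _ hx (residue B w)
  have hu0 := (B.residue_ne_zero_iff u).2 hu
  have hw0 := (B.residue_ne_zero_iff w).2 hw
  by_cases hα : α = 0
  · subst hα
    refine ⟨0, (w * z ^ 2) / (u * y ^ 2), Or.inr rfl, Or.inl ?_, ?_⟩
    · have hmem : (u : F) * w ∈ B.oneUnitSq := by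
        have : ((u * w : B) : F) ∈ B.oneUnitSq := by
          rw [B.mem_oneUnitSq_iff_isSquare (by push_cast; rw [map_mul, hu, hw, one_mul]), map_mul, e]
          exact ⟨residue B u * β, by ring⟩
        simpa using this
      have hu1 := B.ne_zero_of_valuation_eq_one hu
      refine B.isSqGroup_oneUnitSq.mem_of_eq hmem (z := z / (u * y))
        (div_ne_zero hz (mul_ne_zero hu1 hy)) ?_
      field_simp
    · have hu1 := B.ne_zero_of_valuation_eq_one hu
      field_simp
      simp
  · obtain ⟨a, rfl⟩ := residue_surjective α
    obtain ⟨b, rfl⟩ := residue_surjective β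
    refine ⟨(w - u * b ^ 2) * z ^ 2, b ^ 2 * (z / y) ^ 2, Or.inl ?_, ?_, by field_simp; ring⟩
    · rw [B.mul_sq_mem_oneUnitSq_iff hz]
      have e2 : residue B (w - u * b ^ 2) = residue B a ^ 2 := by
        rw [map_sub, map_mul, map_pow, e]; ring
      have : ((w - u * b ^ 2 : B) : F) ∈ B.oneUnitSq := by
        rw [B.mem_oneUnitSq_iff_isSquare, e2]
        · exact ⟨_, sq _⟩
        · rw [← B.residue_ne_zero_iff, e2]; exact pow_ne_zero _ hα
      simpa using this
    · by_cases hb : (b : F) = 0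
      · right; simp [hb]
      · left
        rw [← mul_pow]
        exact B.isSqGroup_oneUnitSq.sq_mem (mul_ne_zero hb (div_ne_zero hz hy))

theorem exists_nonrigidElt_of_charTwo [CharP (ResidueField B) 2] {y : ResidueField B}
    (hy : ¬ IsSquare y) : ∃ g, NonrigidElt B.oneUnitSq B.unitSq g := by
  obtain ⟨g, rfl⟩ := residue_surjective y
  have h2 : ∀ z : ResidueField B, z + z = 0 := fun z => CharTwo.add_self_eq_zero z
  have hval : ∀ w : B, ¬ IsSquare (residue B w) → B.valuation (w : F) = 1 := by
    intro w hw
    rw [← B.residue_ne_zero_iff]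
    intro h; rw [h] at hw; exact hw ⟨0, by simp⟩
  have hT : ∀ w : B, ¬ IsSquare (residue B w) → (w : F) ∉ B.oneUnitSq := by
    intro w hw
    rwa [B.mem_oneUnitSq_iff_isSquare (hval w hw)]
  have h1 : ¬ IsSquare (residue B (1 + g)) := by
    rintro ⟨z, hz⟩
    rw [map_add, map_one] at hz
    exact hy ⟨z + 1, by linear_combination hz - h2 z - h2 1⟩
  refine ⟨g, B.mem_unitSq_of_valuation (hval g hy), hT g hy, ?_, ?_, ?_, ?_⟩
  · have := hT (-g) (by rw [map_neg, show -residue B g = residue B g by linear_combination -h2 (residue B g)]; exact hy)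
    simpa using this
  · have := B.ne_zero_of_valuation_eq_one (hval _ h1)
    simpa using this
  · have := hT _ h1
    simpa using this
  · have := hT (g * (1 + g)) (by
      rintro ⟨z, hz⟩
      rw [map_mul, map_add, map_one] at hz
      exact hy ⟨z + residue B g, by
        linear_combination hz - (h2 (z * residue B g)) - h2 (residue B g ^ 2)⟩)
    simpa using this

variable [CharZero F] (hF : IsAbsFunctionField F)
include hF

theorem exists_isUniformized {p : ℕ} (hp : p.Prime) (hB : B.valuation p < 1) {s : ResidueField B}
    (hs : IsAbsTranscendental s) : ∃ E₀ : Subfield F, FiniteDimensional E₀ F ∧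
      B.IsUniformized E₀ p (Subfield.closure {s}) := by
  obtain ⟨t, rfl⟩ := residue_surjective s
  refine ⟨_, hF t ?_, B.isUniformized_natCast hp hB t hs⟩
  intro f hf n
  have h1 : Polynomial.aeval t f = 0 := by
    apply Subtype.ext
    exact (map_aeval_int B.subtype t f).trans hf
  have h2 : ∀ m, (p : ℤ) ∣ f.coeff m := fun m => by
    rw [← intCast_eq_zero_iff_dvd hp (B.natCast_residue_eq_zero hB)]
    refine hs f ?_ m
    rw [← map_aeval_int, h1, map_zero]
  by_contra hne
  have hf0 : f ≠ 0 := by rintro rfl; simp at hne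
  have hfin : FiniteMultiplicity (Polynomial.C (p : ℤ)) f := by
    refine FiniteMultiplicity.of_not_isUnit ?_ hf0
    rw [Polynomial.isUnit_C, Int.isUnit_iff]
    have := hp.two_le
    omega
  obtain ⟨g, hg, hgd⟩ := hfin.exists_eq_pow_mul_and_not_dvd
  refine hs.aeval_ne_zero hp (B.natCast_residue_eq_zero hB) hgd ?_
  rw [← map_aeval_int]
  have h3 : Polynomial.aeval (t : F) g = 0 := by
    rw [hg, map_mul, map_pow, Polynomial.aeval_C] at hf
    refine (mul_eq_zero.1 hf).resolve_left (pow_ne_zero _ ?_)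
    simpa using hp.ne_zero
  have h4 : Polynomial.aeval t g = 0 := Subtype.ext ((map_aeval_int B.subtype t g).trans h3)
  rw [h4, map_zero]

theorem index_of_prime {p : ℕ} (hp : p.Prime) (hB : B.valuation p < 1) {s : ResidueField B}
    (hs : IsAbsTranscendental s) {x y : F} (hx : x ≠ 0) (hy : y ≠ 0) (hxB : x ∉ B.unitSq)
    (hyB : y ∉ B.unitSq) : x * y ∈ B.unitSq := by
  obtain ⟨E₀, _, h⟩ := B.exists_isUniformized hF hp hB hs
  exact h.index hx hy hxB hyB

theorem finiteDimensional_closure_residue {p : ℕ} (hp : p.Prime) (hB : B.valuation p < 1)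
    {s : ResidueField B} (hs : IsAbsTranscendental s) :
    FiniteDimensional (Subfield.closure {s}) (ResidueField B) := by
  obtain ⟨E₀, _, h⟩ := B.exists_isUniformized hF hp hB hs
  exact h.finite_residueField

theorem hasNonuniversalForm_residueField {p : ℕ} (hp : p.Prime) (hp2 : p ≠ 2)
    (hB : B.valuation p < 1) {s : ResidueField B} (hs : IsAbsTranscendental s) :
    HasNonuniversalForm (ResidueField B) := by
  have := B.finiteDimensional_closure_residue hF hp hB hs
  exact hasNonuniversalForm_of_charP hp hp2 (B.natCast_residue_eq_zero hB) hs

theorem isUniversalPair_of_two (hB : B.valuation 2 < 1) {s : ResidueField B}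
    (hs : IsAbsTranscendental s) : IsUniversalPair B.oneUnitSq B.unitSq := by
  have hB' : B.valuation ((2 : ℕ) : F) < 1 := by exact_mod_cast hB
  have := B.finiteDimensional_closure_residue hF Nat.prime_two hB' hs
  have := charP_of_natCast_eq_zero Nat.prime_two (B.natCast_residue_eq_zero hB')
  exact B.isUniversalPair_of_residueField fun x hx c => exists_eq_sq_add_mul_sq (s := s) hx c

theorem isNice_of_two (hB : B.valuation 2 < 1) {s : ResidueField B}
    (hs : IsAbsTranscendental s) : B.IsNice := by
  have hB' : B.valuation ((2 : ℕ) : F) < 1 := by exact_mod_cast hB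
  have := B.finiteDimensional_closure_residue hF Nat.prime_two hB' hs
  have := charP_of_natCast_eq_zero Nat.prime_two (B.natCast_residue_eq_zero hB')
  obtain ⟨E₀, _, h⟩ := B.exists_isUniformized hF Nat.prime_two hB' hs
  obtain ⟨y, hy⟩ := exists_not_isSquare Nat.prime_two (B.natCast_residue_eq_zero hB') hs
  exact ⟨fun c hc0 hc z => h.arch hc0 hc z, fun hx hy hxB hyB => h.index hx hy hxB hyB,
    h.exists_notMem_unitSq, B.exists_nonrigidElt_of_charTwo hy⟩

end ValuationSubring

end

noncomputable section

/-- `x` and `y` exhibit `K` as the function field of the conic `a x² + b y² = 1` over `k`. -/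
structure ConicModel (k : Type*) [Field k] (a b : k) {K : Type*} [Field K] [Algebra k K]
    (x y : K) : Prop where
  eq : algebraMap k K a * x ^ 2 + algebraMap k K b * y ^ 2 = 1
  transcendental : Transcendental k x
  adjoin_eq : IntermediateField.adjoin k {x, y} = ⊤

theorem IsConicFunctionField.exists_model {k : Type*} [Field k] {a b : k} (hb : b ≠ 0)
    {K : Type*} [Field K] [Algebra k K] (h : IsConicFunctionField k a b K (algebraMap k K)) :
    ∃ x y : K, ConicModel k a b x y := by
  obtain ⟨f, hinj, hf, hgen⟩ := h
  let F : ConicRing k a b →ₐ[k] K :=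
    { f with commutes' := fun r => congrArg (fun g => g r) hf }
  let q : MvPolynomial (Fin 2) k →ₐ[k] ConicRing k a b := Ideal.Quotient.mkₐ k _
  let x := F (q (MvPolynomial.X 0))
  let y := F (q (MvPolynomial.X 1))
  have hq0 : q (conicPoly k a b) = 0 :=
    Ideal.Quotient.eq_zero_iff_mem.2 (Ideal.mem_span_singleton_self _)
  have haeval : ∀ P, F (q P) = MvPolynomial.aeval ![x, y] P := by
    intro P
    have : F.comp q = MvPolynomial.aeval ![x, y] := by
      apply MvPolynomial.algHom_ext
      intro i
      fin_cases i <;> simp [x, y]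
    exact congrArg (fun g => g P) this
  refine ⟨x, y, ?_, ?_, ?_⟩
  · have h1 := haeval (conicPoly k a b)
    rw [hq0, map_zero] at h1
    simp [conicPoly] at h1
    linear_combination -h1
  · rw [transcendental_iff]
    intro P hP
    have h1 : q (Polynomial.aeval (MvPolynomial.X 0) P) = 0 := by
      apply hinj
      rw [map_zero]
      change F (q _) = 0
      rw [haeval]
      rw [← hP, ← Polynomial.aeval_algHom_apply]
      simp
    have h2 := Ideal.Quotient.eq_zero_iff_mem.1 h1
    obtain ⟨Q, hQ⟩ := Ideal.mem_span_singleton.1 h2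
    let Ω := AlgebraicClosure (RatFunc k)
    let t : Ω := algebraMap (RatFunc k) Ω RatFunc.X
    have hb' : algebraMap k Ω b ≠ 0 := by simpa using hb
    obtain ⟨w, hw⟩ := IsAlgClosed.exists_pow_nat_eq
      ((1 - algebraMap k Ω a * t ^ 2) / algebraMap k Ω b) (n := 2) (by norm_num)
    have h3 := congrArg (MvPolynomial.aeval ![t, w]) hQ
    rw [← Polynomial.aeval_algHom_apply, map_mul] at h3
    have h4 : MvPolynomial.aeval ![t, w] (conicPoly k a b) = 0 := by
      simp [conicPoly]
      rw [hw, mul_div_assoc', mul_div_cancel_left₀ _ hb']; ring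
    rw [h4, zero_mul] at h3
    have h5 : Polynomial.aeval t P = 0 := by simpa using h3
    have h6 : Polynomial.aeval (RatFunc.X : RatFunc k) P = 0 := by
      apply (algebraMap (RatFunc k) Ω).injective
      rw [map_zero, ← h5, ← Polynomial.aeval_algebraMap_apply]
    have htr : Transcendental k (RatFunc.X : RatFunc k) := RatFunc.transcendental_X
    exact (transcendental_iff.1 htr) P h6
  · rw [eq_top_iff]
    rintro z -
    have hmem : ∀ p : ConicRing k a b, f p ∈ IntermediateField.adjoin k {x, y} := by
      intro p
      obtain ⟨P, rfl⟩ := Ideal.Quotient.mk_surjective p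
      change F (q P) ∈ _
      rw [haeval]
      induction P using MvPolynomial.induction_on with
      | C c => rw [MvPolynomial.aeval_C]; exact IntermediateField.algebraMap_mem _ c
      | add P Q hP hQ => rw [map_add]; exact add_mem hP hQ
      | mul_X P i hP =>
        rw [map_mul, MvPolynomial.aeval_X]
        refine mul_mem hP (IntermediateField.subset_adjoin _ _ ?_)
        fin_cases i <;> simp
    obtain ⟨p, r, -, rfl⟩ := hgen z
    exact div_mem (hmem p) (hmem r)

theorem isAlgebraic_of_subfield_le {K : Type*} [Field K] {M N : Subfield K} (h : M ≤ N) {z : K}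
    (hz : IsAlgebraic M z) : IsAlgebraic N z := by
  obtain ⟨P, hP0, hP⟩ := hz
  refine ⟨P.map (Subfield.inclusion h), (Polynomial.map_ne_zero_iff (Subfield.inclusion h).injective).2 hP0, ?_⟩
  rw [Polynomial.aeval_def, Polynomial.eval₂_map]
  exact hP

theorem IsAbsTranscendental.transcendental {K : Type*} [Field K] [CharZero K] {s : K}
    (hs : IsAbsTranscendental s) : Transcendental ℚ s := by
  rw [Transcendental, ← IsFractionRing.isAlgebraic_iff ℤ ℚ K, ← Transcendental, transcendental_iff]
  intro f hf
  ext n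
  simpa using hs f hf n

namespace ConicModel

variable {k : Type*} [Field k] [NumberField k] {a b : k} {K : Type*} [Field K]
  [Algebra k K] {x y : K}

open scoped IntermediateField.algebraAdjoinAdjoin in
theorem isAbsFunctionField [CharZero K] (h : ConicModel k a b x y) (hb : b ≠ 0) :
    IsAbsFunctionField K := by
  intro s hs
  have hkalg : ∀ (M : Subfield K) (c : k), IsAlgebraic M (algebraMap k K c) := by
    intro M c
    have h1 : IsAlgebraic ℚ (algebraMap k K c) :=
      (Algebra.IsAlgebraic.isAlgebraic (R := ℚ) c).algebraMap
    exact IsAlgebraic.tower_top M h1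
  have hle : ∀ (M : Subfield K), IsAlgebraic M x → Algebra.IsAlgebraic M K := by
    intro M hx
    have hy : IsAlgebraic M y := by
      have hb' : algebraMap k K b ≠ 0 := by simpa using hb
      have e : y ^ 2 = (1 - algebraMap k K a * x ^ 2) * (algebraMap k K b)⁻¹ := by
        have := h.eq
        field_simp
        linear_combination this
      have : IsAlgebraic M (y ^ 2) := by
        rw [e]
        exact (isAlgebraic_one.sub ((hkalg M a).mul (hx.pow 2))).mul (hkalg M b).inv
      exact this.of_pow (by norm_num)
    have htop : (algebraicClosure M K).toSubfield = ⊤ := by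
      rw [eq_top_iff]
      have h1 : (IntermediateField.adjoin k {x, y}).toSubfield = ⊤ := by
        rw [h.adjoin_eq]; rfl
      rw [← h1, IntermediateField.adjoin_toSubfield, Subfield.closure_le]
      rintro z (⟨c, rfl⟩ | rfl | rfl)
      · exact mem_algebraicClosure_iff.2 (hkalg M c)
      · exact mem_algebraicClosure_iff.2 hx
      · exact mem_algebraicClosure_iff.2 hy
    refine ⟨fun z => mem_algebraicClosure_iff.1 (?_ : z ∈ (algebraicClosure M K).toSubfield)⟩
    rw [htop]; trivial
  have halg : ∀ z : K, IsAlgebraic (Subfield.closure {s}) z := by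
    have h0 : Algebra.IsAlgebraic (IntermediateField.adjoin ℚ {x}) K := by
      have := hle (IntermediateField.adjoin ℚ {x}).toSubfield
        (isAlgebraic_algebraMap (⟨x, IntermediateField.subset_adjoin _ _ rfl⟩ :
          (IntermediateField.adjoin ℚ {x}).toSubfield))
      exact this
    have h1 : Algebra.IsAlgebraic (Algebra.adjoin ℚ {x}) K :=
      (IsFractionRing.comap_isAlgebraic_iff (A := Algebra.adjoin ℚ {x})
        (K := IntermediateField.adjoin ℚ {x}) (C := K)).2 h0
    have h2 := Algebra.IsAlgebraic.trdeg_le_cardinalMk ℚ ({x} : Set K)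
    have hind : AlgebraicIndependent ℚ (fun _ : Unit => s) :=
      algebraicIndependent_unique_type_iff.2 hs.transcendental
    have h3 := (hind.isTranscendenceBasis_of_lift_trdeg_le_of_finite
      (by simpa using h2)).isAlgebraic_field
    intro z
    have h4 := h3.isAlgebraic z
    refine isAlgebraic_of_subfield_le (M := (IntermediateField.adjoin ℚ _).toSubfield) ?_ h4
    rw [IntermediateField.adjoin_toSubfield, Subfield.closure_le]
    rintro _ (⟨c, rfl⟩ | ⟨_, rfl⟩)
    · simp
    · exact Subfield.subset_closure rfl
  set N := Subfield.closure {s}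
  let e := Module.finBasis ℚ k
  let S : Set K := {x, y} ∪ Set.range (fun i => algebraMap k K (e i))
  have hSfin : Finite S := ((Set.toFinite _).union (Set.finite_range _)).to_subtype
  have hfd : FiniteDimensional N (IntermediateField.adjoin N S) :=
    IntermediateField.finiteDimensional_adjoin fun z _ => (halg z).isIntegral
  have htop : (IntermediateField.adjoin N S) = ⊤ := by
    rw [eq_top_iff]
    have hsub : (IntermediateField.adjoin N S).toSubfield = ⊤ := by
      rw [eq_top_iff]
      have h1 : (IntermediateField.adjoin k {x, y}).toSubfield = ⊤ := by
        rw [h.adjoin_eq]; rfl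
      rw [← h1, IntermediateField.adjoin_toSubfield, Subfield.closure_le]
      rintro z (⟨c, rfl⟩ | hz)
      · change _ ∈ IntermediateField.adjoin N S
        rw [← e.sum_repr c, map_sum]
        refine sum_mem fun i _ => ?_
        rw [Rat.smul_def, map_mul, map_ratCast]
        exact mul_mem (SubfieldClass.ratCast_mem _ _)
          (IntermediateField.subset_adjoin _ _ (Or.inr ⟨i, rfl⟩))
      · exact IntermediateField.subset_adjoin N S (Or.inl hz)
    rintro z -
    change z ∈ (IntermediateField.adjoin N S).toSubfield
    rw [hsub]; trivial
  rw [htop] at hfd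
  exact LinearEquiv.finiteDimensional (IntermediateField.topEquiv (F := N) (E := K)).toLinearEquiv

end ConicModel

end

noncomputable section

theorem Polynomial.exists_prime_dvd_eval {F : Polynomial ℤ} (hF : F.natDegree ≠ 0) (N : ℕ) :
    ∃ p : ℕ, p.Prime ∧ N < p ∧ ∃ m : ℤ, (p : ℤ) ∣ F.eval m := by
  by_cases hc : F.eval 0 = 0
  · obtain ⟨p, hNp, hp⟩ := Nat.exists_infinite_primes (N + 1)
    exact ⟨p, hp, hNp, 0, by simp [hc]⟩
  set c := F.eval 0 with hcdef
  obtain ⟨M, hM⟩ : ∃ M : ℤ, M = (N.factorial : ℤ) := ⟨_, rfl⟩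
  have hM0 : M ≠ 0 := by simp [hM, Nat.factorial_ne_zero]
  obtain ⟨t, ht⟩ : ∃ t : ℤ, F.eval (c * (M * t)) ^ 2 ≠ c ^ 2 := by
    by_contra! hcon
    have h0 : F ^ 2 - Polynomial.C (c ^ 2) = 0 := by
      apply Polynomial.eq_zero_of_infinite_isRoot
      refine (Set.infinite_range_of_injective
        (f := fun t : ℤ => c * (M * t)) ?_).mono ?_
      · intro s t hst
        exact mul_left_cancel₀ hM0 (mul_left_cancel₀ hc hst)
      · rintro _ ⟨t, rfl⟩
        simpa [Polynomial.IsRoot, sub_eq_zero] using hcon t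
    have h1 := congrArg Polynomial.natDegree (sub_eq_zero.1 h0)
    rw [Polynomial.natDegree_pow, Polynomial.natDegree_C] at h1
    omega
  obtain ⟨w, hw⟩ := Polynomial.sub_dvd_eval_sub (c * (M * t)) 0 F
  rw [← hcdef] at hw
  have he : F.eval (c * (M * t)) = c * (1 + M * (t * w)) := by linear_combination hw
  have hne : (1 + M * (t * w)).natAbs ≠ 1 := by
    intro h
    apply ht
    rw [he, mul_pow]
    rcases Int.natAbs_eq (1 + M * (t * w)) with h1 | h1 <;> rw [h1, h] <;> simp
  obtain ⟨p, hp, hpd⟩ := Nat.exists_prime_and_dvd hne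
  have hpd' : (p : ℤ) ∣ 1 + M * (t * w) := Int.natCast_dvd.2 hpd
  refine ⟨p, hp, ?_, _, he ▸ hpd'.mul_left c⟩
  by_contra! hle
  have h1 : (p : ℤ) ∣ M := hM ▸ Int.natCast_dvd_natCast.2 (Nat.dvd_factorial hp.pos hle)
  have h2 : (p : ℤ) ∣ 1 := (dvd_add_left (h1.mul_right (t * w))).1 hpd'
  exact hp.one_lt.ne' (by exact_mod_cast Int.eq_one_of_dvd_one (by positivity) h2)

theorem Polynomial.exists_prime_exists_padic_root {P : Polynomial ℚ} (hP : Irreducible P) (N : ℕ) :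
    ∃ p : ℕ, N < p ∧ ∃ _ : Fact p.Prime, ∃ z : ℚ_[p], Polynomial.aeval z P = 0 := by
  obtain ⟨u, v, huv⟩ := hP.separable
  obtain ⟨m, hm, hmF⟩ := IsLocalization.integerNormalization_spec (nonZeroDivisors ℤ) P
  obtain ⟨n, hn, hnU⟩ := IsLocalization.integerNormalization_spec (nonZeroDivisors ℤ) u
  obtain ⟨r, hr, hrV⟩ := IsLocalization.integerNormalization_spec (nonZeroDivisors ℤ) v
  set F := IsLocalization.integerNormalization (nonZeroDivisors ℤ) P
  set U := IsLocalization.integerNormalization (nonZeroDivisors ℤ) u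
  set V := IsLocalization.integerNormalization (nonZeroDivisors ℤ) v
  rw [mem_nonZeroDivisors_iff_ne_zero] at hm hn hr
  have hdF : (Polynomial.derivative F).map (algebraMap ℤ ℚ) = m • Polynomial.derivative P := by
    rw [← Polynomial.derivative_map, hmF, map_zsmul]
  have hbez : Polynomial.C r * U * F + Polynomial.C n * V * Polynomial.derivative F =
      Polynomial.C (m * n * r) := by
    apply Polynomial.map_injective (algebraMap ℤ ℚ) (algebraMap ℤ ℚ).injective_int
    simp only [Polynomial.map_add, Polynomial.map_mul, hdF, hmF, hnU, hrV, Polynomial.map_C]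
    have : ∀ (j : ℤ) (Q : Polynomial ℚ), j • Q = Polynomial.C (j : ℚ) * Q := by
      intro j Q; rw [← Polynomial.smul_eq_C_mul, Int.cast_smul_eq_zsmul]
    simp only [this, eq_intCast, map_mul]
    linear_combination Polynomial.C (m : ℚ) * Polynomial.C (n : ℚ) * Polynomial.C (r : ℚ) * huv
  have hFdeg : F.natDegree ≠ 0 := by
    rw [← Polynomial.natDegree_map_eq_of_injective (algebraMap ℤ ℚ).injective_int F, hmF,
      Polynomial.natDegree_smul _ hm]
    exact hP.natDegree_pos.ne'
  obtain ⟨p, hp, hNp, x, hx⟩ :=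
    Polynomial.exists_prime_dvd_eval hFdeg (max N (m * n * r).natAbs)
  have : Fact p.Prime := ⟨hp⟩
  refine ⟨p, (le_max_left _ _).trans_lt hNp, ⟨hp⟩, ?_⟩
  have hder : ¬ (p : ℤ) ∣ (Polynomial.derivative F).eval x := by
    intro h
    have h1 := congrArg (Polynomial.eval x) hbez
    simp only [Polynomial.eval_add, Polynomial.eval_mul, Polynomial.eval_C] at h1
    have h2 : (p : ℤ) ∣ m * n * r := h1 ▸ (hx.mul_left _).add (h.mul_left _)
    have h3 := Nat.le_of_dvd (Int.natAbs_pos.2 (mul_ne_zero (mul_ne_zero hm hn) hr))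
      (Int.natCast_dvd.1 h2)
    exact absurd ((le_max_right _ _).trans_lt hNp) (not_lt.2 h3)
  have hcast : ∀ G : Polynomial ℤ, Polynomial.aeval (x : ℤ_[p]) G = ((G.eval x : ℤ) : ℤ_[p]) := by
    intro G
    rw [← eq_intCast (algebraMap ℤ ℤ_[p]) x, Polynomial.aeval_algebraMap_apply]; simp
  have hder1 : ‖(Polynomial.aeval (x : ℤ_[p])) (Polynomial.derivative F)‖ = 1 := by
    rw [hcast]
    refine le_antisymm (PadicInt.norm_le_one _) (not_lt.1 fun h => hder ?_)
    exact (PadicInt.norm_int_lt_one_iff_dvd _).1 h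
  obtain ⟨z, hz, -⟩ := hensels_lemma (F := F) (a := (x : ℤ_[p])) (by
    rw [hder1, one_pow, hcast]; exact (PadicInt.norm_int_lt_one_iff_dvd _).2 hx)
  refine ⟨z, ?_⟩
  have h1 : Polynomial.aeval (z : ℚ_[p]) F = 0 := by
    have := congrArg (PadicInt.Coe.ringHom (p := p)) hz
    rw [map_aeval_int, map_zero] at this
    exact this
  rw [← Polynomial.aeval_map_algebraMap ℚ, hmF, map_zsmul, zsmul_eq_mul] at h1
  exact (mul_eq_zero.1 h1).resolve_left (by exact_mod_cast hm)

namespace NumberField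

variable (κ : Type*) [Field κ] [NumberField κ]

theorem exists_ringHom_padic (N : ℕ) :
    ∃ p : ℕ, N < p ∧ ∃ _ : Fact p.Prime, Nonempty (κ →+* ℚ_[p]) := by
  let pb := Field.powerBasisOfFiniteOfSeparable ℚ κ
  obtain ⟨p, hp, hpp, z, hz⟩ := Polynomial.exists_prime_exists_padic_root
    (minpoly.irreducible (IsIntegral.of_finite ℚ pb.gen)) N
  exact ⟨p, hp, hpp, ⟨(pb.lift z hz).toRingHom⟩⟩

end NumberField

theorem Padic.not_isSquare_of_odd_valuation {p : ℕ} [Fact p.Prime] {x : ℚ_[p]}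
    (hx : Odd x.valuation) : ¬ IsSquare x := by
  rintro ⟨y, rfl⟩
  rcases eq_or_ne y 0 with rfl | hy
  · simp at hx
  · rw [Padic.valuation_mul hy hy] at hx
    exact Int.not_even_iff_odd.2 hx ⟨_, rfl⟩

theorem Padic.valuation_eq_of_norm {p : ℕ} [hp : Fact p.Prime] {x : ℚ_[p]} {n : ℤ}
    (h : ‖x‖ = (p : ℝ) ^ (-n)) : x.valuation = n := by
  have hp0 : (0 : ℝ) < p := by exact_mod_cast hp.out.pos
  have hx : x ≠ 0 := by
    rintro rfl; rw [norm_zero] at h; exact (zpow_pos hp0 _).ne h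
  rw [Padic.norm_eq_zpow_neg_valuation hx] at h
  have := zpow_right_injective₀ hp0 (by exact_mod_cast hp.out.one_lt.ne') h
  simpa using this

theorem Padic.valuation_intCast_of_not_dvd {p : ℕ} [hp : Fact p.Prime] {n : ℤ}
    (h : ¬ (p : ℤ) ∣ n) : (n : ℚ_[p]).valuation = 0 := by
  rw [Padic.valuation_intCast]
  simp [padicValInt.eq_zero_of_not_dvd h]

theorem Padic.valuation_intCast_of_modEq {p : ℕ} [hp : Fact p.Prime] {n : ℤ}
    (h : n ≡ p [ZMOD (p ^ 2)]) : (n : ℚ_[p]).valuation = 1 := by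
  obtain ⟨w, hw⟩ := h.symm.dvd
  have hn : n = p * (1 + p * w) := by linear_combination hw
  have h1 : ¬ (p : ℤ) ∣ 1 + p * w := by
    intro hd
    have := (dvd_add_left (dvd_mul_right (p : ℤ) w)).1 hd
    exact hp.out.one_lt.ne' (by exact_mod_cast Int.eq_one_of_dvd_one (by positivity) this)
  have h2 : ((1 + p * w : ℤ) : ℚ_[p]) ≠ 0 := by
    intro h0
    rw [Int.cast_eq_zero] at h0
    exact h1 (h0 ▸ dvd_zero _)
  rw [hn, Int.cast_mul, Padic.valuation_mul (by simpa using hp.out.ne_zero) h2,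
    Padic.valuation_intCast_of_not_dvd h1]
  simp

namespace NumberField

variable (κ : Type*) [Field κ] [NumberField κ]

theorem exists_intCast_not_isSquare : ∃ h : ℤ, ¬ IsSquare (h : κ) ∧ ¬ IsSquare (-h : κ) ∧
    ¬ IsSquare (1 + h : κ) ∧ ¬ IsSquare (h * (1 + h) : κ) := by
  obtain ⟨p, -, hp, ⟨φ⟩⟩ := exists_ringHom_padic κ 0
  obtain ⟨q, hpq, hq, ⟨ψ⟩⟩ := exists_ringHom_padic κ p
  have hcop : (p ^ 2).Coprime (q ^ 2) :=
    Nat.Coprime.pow _ _ ((Nat.coprime_primes hp.out hq.out).2 hpq.ne)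
  obtain ⟨h, hh1, hh2⟩ := Nat.chineseRemainder hcop p (q - 1)
  have e1 : (h : ℤ) ≡ p [ZMOD (p ^ 2)] := by exact_mod_cast Int.natCast_modEq_iff.2 hh1
  have e2 : (1 + h : ℤ) ≡ q [ZMOD (q ^ 2)] := by
    have := (Int.natCast_modEq_iff.2 hh2).add_left 1
    rw [Nat.cast_sub hq.out.one_le] at this
    simpa using this
  have v1 := Padic.valuation_intCast_of_modEq e1
  have v2 := Padic.valuation_intCast_of_modEq e2
  have hh0 : ((h : ℤ) : ℚ_[p]) ≠ 0 := by
    intro h0; rw [h0, Padic.valuation_zero] at v1; omega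
  have hh1' : ((1 + h : ℤ) : ℚ_[p]) ≠ 0 := by
    rw [Int.cast_ne_zero]; omega
  have v3 : ((1 + h : ℤ) : ℚ_[p]).valuation = 0 := by
    apply Padic.valuation_intCast_of_not_dvd
    intro hd
    have h1 : (p : ℤ) ∣ h := by
      obtain ⟨w, hw⟩ := e1.symm.dvd
      exact ⟨1 + p * w, by linear_combination hw⟩
    have := (dvd_add_left h1).1 hd
    exact hp.out.one_lt.ne' (by exact_mod_cast Int.eq_one_of_dvd_one (by positivity) this)
  refine ⟨h, ?_, ?_, ?_, ?_⟩
  · intro hs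
    refine Padic.not_isSquare_of_odd_valuation (p := p) (x := ((h : ℤ) : ℚ_[p])) ?_ ?_
    · rw [v1]; exact odd_one
    · simpa using hs.map φ
  · intro hs
    refine Padic.not_isSquare_of_odd_valuation (p := p) (x := ((-1 : ℤ) : ℚ_[p]) * (h : ℤ)) ?_ ?_
    · rw [Padic.valuation_mul (by simp) hh0, v1, Padic.valuation_intCast_of_not_dvd]
      · exact odd_one
      · intro hd
        have := hd.neg_right
        exact hp.out.one_lt.ne' (by exact_mod_cast Int.eq_one_of_dvd_one (by positivity) this)
    · simpa using hs.map φ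
  · intro hs
    refine Padic.not_isSquare_of_odd_valuation (p := q) (x := ((1 + h : ℤ) : ℚ_[q])) ?_ ?_
    · rw [v2]; exact odd_one
    · simpa using hs.map ψ
  · intro hs
    refine Padic.not_isSquare_of_odd_valuation (p := p)
      (x := ((h : ℤ) : ℚ_[p]) * ((1 + h : ℤ) : ℚ_[p])) ?_ ?_
    · rw [Padic.valuation_mul hh0 hh1', v1, v3]; exact odd_one
    · simpa using hs.map φ

theorem hasNonuniversalForm : HasNonuniversalForm κ := by
  obtain ⟨p, hp2, hp, ⟨φ⟩⟩ := exists_ringHom_padic κ 2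
  let A : ValuationSubring κ :=
    { carrier := {x | ‖φ x‖ ≤ 1}
      mul_mem' := fun {x y} hx hy => by
        simp only [Set.mem_ofPred_eq, map_mul, norm_mul] at *
        exact mul_le_one₀ hx (norm_nonneg _) hy
      one_mem' := by simp
      add_mem' := fun {x y} hx hy => by
        simp only [Set.mem_ofPred_eq, map_add] at *
        exact (Padic.nonarchimedean _ _).trans (max_le hx hy)
      zero_mem' := by simp
      neg_mem' := fun {x} hx => by simpa using hx
      mem_or_inv_mem' := fun x => by
        simp only [Set.mem_ofPred_eq, map_inv₀, norm_inv]
        rcases le_total ‖φ x‖ 1 with h | h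
        · exact Or.inl h
        · exact Or.inr (inv_le_one_of_one_le₀ h) }
  have hmem : ∀ x, x ∈ A ↔ ‖φ x‖ ≤ 1 := fun x => Iff.rfl
  have hlt : ∀ x, A.valuation x < 1 → ‖φ x‖ < 1 := by
    intro x hx
    rcases eq_or_ne x 0 with rfl | hx0
    · simp
    · rw [A.valuation_lt_one_iff_inv_notMem hx0, hmem, map_inv₀, norm_inv, not_le] at hx
      exact (one_lt_inv₀ (norm_pos_iff.2 (by simpa using hx0))).1 hx
  have hone : ∀ x, A.valuation x = 1 → ‖φ x‖ = 1 := by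
    intro x hx
    refine le_antisymm ((A.valuation_le_one_iff x).1 hx.le) ?_
    have h0 := A.ne_zero_of_valuation_eq_one hx
    have h1 : A.valuation x⁻¹ = 1 := by rw [map_inv₀, hx, inv_one]
    have h2 := (A.valuation_le_one_iff _).1 h1.le
    rw [hmem, map_inv₀, norm_inv] at h2
    exact (inv_le_one₀ (norm_pos_iff.2 (by simpa using h0))).1 h2
  obtain ⟨c, hc⟩ := FiniteField.exists_nonsquare (F := ZMod p) (by
    rw [ZMod.ringChar_zmod_n]; omega)
  refine A.hasNonuniversalForm (π := (p : κ)) (by simpa using hp.out.ne_zero) ?_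
    (ε := IsLocalRing.residue A (c.val : A)) ?_
  · rintro ⟨u, y, hu, hy, e⟩
    have hu1 := hone u hu
    have huv : (φ u).valuation = 0 := Padic.valuation_eq_of_norm (n := 0) (by simpa using hu1)
    have hu0 := A.ne_zero_of_valuation_eq_one hu
    have h1 := congrArg (fun x => (φ x).valuation) e
    simp only [map_natCast, map_mul, map_pow] at h1
    rw [Padic.valuation_mul (by simpa using hu0) (pow_ne_zero _ (by simpa using hy)),
      Padic.valuation_pow, huv, Padic.valuation_p] at h1
    push_cast at h1
    omega
  · rintro ⟨r, hr⟩
    obtain ⟨s, rfl⟩ := IsLocalRing.residue_surjective r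
    rw [← map_mul, A.residue_eq_iff] at hr
    have h1 := hlt _ hr
    let z : ℤ_[p] := ⟨φ s, s.2⟩
    have h2 : ‖((c.val : ℤ_[p]) - z * z)‖ < 1 := by
      have : (((c.val : ℤ_[p]) - z * z : ℤ_[p]) : ℚ_[p]) = φ ((c.val : A) - (s * s : A) : κ) := by
        rw [PadicInt.coe_sub, PadicInt.coe_mul, PadicInt.coe_natCast, map_sub, MulMemClass.coe_mul,
          map_mul]
        generalize c.val = n
        simp [z]
      rw [PadicInt.norm_def, this]; exact h1
    have h3 : (c.val : ℤ_[p]) - z * z ∈ RingHom.ker (PadicInt.toZMod (p := p)) := by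
      rw [PadicInt.ker_toZMod]
      exact (IsLocalRing.mem_maximalIdeal _).2 (PadicInt.mem_nonunits.2 h2)
    rw [RingHom.mem_ker, map_sub, map_mul, map_natCast, sub_eq_zero, ZMod.natCast_zmod_val] at h3
    exact hc ⟨_, h3⟩

end NumberField

open NumberField in
theorem NumberField.algebraMap_surjective_of_sq (l κ : Type*) [Field l] [NumberField l] [Field κ]
    [NumberField κ] [Algebra l κ]
    (H : ∀ z : κ, z ≠ 0 → ∃ (c : l) (s : κ), z = algebraMap l κ c * s ^ 2) :
    Function.Surjective (algebraMap l κ) := by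
  have : FiniteDimensional l κ := Module.Finite.of_restrictScalars_finite ℚ l κ
  intro θ
  by_contra hθ
  let M := IntermediateField.normalClosure l κ (AlgebraicClosure κ)
  have : FiniteDimensional l M := normalClosure.is_finiteDimensional l κ (AlgebraicClosure κ)
  have : FiniteDimensional ℚ M := FiniteDimensional.trans ℚ l M
  have : NumberField M := { to_charZero := inferInstance, to_finiteDimensional := this }
  have : IsGalois l M := ⟨⟩
  obtain ⟨g, hg⟩ : ∃ g : M ≃ₐ[l] M, g (algebraMap κ M θ) ≠ algebraMap κ M θ := by
    by_contra! hcon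
    have := (IsGalois.mem_bot_iff_fixed (F := l) (E := M) (algebraMap κ M θ)).2 hcon
    obtain ⟨r, hr⟩ := IntermediateField.mem_bot.1 this
    apply hθ
    refine ⟨r, (algebraMap κ M).injective ?_⟩
    rw [← hr, ← IsScalarTower.algebraMap_apply]
  obtain ⟨p, -, hp, ⟨σ⟩⟩ := exists_ringHom_padic M 0
  let σ₁ : κ →+* ℚ_[p] := σ.comp (algebraMap κ M)
  let σ₂ : κ →+* ℚ_[p] := σ.comp ((g : M →+* M).comp (algebraMap κ M))
  have hσl : ∀ c : l, σ₁ (algebraMap l κ c) = σ₂ (algebraMap l κ c) := by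
    intro c
    simp only [σ₁, σ₂, RingHom.comp_apply]
    rw [← IsScalarTower.algebraMap_apply]
    congr 1
    exact (g.commutes c).symm
  have hσθ : σ₂ θ - σ₁ θ ≠ 0 := by
    rw [sub_ne_zero]
    intro h
    exact hg (σ.injective h)
  have hp0 : (0 : ℝ) < p := by exact_mod_cast hp.out.pos
  have hp1 : (1 : ℝ) < p := by exact_mod_cast hp.out.one_lt
  set D := (σ₂ θ - σ₁ θ).valuation with hD
  have hDn := Padic.norm_eq_zpow_neg_valuation hσθ
  rw [← hD] at hDn
  obtain ⟨r, hr⟩ := Padic.rat_dense p (σ₁ θ - (p : ℚ_[p]) ^ (D + 1))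
    (ε := (p : ℝ) ^ (-(D + 1))) (zpow_pos hp0 _)
  have hn1 : ‖σ₁ θ - r‖ = (p : ℝ) ^ (-(D + 1)) := by
    have e : σ₁ θ - r = (σ₁ θ - (p : ℚ_[p]) ^ (D + 1) - r) + (p : ℚ_[p]) ^ (D + 1) := by ring
    have hpn : ‖(p : ℚ_[p]) ^ (D + 1)‖ = (p : ℝ) ^ (-(D + 1)) := Padic.norm_p_zpow _
    rw [e, Padic.add_eq_max_of_ne (by rw [hpn]; exact hr.ne), hpn]
    exact max_eq_right hr.le
  have hn2 : ‖σ₂ θ - r‖ = (p : ℝ) ^ (-D) := by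
    have e : σ₂ θ - r = (σ₂ θ - σ₁ θ) + (σ₁ θ - r) := by ring
    have hlt : (p : ℝ) ^ (-(D + 1)) < (p : ℝ) ^ (-D) := zpow_lt_zpow_right₀ hp1 (by omega)
    rw [e, Padic.add_eq_max_of_ne (by rw [hn1, hDn]; exact hlt.ne'), hn1, hDn]
    exact max_eq_left hlt.le
  have hv1 := Padic.valuation_eq_of_norm hn1
  have hv2 := Padic.valuation_eq_of_norm hn2
  have hz0 : θ - (r : κ) ≠ 0 := by
    rw [sub_ne_zero]
    rintro h
    exact hθ ⟨r, by simp [h]⟩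
  obtain ⟨c, s, hcs⟩ := H _ hz0
  have hs0 : s ≠ 0 := by rintro rfl; simp at hcs; exact hz0 hcs
  have hc0 : algebraMap l κ c ≠ 0 := by intro h; rw [h, zero_mul] at hcs; exact hz0 hcs
  have key : ∀ τ : κ →+* ℚ_[p], (τ θ - r).valuation =
      (τ (algebraMap l κ c)).valuation + 2 * (τ s).valuation := by
    intro τ
    have h1 := congrArg τ hcs
    rw [map_sub, map_ratCast, map_mul, map_pow] at h1
    rw [h1, Padic.valuation_mul (by simpa using hc0) (pow_ne_zero _ (by simpa using hs0)),
      Padic.valuation_pow]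
    norm_num
  have k1 := key σ₁
  have k2 := key σ₂
  rw [hv1, hσl] at k1
  rw [hv2] at k2
  omega

end

noncomputable section

/-- `z = c t ^ n w` where `w` is a quotient of polynomials in `t` with constant term one. -/
def IsLeading {κ E : Type*} [Field κ] [Field E] [Algebra κ E] (t z : E) (c : κ) (n : ℤ) : Prop :=
  c ≠ 0 ∧ ∃ p q : Polynomial κ, p.coeff 0 = 1 ∧ q.coeff 0 = 1 ∧
    z = algebraMap κ E c * t ^ n * (Polynomial.aeval t p / Polynomial.aeval t q)

theorem Polynomial.exists_eq_mul_X_pow_mul {κ : Type*} [Field κ] {P : Polynomial κ} (hP : P ≠ 0) :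
    ∃ (c : κ) (n : ℕ) (p : Polynomial κ), c ≠ 0 ∧ p.coeff 0 = 1 ∧
      P = Polynomial.C c * Polynomial.X ^ n * p := by
  obtain ⟨q, hq, hX⟩ := Polynomial.exists_eq_pow_rootMultiplicity_mul_and_not_dvd P hP 0
  rw [Polynomial.C_0, sub_zero] at hq hX
  rw [Polynomial.X_dvd_iff] at hX
  refine ⟨q.coeff 0, Polynomial.rootMultiplicity 0 P, Polynomial.C (q.coeff 0)⁻¹ * q, hX, by simp [hX], hq.trans ?_⟩
  have : (Polynomial.C (q.coeff 0) : Polynomial κ) * Polynomial.C (q.coeff 0)⁻¹ = 1 := by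
    rw [← Polynomial.C_mul, mul_inv_cancel₀ hX, Polynomial.C_1]
  linear_combination -(Polynomial.X ^ Polynomial.rootMultiplicity 0 P * q) * this

namespace IsLeading

variable {κ E : Type*} [Field κ] [Field E] [Algebra κ E] {t z w : E} {c d : κ} {n m : ℤ}

theorem aeval_ne_zero (ht : Transcendental κ t) {p : Polynomial κ} (hp : p.coeff 0 = 1) :
    Polynomial.aeval t p ≠ 0 := by
  intro h
  have := (transcendental_iff.1 ht) p h
  simp [this] at hp

theorem base_ne_zero (ht : Transcendental κ t) : t ≠ 0 := by
  rintro rfl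
  exact ht isAlgebraic_zero

theorem ne_zero (ht : Transcendental κ t) (h : IsLeading t z c n) : z ≠ 0 := by
  obtain ⟨hc, p, q, hp, hq, rfl⟩ := h
  exact mul_ne_zero (mul_ne_zero (by simpa using hc) (zpow_ne_zero _ (base_ne_zero ht)))
    (div_ne_zero (aeval_ne_zero ht hp) (aeval_ne_zero ht hq))

theorem mul (ht : Transcendental κ t) (hz : IsLeading t z c n) (hw : IsLeading t w d m) :
    IsLeading t (z * w) (c * d) (n + m) := by
  obtain ⟨hc, p, q, hp, hq, rfl⟩ := hz
  obtain ⟨hd, r, s, hr, hs, rfl⟩ := hw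
  refine ⟨mul_ne_zero hc hd, p * r, q * s, by simp [Polynomial.mul_coeff_zero, hp, hr],
    by simp [Polynomial.mul_coeff_zero, hq, hs], ?_⟩
  rw [map_mul, map_mul, map_mul, zpow_add₀ (base_ne_zero ht)]
  have := aeval_ne_zero ht hq
  have := aeval_ne_zero ht hs
  field_simp

theorem inv (hz : IsLeading t z c n) : IsLeading t z⁻¹ c⁻¹ (-n) := by
  obtain ⟨hc, p, q, hp, hq, rfl⟩ := hz
  refine ⟨inv_ne_zero hc, q, p, hq, hp, ?_⟩
  rw [mul_inv, mul_inv, inv_div, map_inv₀, zpow_neg]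

theorem const (hc : c ≠ 0) : IsLeading t (algebraMap κ E c) c 0 :=
  ⟨hc, 1, 1, by simp, by simp, by simp⟩

theorem pow (ht : Transcendental κ t) (hz : IsLeading t z c n) (k : ℕ) :
    IsLeading t (z ^ k) (c ^ k) (n * k) := by
  induction k with
  | zero => simpa using const (t := t) (one_ne_zero (α := κ))
  | succ k ih =>
    have := ih.mul ht hz
    rw [pow_succ, pow_succ]
    convert this using 1
    push_cast; ring

theorem unique (ht : Transcendental κ t) (hz : IsLeading t z c n) (hw : IsLeading t z d m) :
    n = m ∧ c = d := by
  wlog hnm : n ≤ m generalizing n m c d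
  · obtain ⟨h1, h2⟩ := this hw hz (le_of_not_ge hnm)
    exact ⟨h1.symm, h2.symm⟩
  obtain ⟨hc, p, q, hp, hq, rfl⟩ := hz
  obtain ⟨hd, r, s, hr, hs, e⟩ := hw
  obtain ⟨k, hk⟩ := Int.eq_ofNat_of_zero_le (sub_nonneg.2 hnm)
  have hm : m = n + k := by omega
  have hq' := aeval_ne_zero ht hq
  have hs' := aeval_ne_zero ht hs
  have ht0 := zpow_ne_zero n (base_ne_zero ht)
  rw [hm, zpow_add₀ (base_ne_zero ht), zpow_natCast] at e
  have h1 : Polynomial.aeval t (Polynomial.C c * p * s) =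
      Polynomial.aeval t (Polynomial.C d * Polynomial.X ^ k * r * q) := by
    simp only [map_mul, Polynomial.aeval_C, map_pow, Polynomial.aeval_X]
    field_simp at e
    linear_combination e
  have h2 := (transcendental_iff_injective.1 ht) h1
  have h3 := congrArg (fun P => Polynomial.coeff P 0) h2
  simp only [Polynomial.mul_coeff_zero, Polynomial.coeff_C_zero, hp, hq, hr, hs, mul_one] at h3
  rcases Nat.eq_zero_or_pos k with rfl | hk0
  · simp at h3
    exact ⟨by omega, h3⟩
  · rw [Polynomial.coeff_X_pow, if_neg hk0.ne, mul_zero] at h3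
    exact absurd h3 hc

theorem sub_const (ht : Transcendental κ t) (hz : IsLeading t z c 0) (hcd : c ≠ d) :
    IsLeading t (z - algebraMap κ E d) (c - d) 0 := by
  obtain ⟨hc, p, q, hp, hq, rfl⟩ := hz
  have h0 : c - d ≠ 0 := sub_ne_zero.2 hcd
  refine ⟨h0, Polynomial.C (c - d)⁻¹ * (Polynomial.C c * p - Polynomial.C d * q), q, ?_, hq, ?_⟩
  · simp [Polynomial.mul_coeff_zero, hp, hq, h0]
  · have hq' := aeval_ne_zero ht hq
    have h1 : algebraMap κ E (c - d) ≠ 0 := (map_ne_zero _).2 h0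
    simp only [map_mul, map_sub, Polynomial.aeval_C, map_inv₀, zpow_zero, mul_one] at h1 ⊢
    field_simp

theorem exists_of_div (ht : Transcendental κ t) {F G : Polynomial κ}
    (hz : z = Polynomial.aeval t F / Polynomial.aeval t G) (hz0 : z ≠ 0) :
    ∃ c n, IsLeading t z (c : κ) n := by
  have hF : F ≠ 0 := by rintro rfl; simp at hz; exact hz0 hz
  have hG : G ≠ 0 := by rintro rfl; simp at hz; exact hz0 hz
  obtain ⟨c, n, p, hc, hp, rfl⟩ := Polynomial.exists_eq_mul_X_pow_mul hF
  obtain ⟨d, m, q, hd, hq, rfl⟩ := Polynomial.exists_eq_mul_X_pow_mul hG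
  refine ⟨c / d, n - m, div_ne_zero hc hd, p, q, hp, hq, ?_⟩
  have ht0 := base_ne_zero ht
  rw [hz, zpow_sub₀ ht0]
  simp only [map_mul, map_div₀, Polynomial.aeval_C, map_pow, Polynomial.aeval_X, zpow_natCast]
  field_simp

end IsLeading

namespace ValuationSubring

open IsLocalRing

/-- An embedding of `K` into a rational function field `κ(t)` inducing the given valuation
on `K` with ramification index one. -/
structure LocalParam {K κ E : Type*} [Field K] [Field κ] [Field E] [Algebra κ E]
    (A : ValuationSubring K) (φ : K →+* E) (t : E) : Prop where
  transcendental : Transcendental κ t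
  exists_div : ∀ z : E, ∃ F G : Polynomial κ, z = Polynomial.aeval t F / Polynomial.aeval t G
  mem_iff : ∀ (z : K) (c : κ) (n : ℤ), IsLeading t (φ z) c n → (z ∈ A ↔ 0 ≤ n)
  exists_uniformizer : ∃ (ϖ : K) (c : κ), IsLeading t (φ ϖ) c 1

namespace LocalParam

variable {K κ E : Type*} [Field K] [Field κ] [Field E] [Algebra κ E]
  {A : ValuationSubring K} {φ : K →+* E} {t : E} (h : A.LocalParam (κ := κ) φ t)
include h

theorem exists_isLeading {z : K} (hz : z ≠ 0) : ∃ (c : κ) (n : ℤ), IsLeading t (φ z) c n := by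
  obtain ⟨F, G, hFG⟩ := h.exists_div (φ z)
  exact IsLeading.exists_of_div h.transcendental hFG (by simpa using hz)

theorem valuation_lt_one_iff {z : K} {c : κ} {n : ℤ} (hz : IsLeading t (φ z) c n) :
    A.valuation z < 1 ↔ 0 < n := by
  have hz0 : z ≠ 0 := by rintro rfl; simpa using hz.ne_zero h.transcendental
  rw [A.valuation_lt_one_iff_inv_notMem hz0, h.mem_iff z⁻¹ c⁻¹ (-n) (by simpa using hz.inv)]
  omega

theorem valuation_eq_one_iff {z : K} {c : κ} {n : ℤ} (hz : IsLeading t (φ z) c n) :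
    A.valuation z = 1 ↔ n = 0 := by
  have h1 := h.valuation_lt_one_iff hz
  have h2 := h.mem_iff z c n hz
  rw [← A.valuation_le_one_iff] at h2
  rw [le_antisymm_iff, h2, ← not_lt (a := A.valuation z), h1]
  omega

theorem isLeading_one_of_sub {m : K} (hm : A.valuation (m - 1) < 1) :
    IsLeading t (φ m) (1 : κ) 0 := by
  have h1 := A.valuation_eq_one_of_sub hm
  obtain ⟨c, n, hc⟩ := h.exists_isLeading (A.ne_zero_of_valuation_eq_one h1)
  obtain rfl := (h.valuation_eq_one_iff hc).1 h1
  by_cases hc1 : c = 1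
  · rwa [hc1] at hc
  · have h2 := hc.sub_const h.transcendental hc1
    rw [map_one, ← map_one φ, ← map_sub] at h2
    exact absurd ((h.valuation_eq_one_iff h2).2 rfl) hm.ne

theorem mem_unitSq_iff {z : K} {c : κ} {n : ℤ} (hz : IsLeading t (φ z) c n) :
    z ∈ A.unitSq ↔ Even n := by
  have ht := h.transcendental
  constructor
  · rintro ⟨u, y, hu, hy, rfl⟩
    obtain ⟨d, m, hd⟩ := h.exists_isLeading (A.ne_zero_of_valuation_eq_one hu)
    obtain rfl := (h.valuation_eq_one_iff hd).1 hu
    obtain ⟨e, k, he⟩ := h.exists_isLeading hy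
    have h1 := hd.mul ht (he.pow ht 2)
    rw [← map_pow, ← map_mul] at h1
    rw [(hz.unique ht h1).1]
    exact ⟨k, by push_cast; ring⟩
  · rintro ⟨k, rfl⟩
    have hz0 : z ≠ 0 := by rintro rfl; simpa using hz.ne_zero ht
    obtain ⟨ϖ, e, hϖ⟩ := h.exists_uniformizer
    have hϖ0 : ϖ ≠ 0 := by rintro rfl; simpa using hϖ.ne_zero ht
    have key : ∃ y d, y ≠ 0 ∧ IsLeading t (φ y) (d : κ) k := by
      obtain ⟨n, rfl | rfl⟩ := k.eq_nat_or_neg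
      · exact ⟨ϖ ^ n, e ^ n, pow_ne_zero _ hϖ0, by simpa using hϖ.pow ht n⟩
      · exact ⟨(ϖ ^ n)⁻¹, (e ^ n)⁻¹, inv_ne_zero (pow_ne_zero _ hϖ0), by
          simpa using (hϖ.pow ht n).inv⟩
    obtain ⟨y, d, hy0, hy⟩ := key
    have h1 := hz.mul ht (hy.pow ht 2).inv
    rw [← map_pow, ← map_inv₀, ← map_mul] at h1
    refine ⟨z * (y ^ 2)⁻¹, y, (h.valuation_eq_one_iff h1).2 (by push_cast; ring), hy0, ?_⟩
    field_simp

theorem isSquare_of_mem_oneUnitSq {z : K} {c : κ} {n : ℤ} (hz : IsLeading t (φ z) c n)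
    (hzA : z ∈ A.oneUnitSq) : IsSquare c := by
  have ht := h.transcendental
  obtain ⟨m, y, hm, hy, rfl⟩ := hzA
  obtain ⟨e, k, he⟩ := h.exists_isLeading hy
  have h1 := (h.isLeading_one_of_sub hm).mul ht (he.pow ht 2)
  rw [← map_pow, ← map_mul] at h1
  exact ⟨e, by rw [(hz.unique ht h1).2]; ring⟩

theorem isNice [NumberField κ] : A.IsNice where
  arch := by
    intro c hc hc1 z
    rcases eq_or_ne z 0 with rfl | hz
    · exact ⟨0, by simp⟩
    obtain ⟨d, m, hd⟩ := h.exists_isLeading hc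
    obtain ⟨e, k, he⟩ := h.exists_isLeading hz
    have hm := (h.valuation_lt_one_iff hd).1 hc1
    refine ⟨k.natAbs, (A.valuation_le_one_iff _).2 ?_⟩
    have h1 := he.mul h.transcendental (hd.pow h.transcendental k.natAbs)
    rw [← map_pow, ← map_mul] at h1
    rw [h.mem_iff _ _ _ h1]
    have h2 : (k.natAbs : ℤ) ≤ m * k.natAbs := le_mul_of_one_le_left (by positivity) hm
    omega
  index := by
    intro x y hx hy hxA hyA
    obtain ⟨d, m, hd⟩ := h.exists_isLeading hx
    obtain ⟨e, k, he⟩ := h.exists_isLeading hy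
    have h1 := hd.mul h.transcendental he
    rw [← map_mul] at h1
    rw [h.mem_unitSq_iff h1]
    rw [h.mem_unitSq_iff hd, Int.not_even_iff_odd] at hxA
    rw [h.mem_unitSq_iff he, Int.not_even_iff_odd] at hyA
    exact hxA.add_odd hyA
  nontrivial := by
    obtain ⟨ϖ, e, hϖ⟩ := h.exists_uniformizer
    refine ⟨ϖ, ?_, ?_⟩
    · rintro rfl; simpa using hϖ.ne_zero h.transcendental
    · rw [h.mem_unitSq_iff hϖ]; simp
  nonrigid := by
    obtain ⟨g, h1, h2, h3, h4⟩ := NumberField.exists_intCast_not_isSquare κ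
    have hE : CharZero E := charZero_of_injective_algebraMap (algebraMap κ E).injective
    have hK : CharZero K := φ.charZero
    have key : ∀ m : ℤ, ¬ IsSquare (m : κ) → (m : K) ∉ A.oneUnitSq ∧ (m : K) ∈ A.unitSq := by
      intro m hm
      have hm0 : (m : κ) ≠ 0 := by intro h0; rw [h0] at hm; exact hm ⟨0, by simp⟩
      have hl : IsLeading t (φ (m : K)) (m : κ) 0 := by
        have := IsLeading.const (t := t) (E := E) hm0
        simpa using this
      exact ⟨fun hmem => hm (h.isSquare_of_mem_oneUnitSq hl hmem),
        (h.mem_unitSq_iff hl).2 (by simp)⟩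
    refine ⟨(g : K), (key g h1).2, (key g h1).1, ?_, ?_, ?_, ?_⟩
    · simpa using (key (-g) (by simpa using h2)).1
    · intro h0
      apply h3
      have h0' : 1 + g = 0 := by exact_mod_cast h0
      have : (1 + g : κ) = 0 := by exact_mod_cast h0'
      rw [this]; exact ⟨0, by simp⟩
    · simpa using (key (1 + g) (by simpa using h3)).1
    · simpa using (key (g * (1 + g)) (by simpa using h4)).1

theorem exists_residueField_ringHom : Nonempty (ResidueField A →+* κ) := by
  have ht := h.transcendental
  let Rel : A → κ → Prop := fun a c => ∃ F G : Polynomial κ, F.coeff 0 = c ∧ G.coeff 0 = 1 ∧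
    φ a = Polynomial.aeval t F / Polynomial.aeval t G
  have hlead : ∀ (a : A) (c : κ) (n : ℤ), IsLeading t (φ a) c n → Rel a (if n = 0 then c else 0) := by
    intro a c n hl
    obtain ⟨k, rfl⟩ := Int.eq_ofNat_of_zero_le ((h.mem_iff a c n hl).1 a.2)
    obtain ⟨hc, p, q, hp, hq, e⟩ := hl
    refine ⟨Polynomial.C c * Polynomial.X ^ k * p, q, ?_, hq, ?_⟩
    · rw [Polynomial.mul_coeff_zero, Polynomial.coeff_C_mul, Polynomial.coeff_X_pow, hp]
      rcases Nat.eq_zero_or_pos k with rfl | hk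
      · simp
      · simp [hk.ne, hk.ne']
    · rw [e]; simp [mul_div_assoc]
  have htot : ∀ a, ∃ c, Rel a c := by
    intro a
    rcases eq_or_ne (a : K) 0 with h0 | h0
    · exact ⟨0, 0, 1, by simp, by simp, by simp [h0]⟩
    · obtain ⟨c, n, hc⟩ := h.exists_isLeading h0
      exact ⟨_, hlead a c n hc⟩
  have huniq : ∀ a c d, Rel a c → Rel a d → c = d := by
    rintro a _ _ ⟨F, G, rfl, hG, e⟩ ⟨F', G', rfl, hG', e'⟩
    have h1 := IsLeading.aeval_ne_zero ht hG
    have h2 := IsLeading.aeval_ne_zero ht hG'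
    rw [e, div_eq_div_iff h1 h2, ← map_mul, ← map_mul] at e'
    have h3 := congrArg (fun P => Polynomial.coeff P 0) ((transcendental_iff_injective.1 ht) e')
    simpa [Polynomial.mul_coeff_zero, hG, hG'] using h3
  choose f hf using htot
  have hadd : ∀ a b, f (a + b) = f a + f b := by
    intro a b
    refine huniq (a + b) _ _ (hf _) ?_
    obtain ⟨F, G, h1, hG, e⟩ := hf a
    obtain ⟨F', G', h2, hG', e'⟩ := hf b
    refine ⟨F * G' + G * F', G * G', by simp [Polynomial.mul_coeff_zero, h1, h2, hG, hG'],
      by simp [Polynomial.mul_coeff_zero, hG, hG'], ?_⟩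
    have h3 := IsLeading.aeval_ne_zero ht hG
    have h4 := IsLeading.aeval_ne_zero ht hG'
    rw [show ((a + b : A) : K) = (a : K) + b from rfl, map_add, e, e']
    simp only [map_add, map_mul]
    rw [div_add_div _ _ h3 h4]
  have hmul : ∀ a b, f (a * b) = f a * f b := by
    intro a b
    refine huniq (a * b) _ _ (hf _) ?_
    obtain ⟨F, G, h1, hG, e⟩ := hf a
    obtain ⟨F', G', h2, hG', e'⟩ := hf b
    refine ⟨F * F', G * G', by simp [Polynomial.mul_coeff_zero, h1, h2],
      by simp [Polynomial.mul_coeff_zero, hG, hG'], ?_⟩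
    rw [show ((a * b : A) : K) = (a : K) * b from rfl, map_mul, e, e']
    simp only [map_mul]
    rw [div_mul_div_comm]
  have hone : f 1 = 1 := huniq 1 _ _ (hf 1) ⟨1, 1, by simp, by simp, by simp⟩
  have hzero : f 0 = 0 := huniq 0 _ _ (hf 0) ⟨0, 1, by simp, by simp, by simp⟩
  let j : A →+* κ := ⟨⟨⟨f, hone⟩, hmul⟩, hzero, hadd⟩
  have hj : IsLocalHom j := by
    refine ⟨fun a ha => ?_⟩
    have ha0 : f a ≠ 0 := ha.ne_zero
    have h0 : (a : K) ≠ 0 := by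
      intro h0
      have : a = 0 := Subtype.ext h0
      rw [this] at ha0; exact ha0 hzero
    obtain ⟨c, n, hc⟩ := h.exists_isLeading h0
    have h1 := huniq a _ _ (hf a) (hlead a c n hc)
    have hn : n = 0 := by
      by_contra hn; rw [if_neg hn] at h1; exact ha0 h1
    exact (A.valuation_eq_one_iff a).2 ((h.valuation_eq_one_iff hc).2 hn)
  exact ⟨ResidueField.lift j⟩

theorem numberField_residueField [NumberField κ] : NumberField (ResidueField A) := by
  obtain ⟨j⟩ := h.exists_residueField_ringHom
  have h0 : CharZero (ResidueField A) := j.charZero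
  exact { to_charZero := h0
          to_finiteDimensional :=
            Module.Finite.of_injective (j.toRatAlgHom : ResidueField A →ₐ[ℚ] κ).toLinearMap
              j.injective }

end LocalParam

end ValuationSubring

end

noncomputable section

namespace ValuationSubring

theorem mem_of_isAlgebraic {Ω : Type*} [Field Ω] (W : ValuationSubring Ω) {M : Type*} [Field M]
    [Algebra M Ω] (hM : ∀ m : M, algebraMap M Ω m ∈ W) {z : Ω} (hz : IsAlgebraic M z) : z ∈ W := by
  let f : M →+* W := (algebraMap M Ω).codRestrict W hM
  obtain ⟨p, hp, e⟩ := hz.isIntegral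
  have h1 : IsIntegral W z := ⟨p.map f, hp.map f, by rw [Polynomial.eval₂_map]; exact e⟩
  obtain ⟨y, rfl⟩ := IsIntegrallyClosed.isIntegral_iff.1 h1
  exact y.2

theorem valuation_eq_one_of_isAlgebraic {Ω : Type*} [Field Ω] (W : ValuationSubring Ω) {M : Type*}
    [Field M] [Algebra M Ω] (hM : ∀ m : M, algebraMap M Ω m ∈ W) {z : Ω} (hz : IsAlgebraic M z)
    (hz0 : z ≠ 0) : W.valuation z = 1 := by
  have h1 := (W.valuation_le_one_iff _).2 (W.mem_of_isAlgebraic hM hz)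
  have h2 := (W.valuation_le_one_iff _).2 (W.mem_of_isAlgebraic hM hz.inv)
  rw [map_inv₀] at h2
  exact le_antisymm h1 ((inv_le_one₀ (W.valuation_pos hz0)).1 h2)

theorem exists_comap_eq {K : Type*} [Field K] (A : ValuationSubring K) (Ω : Type*) [Field Ω]
    [Algebra K Ω] : ∃ W : ValuationSubring Ω, W.comap (algebraMap K Ω) = A := by
  obtain ⟨W, hW, hloc⟩ := (A.toLocalSubring.map (algebraMap K Ω)).exists_le_valuationSubring
  have hAW : ∀ z ∈ A, algebraMap K Ω z ∈ W := fun z hz => hW ⟨z, hz, rfl⟩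
  refine ⟨W, le_antisymm (fun z hz => ?_) hAW⟩
  by_contra hzA
  have hz0 : z ≠ 0 := by rintro rfl; exact hzA A.zero_mem
  have hzi := (A.mem_or_inv_mem z).resolve_left hzA
  let r : (A.toLocalSubring.map (algebraMap K Ω)).toSubring :=
    ⟨algebraMap K Ω z⁻¹, z⁻¹, hzi, rfl⟩
  have hu : IsUnit (Subring.inclusion hW r) := by
    refine IsUnit.of_mul_eq_one (⟨algebraMap K Ω z, hz⟩ : W.toSubring) (Subtype.ext ?_)
    change algebraMap K Ω z⁻¹ * algebraMap K Ω z = 1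
    rw [← map_mul, inv_mul_cancel₀ hz0, map_one]
  obtain ⟨⟨s, u, hus, rfl⟩, hs⟩ := (hloc.map_nonunit r hu).exists_right_inv
  have h1 : algebraMap K Ω z⁻¹ * algebraMap K Ω u = 1 := congrArg Subtype.val hs
  rw [← map_mul, ← map_one (algebraMap K Ω)] at h1
  have h2 := (algebraMap K Ω).injective h1
  have : z = u := by field_simp at h2; exact h2.symm
  exact hzA (this ▸ hus)

end ValuationSubring

namespace ConicModel

variable {k : Type*} [Field k] {a b : k} {K : Type*} [Field K] [Algebra k K] {x y : K}

theorem isAlgebraic_adjoin (h : ConicModel k a b x y) (hb : b ≠ 0) (z : K) :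
    IsAlgebraic (IntermediateField.adjoin k {x}) z := by
  let M := IntermediateField.adjoin k {x}
  have hx : x ∈ M := IntermediateField.subset_adjoin _ _ rfl
  have hb' : algebraMap k K b ≠ 0 := by simpa using hb
  have hy : IsAlgebraic M y := by
    have hy2 : y ^ 2 ∈ M := by
      have e : y ^ 2 = (1 - algebraMap k K a * x ^ 2) / algebraMap k K b := by
        have := h.eq
        field_simp
        linear_combination this
      rw [e]
      exact div_mem (sub_mem (one_mem _) (mul_mem (M.algebraMap_mem a) (pow_mem hx 2)))
        (M.algebraMap_mem b)
    exact (isAlgebraic_algebraMap (⟨y ^ 2, hy2⟩ : M)).of_pow (n := 2) (by norm_num)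
  have hle : IntermediateField.adjoin k {x, y} ≤
      (algebraicClosure M K).restrictScalars k := by
    rw [IntermediateField.adjoin_le_iff]
    rintro z (rfl | rfl)
    · exact mem_algebraicClosure_iff.2 (isAlgebraic_algebraMap (⟨z, hx⟩ : M))
    · exact mem_algebraicClosure_iff.2 hy
  rw [h.adjoin_eq] at hle
  exact mem_algebraicClosure_iff.1 (hle (IntermediateField.mem_top : z ∈ ⊤))

theorem exists_valuation_aeval_lt_one (h : ConicModel k a b x y) (hb : b ≠ 0)
    {A : ValuationSubring K} (hA : A ≠ ⊤) (hk : ∀ c : k, algebraMap k K c ∈ A) (hx : x ∈ A) :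
    ∃ P : Polynomial k, P ≠ 0 ∧ A.valuation (Polynomial.aeval x P) < 1 := by
  by_contra! hcon
  have hmem : ∀ P : Polynomial k, Polynomial.aeval x P ∈ A := by
    intro P
    rw [Polynomial.aeval_eq_sum_range]
    refine sum_mem fun i _ => ?_
    rw [Algebra.smul_def]
    exact mul_mem (hk _) (pow_mem hx _)
  apply hA
  rw [eq_top_iff]
  rintro z -
  refine A.mem_of_isAlgebraic (M := IntermediateField.adjoin k {x}) ?_ (h.isAlgebraic_adjoin hb z)
  rintro ⟨m, hm⟩
  obtain ⟨r, s, rfl⟩ := (IntermediateField.mem_adjoin_simple_iff k m).1 hm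
  change Polynomial.aeval x r / Polynomial.aeval x s ∈ A
  rw [div_eq_mul_inv]
  refine mul_mem (hmem r) ?_
  rcases eq_or_ne s 0 with rfl | hs
  · simp
  · rw [← A.valuation_le_one_iff, map_inv₀]
    exact inv_le_one_of_one_le₀ (hcon s hs)

theorem exists_algebraic_approx [CharZero K] (h : ConicModel k a b x y) (hb : b ≠ 0)
    {A : ValuationSubring K} (hA : A ≠ ⊤) (hk : ∀ c : k, algebraMap k K c ∈ A) (hx : x ∈ A) :
    ∃ W : ValuationSubring (AlgebraicClosure K), W.comap (algebraMap K _) = A ∧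
      ∃ x₀ y₀ : AlgebraicClosure K, IsAlgebraic k x₀ ∧ IsAlgebraic k y₀ ∧
        algebraMap k _ a * x₀ ^ 2 + algebraMap k _ b * y₀ ^ 2 = 1 ∧
        W.valuation (algebraMap K _ x - x₀) < 1 ∧ W.valuation (algebraMap K _ y - y₀) < 1 := by
  let Ω := AlgebraicClosure K
  obtain ⟨W, hW⟩ := A.exists_comap_eq Ω
  have hkW : ∀ c : k, algebraMap k Ω c ∈ W := by
    intro c
    rw [IsScalarTower.algebraMap_apply k K Ω]
    have := hk c
    rw [← hW] at this
    exact this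
  have hlt : ∀ z : K, A.valuation z < 1 → W.valuation (algebraMap K Ω z) < 1 := by
    intro z hz
    rcases eq_or_ne z 0 with rfl | hz0
    · simp
    rw [A.valuation_lt_one_iff_inv_notMem hz0, ← hW, ValuationSubring.mem_comap, map_inv₀] at hz
    exact (W.valuation_lt_one_iff_inv_notMem (by simpa using hz0)).2 hz
  have hb' : algebraMap k Ω b ≠ 0 := by simpa using hb
  have hbW : W.valuation (algebraMap k Ω b) = 1 :=
    W.valuation_eq_one_of_isAlgebraic hkW (isAlgebraic_algebraMap _) hb'
  have hxW : algebraMap K Ω x ∈ W := by rw [← hW] at hx; exact hx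
  obtain ⟨P, hP0, hP⟩ := h.exists_valuation_aeval_lt_one hb hA hk hx
  have hPW := hlt _ hP
  obtain ⟨x₀, hx₀alg, hx₀⟩ : ∃ x₀ : Ω, IsAlgebraic k x₀ ∧ W.valuation (algebraMap K Ω x - x₀) < 1 := by
    by_contra! hcon
    have hsplit := (IsAlgClosed.splits (P.map (algebraMap k Ω))).eq_prod_roots
    have h1 := congrArg (fun Q => W.valuation (Polynomial.eval (algebraMap K Ω x) Q)) hsplit
    simp only [Polynomial.eval_mul, Polynomial.eval_C, map_mul, Polynomial.eval_multiset_prod,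
      map_multiset_prod, Multiset.map_map] at h1
    rw [Multiset.prod_eq_one, mul_one, Polynomial.leadingCoeff_map,
      W.valuation_eq_one_of_isAlgebraic hkW (isAlgebraic_algebraMap _) (by simpa using hP0)] at h1
    · rw [Polynomial.eval_map_algebraMap, Polynomial.aeval_algebraMap_apply] at h1
      exact hPW.ne h1
    · intro v hv
      obtain ⟨α, hα, rfl⟩ := Multiset.mem_map.1 hv
      have hαa : IsAlgebraic k α := by
        refine ⟨P, hP0, ?_⟩
        have := Polynomial.isRoot_of_mem_roots hα
        rwa [Polynomial.IsRoot, Polynomial.eval_map_algebraMap] at this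
      simp only [Function.comp_apply, Polynomial.eval_sub, Polynomial.eval_X, Polynomial.eval_C]
      exact le_antisymm ((W.valuation_le_one_iff _).2
        (sub_mem hxW (W.mem_of_isAlgebraic hkW hαa))) (hcon α hαa)
  have hx₀W := W.mem_of_isAlgebraic hkW hx₀alg
  obtain ⟨w, hw⟩ := IsAlgClosed.exists_pow_nat_eq
    ((1 - algebraMap k Ω a * x₀ ^ 2) / algebraMap k Ω b) (n := 2) (by norm_num)
  have hwalg : IsAlgebraic k w := by
    refine IsAlgebraic.of_pow (n := 2) (by norm_num) ?_
    rw [hw, div_eq_mul_inv]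
    exact (isAlgebraic_one.sub ((isAlgebraic_algebraMap a).mul (hx₀alg.pow 2))).mul
      (isAlgebraic_algebraMap b).inv
  have hwe : algebraMap k Ω a * x₀ ^ 2 + algebraMap k Ω b * w ^ 2 = 1 := by
    rw [hw, mul_div_cancel₀ _ hb']; ring
  have hxy : algebraMap k Ω a * algebraMap K Ω x ^ 2 + algebraMap k Ω b * algebraMap K Ω y ^ 2 = 1 := by
    have := congrArg (algebraMap K Ω) h.eq
    simpa [← IsScalarTower.algebraMap_apply] using this
  have key : W.valuation ((algebraMap K Ω y - w) * (algebraMap K Ω y - -w)) < 1 := by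
    have e : algebraMap k Ω b * ((algebraMap K Ω y - w) * (algebraMap K Ω y - -w)) =
        -(algebraMap k Ω a * (algebraMap K Ω x + x₀)) * (algebraMap K Ω x - x₀) := by
      linear_combination hxy - hwe
    have h1 := congrArg W.valuation e
    rw [map_mul, hbW, one_mul] at h1
    rw [h1, map_mul]
    exact lt_of_le_of_lt (mul_le_of_le_one_left zero_le ((W.valuation_le_one_iff _).2
      (neg_mem (mul_mem (hkW a) (add_mem hxW hx₀W))))) hx₀
  rw [map_mul] at key
  refine ⟨W, hW, x₀, ?_⟩
  by_cases h1 : W.valuation (algebraMap K Ω y - w) < 1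
  · exact ⟨w, hx₀alg, hwalg, hwe, hx₀, h1⟩
  · refine ⟨-w, hx₀alg, hwalg.neg, by rw [neg_sq]; exact hwe, hx₀, ?_⟩
    by_contra h2
    exact absurd key (not_lt.2 (one_le_mul_of_one_le_of_one_le (not_lt.1 h1) (not_lt.1 h2)))

end ConicModel

end

noncomputable section

namespace ValuationSubring

theorem localParam_of_adjoin {κ Ω K : Type*} [Field κ] [Field Ω] [Field K] [Algebra κ Ω] {t : Ω}
    (ht : Transcendental κ t) (W : ValuationSubring Ω) (hW : ∀ c : κ, algebraMap κ Ω c ∈ W)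
    (htv : W.valuation t < 1) (φ : K →+* Ω) (hφ : ∀ z, φ z ∈ IntermediateField.adjoin κ {t})
    {A : ValuationSubring K} (hA : W.comap φ = A) {ϖ : K}
    (hϖ : W.valuation (φ ϖ) = W.valuation t) :
    A.LocalParam (κ := κ) (φ.codRestrict (IntermediateField.adjoin κ {t}) hφ)
      (IntermediateField.AdjoinSimple.gen κ t) := by
  let E := IntermediateField.adjoin κ {t}
  let τ : E := IntermediateField.AdjoinSimple.gen κ t
  have hτ : (algebraMap E Ω) τ = t := rfl
  have hmap : ∀ p : Polynomial κ, algebraMap E Ω (Polynomial.aeval τ p) = Polynomial.aeval t p :=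
    fun p => by rw [← Polynomial.aeval_algebraMap_apply, hτ]
  have hτt : Transcendental κ τ := by
    rw [← hτ] at ht
    exact (transcendental_algebraMap_iff (algebraMap E Ω).injective).1 ht
  have ht0 : t ≠ 0 := by rintro rfl; exact ht isAlgebraic_zero
  have hdiv : ∀ z : E, ∃ F G : Polynomial κ, z = Polynomial.aeval τ F / Polynomial.aeval τ G := by
    rintro ⟨z, hz⟩
    obtain ⟨r, s, rfl⟩ := (IntermediateField.mem_adjoin_simple_iff κ z).1 hz
    refine ⟨r, s, (algebraMap E Ω).injective ?_⟩
    rw [map_div₀, hmap, hmap]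
    rfl
  have hone : ∀ p : Polynomial κ, p.coeff 0 = 1 → W.valuation (Polynomial.aeval t p) = 1 := by
    intro p hp
    apply W.valuation_eq_one_of_sub
    have e : Polynomial.aeval t p - 1 = t * Polynomial.aeval t p.divX := by
      conv_lhs => rw [← p.divX_mul_X_add, hp]
      simp
      ring
    have htW : t ∈ W := (W.valuation_le_one_iff _).1 htv.le
    rw [e, map_mul, mul_comm]
    refine lt_of_le_of_lt (mul_le_of_le_one_left zero_le ((W.valuation_le_one_iff _).2 ?_)) htv
    rw [Polynomial.aeval_eq_sum_range]
    refine sum_mem fun i _ => ?_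
    rw [Algebra.smul_def]
    exact MulMemClass.mul_mem (hW _) (pow_mem htW _)
  have hcon : ∀ c : κ, c ≠ 0 → W.valuation (algebraMap κ Ω c) = 1 := fun c hc =>
    W.valuation_eq_one_of_isAlgebraic hW (isAlgebraic_algebraMap c) (by simpa using hc)
  have hval : ∀ (z : K) (c : κ) (n : ℤ), IsLeading τ (φ.codRestrict E hφ z) c n →
      W.valuation (φ z) = W.valuation t ^ n := by
    rintro z c n ⟨hc, p, q, hp, hq, e⟩
    have e' := congrArg (algebraMap E Ω) e
    rw [map_mul, map_mul, map_div₀, hmap, hmap, map_zpow₀, hτ,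
      ← IsScalarTower.algebraMap_apply κ E Ω] at e'
    change φ z = _ at e'
    rw [e', map_mul, map_mul, map_div₀, hone p hp, hone q hq, hcon c hc, map_zpow₀]
    simp
  have hpos := W.valuation_pos ht0
  have hanti := zpow_right_strictAnti₀ hpos htv
  refine ⟨hτt, hdiv, ?_, ?_⟩
  · intro z c n hz
    rw [← hA, ValuationSubring.mem_comap, ← W.valuation_le_one_iff, hval z c n hz,
      ← zpow_zero (W.valuation t), hanti.le_iff_ge]
  · have hϖ0 : φ ϖ ≠ 0 := by
      intro h0
      rw [h0, map_zero] at hϖ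
      exact hpos.ne hϖ
    obtain ⟨F, G, hFG⟩ := hdiv (φ.codRestrict E hφ ϖ)
    obtain ⟨c, n, hc⟩ := IsLeading.exists_of_div hτt hFG (by
      intro h0; exact hϖ0 (congrArg Subtype.val h0))
    have h1 := hval ϖ c n hc
    rw [hϖ, ← zpow_one (W.valuation t), zpow_one, ← zpow_one (W.valuation t)] at h1
    have h2 : (1 : ℤ) = n := hanti.injective (by simpa using h1)
    exact ⟨ϖ, c, h2 ▸ hc⟩

end ValuationSubring

namespace ConicModel

universe u

variable {k : Type*} [Field k] {a b : k} {K : Type u} [Field K] [Algebra k K] {x y : K}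

theorem exists_localParam_of_mem [NumberField k] [CharZero K] (h : ConicModel k a b x y)
    (ha : a ≠ 0) (hb : b ≠ 0) {A : ValuationSubring K} (hA : A ≠ ⊤)
    (hk : ∀ c : k, algebraMap k K c ∈ A) (hx : x ∈ A) (hy : A.valuation y = 1) :
    ∃ (κ E : Type u) (_ : Field κ) (_ : NumberField κ) (_ : Field E) (_ : Algebra κ E)
      (φ : K →+* E) (t : E), A.LocalParam (κ := κ) φ t := by
  let Ω := AlgebraicClosure K
  obtain ⟨W, hW, x₀, y₀, hx₀, hy₀, hxy₀, hvx, hvy⟩ := h.exists_algebraic_approx hb hA hk hx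
  have hkW : ∀ c : k, algebraMap k Ω c ∈ W := by
    intro c
    rw [IsScalarTower.algebraMap_apply k K Ω]
    have := hk c
    rw [← hW] at this
    exact this
  have hunit : ∀ z : Ω, IsAlgebraic k z → z ≠ 0 → W.valuation z = 1 := fun z hz hz0 =>
    W.valuation_eq_one_of_isAlgebraic hkW hz hz0
  set X : Ω := algebraMap K Ω x with hX
  set Y : Ω := algebraMap K Ω y with hY
  set α : Ω := algebraMap k Ω a with hα
  set β : Ω := algebraMap k Ω b with hβ
  have hα0 : α ≠ 0 := by simpa [hα] using ha
  have hβ0 : β ≠ 0 := by simpa [hβ] using hb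
  have hα1 := hunit α (isAlgebraic_algebraMap a) hα0
  have hβ1 := hunit β (isAlgebraic_algebraMap b) hβ0
  have hXY : α * X ^ 2 + β * Y ^ 2 = 1 := by
    have := congrArg (algebraMap K Ω) h.eq
    simpa [← IsScalarTower.algebraMap_apply] using this
  have hYv : W.valuation Y = 1 := by
    have hy0 := A.ne_zero_of_valuation_eq_one hy
    have h1 : y ∈ A := (A.valuation_le_one_iff _).1 hy.le
    have h2 : y⁻¹ ∈ A := (A.valuation_le_one_iff _).1 (by rw [map_inv₀, hy, inv_one])
    rw [← hW] at h1 h2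
    have h3 := (W.valuation_le_one_iff _).2 (ValuationSubring.mem_comap.1 h1)
    have h4 := (W.valuation_le_one_iff _).2 (ValuationSubring.mem_comap.1 h2)
    rw [map_inv₀, map_inv₀] at h4
    exact le_antisymm h3 ((inv_le_one₀ (W.valuation_pos (by simpa [hY] using hy0))).1 h4)
  have hy₀0 : y₀ ≠ 0 := by
    rintro rfl
    rw [sub_zero, hYv] at hvy
    exact lt_irrefl _ hvy
  have hy₀1 := hunit y₀ hy₀ hy₀0
  have hXtr : Transcendental k X :=
    (transcendental_algebraMap_iff (algebraMap K Ω).injective).2 h.transcendental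
  have hXx₀ : X - x₀ ≠ 0 := by
    intro h0
    exact hXtr (by rw [sub_eq_zero.1 h0]; exact hx₀)
  have h2 : (2 : Ω) ≠ 0 := by
    have : CharZero Ω := charZero_of_injective_algebraMap (algebraMap K Ω).injective
    exact two_ne_zero
  have h2v : W.valuation (2 : Ω) = 1 := hunit 2 (by
    rw [← map_ofNat (algebraMap k Ω) 2]
    exact isAlgebraic_algebraMap _) h2
  have hx₀W : x₀ ∈ W := W.mem_of_isAlgebraic hkW hx₀
  have hy₀W : y₀ ∈ W := W.mem_of_isAlgebraic hkW hy₀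
  set m := (Y - y₀) / (X - x₀) with hm
  have hme : m * (X - x₀) = Y - y₀ := div_mul_cancel₀ _ hXx₀
  set t := m + α * x₀ / (β * y₀) with ht
  have hte : β * y₀ * t = β * y₀ * m + α * x₀ := by
    rw [ht, mul_add, mul_div_cancel₀ _ (mul_ne_zero hβ0 hy₀0)]
  have id1 : (X - x₀) * (α + β * m ^ 2) = -2 * (β * y₀ * t) := by
    apply mul_left_cancel₀ hXx₀
    rw [hte]
    linear_combination hXY - hxy₀ + (β * m * (X - x₀) + β * (Y - y₀) + 2 * β * y₀) * hme
  have id2 : β * y₀ * (Y + y₀) * t = α * (x₀ * (Y - y₀) - y₀ * (X - x₀)) := by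
    apply mul_left_cancel₀ hXx₀
    linear_combination (X - x₀) * (Y + y₀) * hte + β * y₀ * (Y + y₀) * hme + y₀ * (hXY - hxy₀)
  have id3 : β * y₀ ^ 2 * (α + β * m ^ 2) = α + β * y₀ * t * (β * y₀ * t - 2 * (α * x₀)) := by
    linear_combination α * hxy₀ - (β * y₀ * t - 2 * (α * x₀) + β * y₀ * m + α * x₀) * hte
  have hYy : W.valuation (Y + y₀) = 1 := by
    have h1 : W.valuation (2 * y₀) = 1 := by rw [map_mul, h2v, hy₀1, one_mul]
    rw [show Y + y₀ = (Y - y₀) + 2 * y₀ by ring, Valuation.map_add_eq_of_lt_right _ (by rwa [h1]), h1]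
  have htv : W.valuation t < 1 := by
    have h1 := congrArg W.valuation id2
    rw [map_mul, map_mul, map_mul, map_mul, hβ1, hy₀1, hYy, hα1, one_mul, one_mul, one_mul,
      one_mul] at h1
    rw [h1]
    refine Valuation.map_sub_lt _ ?_ ?_
    · rw [map_mul]
      exact lt_of_le_of_lt (mul_le_of_le_one_left zero_le ((W.valuation_le_one_iff _).2 hx₀W)) hvy
    · rw [map_mul, hy₀1, one_mul]; exact hvx
  have hαβ : W.valuation (α + β * m ^ 2) = 1 := by
    have h1 := congrArg W.valuation id3
    rw [map_mul, map_mul, map_pow, hβ1, hy₀1, one_pow, one_mul, one_mul] at h1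
    have htW := (W.valuation_le_one_iff _).1 htv.le
    have hc : β * y₀ * t * (β * y₀ * t - 2 * (α * x₀)) =
      (β * y₀ * (β * y₀ * t - 2 * (α * x₀))) * t := by ring
    rw [h1, Valuation.map_add_eq_of_lt_left, hα1]
    rw [hα1, hc, map_mul]
    refine lt_of_le_of_lt (mul_le_of_le_one_left zero_le ((W.valuation_le_one_iff _).2 ?_)) htv
    have h2W : (2 : Ω) ∈ W := (W.valuation_le_one_iff _).1 h2v.le
    exact mul_mem (mul_mem (hkW b) hy₀W) (sub_mem (mul_mem (mul_mem (hkW b) hy₀W) htW)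
      (mul_mem h2W (mul_mem (hkW a) hx₀W)))
  have hαβ0 := W.ne_zero_of_valuation_eq_one hαβ
  have hXt : W.valuation (X - x₀) = W.valuation t := by
    have h1 := congrArg W.valuation id1
    rw [map_mul, map_mul, map_mul, map_mul, Valuation.map_neg, h2v, hαβ, hβ1, hy₀1, one_mul,
      one_mul, one_mul, mul_one] at h1
    exact h1
  have hXeq : X = x₀ + -2 * (β * y₀ * t) / (α + β * m ^ 2) := by
    rw [← id1, mul_div_cancel_right₀ _ hαβ0]; ring
  have hmeq : m = t - α * x₀ / (β * y₀) := by rw [ht]; ring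
  have hYeq : Y = y₀ + m * (X - x₀) := by rw [hme]; ring
  let κ := IntermediateField.adjoin k ({x₀, y₀} : Set Ω)
  have hx₀κ : x₀ ∈ κ := IntermediateField.subset_adjoin _ _ (by simp)
  have hy₀κ : y₀ ∈ κ := IntermediateField.subset_adjoin _ _ (by simp)
  have hfin : FiniteDimensional k κ := by
    have : Finite ({x₀, y₀} : Set Ω) := (Set.toFinite _)
    refine IntermediateField.finiteDimensional_adjoin fun z hz => ?_
    rcases hz with rfl | rfl
    · exact hx₀.isIntegral
    · exact hy₀.isIntegral
  have hκ0 : CharZero κ := charZero_of_injective_algebraMap (algebraMap k κ).injective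
  have hκ : NumberField κ :=
    { to_charZero := hκ0
      to_finiteDimensional := FiniteDimensional.trans ℚ k κ }
  have hκW : ∀ c : κ, algebraMap κ Ω c ∈ W := fun c =>
    W.mem_of_isAlgebraic hkW (by
      have := (Algebra.IsAlgebraic.isAlgebraic (R := k) c).algebraMap (A := Ω)
      exact this)
  have hsub : ∀ M : IntermediateField κ Ω, t ∈ M → X ∈ M ∧ Y ∈ M := by
    intro M htM
    have h1 : x₀ ∈ M := M.algebraMap_mem ⟨x₀, hx₀κ⟩
    have h2 : y₀ ∈ M := M.algebraMap_mem ⟨y₀, hy₀κ⟩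
    have hkM : ∀ c : k, algebraMap k Ω c ∈ M := fun c => by
      rw [IsScalarTower.algebraMap_apply k κ Ω]; exact M.algebraMap_mem _
    have h3 : m ∈ M := by
      rw [hmeq]
      exact sub_mem htM (div_mem (mul_mem (hkM a) h1) (mul_mem (hkM b) h2))
    have h4 : X ∈ M := by
      rw [hXeq]
      exact add_mem h1 (div_mem (mul_mem (neg_mem (ofNat_mem M 2)) (mul_mem (mul_mem (hkM b) h2)
        htM)) (add_mem (hkM a) (mul_mem (hkM b) (pow_mem h3 2))))
    exact ⟨h4, by rw [hYeq]; exact add_mem h2 (mul_mem h3 (sub_mem h4 h1))⟩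
  have httr : Transcendental κ t := by
    intro halg
    have h1 := (hsub (algebraicClosure κ Ω) (mem_algebraicClosure_iff.2 halg)).1
    exact hXtr ((mem_algebraicClosure_iff.1 h1).restrictScalars k)
  let φ : K →+* Ω := algebraMap K Ω
  have hφ : ∀ z, φ z ∈ IntermediateField.adjoin κ {t} := by
    intro z
    obtain ⟨h1, h2⟩ := hsub (IntermediateField.adjoin κ {t}) (IntermediateField.subset_adjoin _ _ rfl)
    have hle : IntermediateField.adjoin k {x, y} ≤
        ((IntermediateField.adjoin κ {t}).restrictScalars k).comap
          (IsScalarTower.toAlgHom k K Ω) := by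
      rw [IntermediateField.adjoin_le_iff]
      rintro z (rfl | rfl)
      · exact h1
      · exact h2
    rw [h.adjoin_eq] at hle
    exact hle (IntermediateField.mem_top : z ∈ ⊤)
  let P := minpoly k x₀
  have hPv : W.valuation (φ (Polynomial.aeval x P)) = W.valuation t := by
    let f : k →+* W := (algebraMap k Ω).codRestrict W hkW
    have hXW : X - x₀ ∈ W := (W.valuation_le_one_iff _).1 hvx.le
    obtain ⟨s, hs⟩ := Polynomial.binomExpansion (P.map f) ⟨x₀, hx₀W⟩ ⟨X - x₀, hXW⟩
    have hs' := congrArg (algebraMap W Ω) hs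
    have hev : ∀ (Q : Polynomial k) (w : W), algebraMap W Ω ((Q.map f).eval w) =
        Polynomial.aeval (w : Ω) Q := by
      intro Q w
      rw [Polynomial.eval_map, Polynomial.hom_eval₂]
      rfl
    rw [map_add, map_add, map_mul, map_mul, map_pow, Polynomial.derivative_map, hev, hev, hev] at hs'
    change Polynomial.aeval (x₀ + (X - x₀)) P = Polynomial.aeval x₀ P +
      Polynomial.aeval x₀ P.derivative * (X - x₀) + (s : Ω) * (X - x₀) ^ 2 at hs'
    rw [minpoly.aeval, zero_add, add_sub_cancel] at hs'
    have hder : Polynomial.aeval x₀ P.derivative ≠ 0 :=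
      (minpoly.irreducible hx₀.isIntegral).separable.aeval_derivative_ne_zero (minpoly.aeval k x₀)
    have hder1 : W.valuation (Polynomial.aeval x₀ P.derivative) = 1 := hunit _ (by
      have h1 : IsAlgebraic k (Polynomial.aeval (⟨x₀, hx₀κ⟩ : κ) P.derivative) :=
        Algebra.IsAlgebraic.isAlgebraic _
      have h2 := h1.algebraMap (A := Ω)
      rwa [← Polynomial.aeval_algebraMap_apply] at h2) hder
    change W.valuation (algebraMap K Ω (Polynomial.aeval x P)) = _
    rw [← Polynomial.aeval_algebraMap_apply, ← hX, hs', Valuation.map_add_eq_of_lt_left, map_mul,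
      hder1, one_mul, hXt]
    rw [map_mul, map_mul, hder1, one_mul, map_pow, pow_two, ← mul_assoc]
    refine mul_lt_of_lt_one_left (W.valuation_pos hXx₀) ?_
    exact lt_of_le_of_lt (mul_le_of_le_one_left zero_le ((W.valuation_le_one_iff _).2 s.2)) hvx
  exact ⟨κ, IntermediateField.adjoin κ {t}, inferInstance, hκ, inferInstance, inferInstance, _, _,
    W.localParam_of_adjoin httr hκW htv φ hφ hW hPv⟩

end ConicModel

end

noncomputable section

/-- A nontrivial valuation ring of `K` containing the image of `k`. -/
structure ValuationSubring.IsPlace (k : Type*) [Field k] {K : Type*} [Field K] [Algebra k K]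
    (A : ValuationSubring K) : Prop where
  ne_top : A ≠ ⊤
  algebraMap_mem : ∀ c : k, algebraMap k K c ∈ A

namespace ConicModel

universe u

variable {k : Type*} [Field k] {a b : k} {K : Type u} [Field K] [Algebra k K] {x y : K}

theorem swap (h : ConicModel k a b x y) (ha : a ≠ 0) : ConicModel k b a y x := by
  refine ⟨by rw [add_comm]; exact h.eq, fun hy => h.transcendental ?_, by
    rw [Set.pair_comm]; exact h.adjoin_eq⟩
  refine IsAlgebraic.of_pow (n := 2) (by norm_num) ?_
  have ha' : algebraMap k K a ≠ 0 := by simpa using ha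
  have e : x ^ 2 = (1 - algebraMap k K b * y ^ 2) * (algebraMap k K a)⁻¹ := by
    rw [eq_mul_inv_iff_mul_eq₀ ha']
    linear_combination h.eq
  rw [e]
  exact (isAlgebraic_one.sub ((isAlgebraic_algebraMap b).mul (hy.pow 2))).mul
    (isAlgebraic_algebraMap a).inv

theorem inv (h : ConicModel k a b x y) (ha : a ≠ 0) : ConicModel k a⁻¹ (-b / a) x⁻¹ (y / x) := by
  have hx0 : x ≠ 0 := by
    rintro rfl
    exact h.transcendental isAlgebraic_zero
  have ha' : algebraMap k K a ≠ 0 := by simpa using ha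
  refine ⟨?_, fun hx => h.transcendental (by simpa using hx.inv), ?_⟩
  · simp only [map_inv₀, map_div₀, map_neg]
    field_simp
    linear_combination -h.eq
  · rw [eq_top_iff, ← h.adjoin_eq, IntermediateField.adjoin_le_iff]
    have h1 : x⁻¹ ∈ IntermediateField.adjoin k {x⁻¹, y / x} :=
      IntermediateField.subset_adjoin _ _ (by simp)
    have h2 : y / x ∈ IntermediateField.adjoin k {x⁻¹, y / x} :=
      IntermediateField.subset_adjoin _ _ (by simp)
    have h3 : x ∈ IntermediateField.adjoin k {x⁻¹, y / x} := by simpa using inv_mem h1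
    rintro z (rfl | rfl)
    · exact h3
    · have := mul_mem h2 h3
      rwa [div_mul_cancel₀ _ hx0] at this

theorem exists_model_of_isPlace (h : ConicModel k a b x y) (ha : a ≠ 0) (hb : b ≠ 0)
    {A : ValuationSubring K} (hA : A.IsPlace k) :
    ∃ (a' b' : k) (x' y' : K), a' ≠ 0 ∧ b' ≠ 0 ∧ ConicModel k a' b' x' y' ∧ x' ∈ A ∧
      A.valuation y' = 1 := by
  wlog hx : x ∈ A generalizing a b x y
  · exact this (h.inv ha) (inv_ne_zero ha) (div_ne_zero (neg_ne_zero.2 hb) ha)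
      ((A.mem_or_inv_mem x).resolve_left hx)
  have hunit : ∀ c : k, c ≠ 0 → A.valuation (algebraMap k K c) = 1 := fun c hc =>
    A.valuation_eq_one_of_isAlgebraic hA.algebraMap_mem (isAlgebraic_algebraMap c) (by simpa using hc)
  have hxv := (A.valuation_le_one_iff x).2 hx
  have e : algebraMap k K b * y ^ 2 = 1 - algebraMap k K a * x ^ 2 := by
    linear_combination h.eq
  have hy : y ∈ A := by
    have h1 := congrArg A.valuation e
    rw [map_mul, hunit b hb, one_mul, map_pow] at h1
    have h2 : A.valuation y ^ 2 ≤ 1 := by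
      rw [h1, A.valuation_le_one_iff]
      exact sub_mem (one_mem _) (mul_mem (hA.algebraMap_mem a) (pow_mem hx 2))
    rw [← A.valuation_le_one_iff]
    exact (pow_le_one_iff (two_ne_zero)).1 h2
  rcases eq_or_lt_of_le ((A.valuation_le_one_iff y).2 hy) with h1 | h1
  · exact ⟨a, b, x, y, ha, hb, h, hx, h1⟩
  · refine ⟨b, a, y, x, hb, ha, h.swap ha, hy, ?_⟩
    have h2 := congrArg A.valuation (show algebraMap k K a * x ^ 2 = 1 + -(algebraMap k K b * y ^ 2) by
      linear_combination h.eq)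
    rw [map_mul, hunit a ha, one_mul, map_pow, A.valuation_one_add] at h2
    · exact A.valuation_eq_one_of_pow two_ne_zero (by rwa [map_pow])
    · rw [Valuation.map_neg, map_mul, hunit b hb, one_mul, map_pow]
      exact pow_lt_one₀ zero_le h1 two_ne_zero

theorem exists_localParam [NumberField k] [CharZero K] (h : ConicModel k a b x y)
    (ha : a ≠ 0) (hb : b ≠ 0) {A : ValuationSubring K} (hA : A.IsPlace k) :
    ∃ (κ E : Type u) (_ : Field κ) (_ : NumberField κ) (_ : Field E) (_ : Algebra κ E)
      (φ : K →+* E) (t : E), A.LocalParam (κ := κ) φ t := by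
  obtain ⟨a', b', x', y', ha', hb', h', hx', hy'⟩ := h.exists_model_of_isPlace ha hb hA
  exact h'.exists_localParam_of_mem ha' hb' hA.ne_top hA.algebraMap_mem hx' hy'

end ConicModel

end

noncomputable section

theorem NumberField.exists_dyadic_absoluteValue (κ : Type*) [Field κ] [NumberField κ] :
    ∃ v : AbsoluteValue κ ℝ, IsNonarchimedean v ∧ v 2 < 1 ∧ ∀ z, z ≠ 0 → ∃ n : ℤ, v z = 2 ^ n := by
  let R := NumberField.RingOfIntegers κ
  have h2 : ¬ IsUnit (2 : R) := by
    intro h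
    have h1 : IsIntegral ℤ ((2 : ℚ)⁻¹) := by
      obtain ⟨s, hs⟩ := h.exists_right_inv
      have h3 : (algebraMap R κ s) = algebraMap ℚ κ (2⁻¹) := by
        have := congrArg (algebraMap R κ) hs
        rw [map_mul, map_one, map_ofNat] at this
        rw [map_inv₀, map_ofNat]
        exact eq_inv_of_mul_eq_one_right this
      have h4 : IsIntegral ℤ (algebraMap ℚ κ (2⁻¹)) := h3 ▸ s.isIntegral_coe
      exact (isIntegral_algebraMap_iff (algebraMap ℚ κ).injective).1 h4
    obtain ⟨m, hm⟩ := IsIntegrallyClosed.isIntegral_iff.1 h1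
    have hm' : (m : ℚ) * 2 = 1 := by
      have : (m : ℚ) = 2⁻¹ := hm
      rw [this]; norm_num
    have : m * 2 = 1 := by exact_mod_cast hm'
    omega
  obtain ⟨P, hPmax, hP⟩ := Ideal.exists_le_maximal (Ideal.span {(2 : R)})
    (by rwa [Ne, Ideal.span_singleton_eq_top])
  have h2P : (2 : R) ∈ P := hP (Ideal.mem_span_singleton_self _)
  let p : IsDedekindDomain.HeightOneSpectrum R :=
    ⟨P, hPmax.isPrime, fun h0 => by
      rw [h0, Ideal.mem_bot] at h2P
      exact two_ne_zero h2P⟩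
  have hb : (1 : NNReal) < 2 := one_lt_two
  refine ⟨p.adicAbv hb, p.isNonarchimedean_adicAbv hb, ?_, fun z hz => ?_⟩
  · have := (p.adicAbv_coe_lt_one_iff (K := κ) hb (r := 2)).2 h2P
    rwa [map_ofNat] at this
  · have h0 : p.valuation κ z ≠ 0 := by simpa using hz
    refine ⟨(WithZero.unzero h0).toAdd, ?_⟩
    change ((WithZeroMulInt.toNNReal (ne_zero_of_lt hb) (p.valuation κ z) : NNReal) : ℝ) = _
    rw [WithZeroMulInt.toNNReal_neg_apply _ h0]
    push_cast
    rfl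

theorem AbsoluteValue.exists_gaussNorm {κ E : Type*} [Field κ] [Field E] [Algebra κ E] {t : E}
    (ht : Transcendental κ t)
    (hdiv : ∀ z : E, ∃ F G : Polynomial κ, z = Polynomial.aeval t F / Polynomial.aeval t G)
    (v : AbsoluteValue κ ℝ) (hv : IsNonarchimedean v) {c : ℝ} (hc : 0 < c) :
    ∃ N : AbsoluteValue E ℝ, IsNonarchimedean N ∧
      ∀ P : Polynomial κ, N (Polynomial.aeval t P) = P.gaussNorm v c := by
  let g : Polynomial κ → ℝ := Polynomial.gaussNorm v c
  have hmul : ∀ P Q, g (P * Q) = g P * g Q := Polynomial.gaussNorm_mul hv hc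
  have hnn : ∀ P, 0 ≤ g P := fun P => Polynomial.gaussNorm_nonneg v P hc.le
  have h0 : ∀ P, g P = 0 ↔ P = 0 := fun P =>
    Polynomial.gaussNorm_eq_zero_iff v _ (fun _ hx => (AbsoluteValue.eq_zero v).mp hx) hc
  have hadd : ∀ P Q, g (P + Q) ≤ max (g P) (g Q) := fun P Q =>
    Polynomial.isNonarchimedean_gaussNorm v hv hc.le P Q
  have hone : g 1 = 1 := by
    have := hmul 1 1
    rw [mul_one] at this
    have h1 := (h0 1).not.2 one_ne_zero
    field_simp at this
    exact this.symm
  have hne : ∀ {P : Polynomial κ}, P ≠ 0 → Polynomial.aeval t P ≠ 0 := fun hP h =>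
    hP ((transcendental_iff.1 ht) _ h)
  have hdiv' : ∀ z : E, ∃ F G : Polynomial κ, G ≠ 0 ∧
      z = Polynomial.aeval t F / Polynomial.aeval t G := by
    intro z
    obtain ⟨F, G, h⟩ := hdiv z
    rcases eq_or_ne G 0 with rfl | hG
    · exact ⟨0, 1, one_ne_zero, by simpa using h⟩
    · exact ⟨F, G, hG, h⟩
  choose F G hG hFG using hdiv'
  let n : E → ℝ := fun z => g (F z) / g (G z)
  have hn : ∀ (z : E) (P Q : Polynomial κ), Q ≠ 0 →
      z = Polynomial.aeval t P / Polynomial.aeval t Q → n z = g P / g Q := by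
    intro z P Q hQ hz
    have h1 := hz.symm.trans (hFG z)
    rw [div_eq_div_iff (hne hQ) (hne (hG z)), ← map_mul, ← map_mul] at h1
    have h2 := congrArg g ((transcendental_iff_injective.1 ht) h1)
    rw [hmul, hmul] at h2
    change g (F z) / g (G z) = _
    rw [div_eq_div_iff ((h0 _).not.2 (hG z)) ((h0 _).not.2 hQ), h2]
  have hnmul : ∀ y z, n (y * z) = n y * n z := by
    intro y z
    rw [hn (y * z) (F y * F z) (G y * G z) (mul_ne_zero (hG y) (hG z)), hmul, hmul]
    · exact mul_div_mul_comm _ _ _ _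
    · rw [map_mul, map_mul]
      conv_lhs => rw [hFG y, hFG z]
      exact div_mul_div_comm _ _ _ _
  have hnadd : ∀ y z, n (y + z) ≤ max (n y) (n z) := by
    intro y z
    have hy := lt_of_le_of_ne' (hnn _) ((h0 _).not.2 (hG y))
    have hz := lt_of_le_of_ne' (hnn _) ((h0 _).not.2 (hG z))
    rw [hn (y + z) (F y * G z + G y * F z) (G y * G z) (mul_ne_zero (hG y) (hG z)), hmul]
    · rw [div_le_iff₀ (mul_pos hy hz)]
      refine (hadd _ _).trans ?_
      rw [hmul, hmul]
      refine max_le ?_ ?_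
      · refine le_trans ?_ (mul_le_mul_of_nonneg_right (le_max_left _ _) (mul_pos hy hz).le)
        change _ ≤ g (F y) / g (G y) * _
        field_simp
        exact le_refl _
      · refine le_trans ?_ (mul_le_mul_of_nonneg_right (le_max_right _ _) (mul_pos hy hz).le)
        change _ ≤ g (F z) / g (G z) * _
        field_simp
        exact le_refl _
    · rw [map_add, map_mul, map_mul, map_mul]
      conv_lhs => rw [hFG y, hFG z]
      exact div_add_div _ _ (hne (hG y)) (hne (hG z))
  have hnn' : ∀ z, 0 ≤ n z := fun z => div_nonneg (hnn _) (hnn _)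
  refine ⟨⟨⟨n, hnmul⟩, hnn', fun z => ?_, fun y z => ?_⟩, hnadd, fun P => ?_⟩
  · change g (F z) / g (G z) = 0 ↔ z = 0
    rw [div_eq_zero_iff, or_iff_left ((h0 _).not.2 (hG z)), h0]
    constructor
    · intro h; rw [hFG z, h]; simp
    · intro h
      by_contra hF
      exact div_ne_zero (hne hF) (hne (hG z)) ((hFG z).symm.trans h)
  · exact (hnadd y z).trans (max_le_add_of_nonneg (hnn' y) (hnn' z))
  · change n _ = g P
    rw [hn _ P 1 one_ne_zero (by simp), hone, div_one]

/-- The valuation ring of a nonarchimedean absolute value. -/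
def AbsoluteValue.toValuationSubring {K : Type*} [Field K] (N : AbsoluteValue K ℝ)
    (hN : IsNonarchimedean N) : ValuationSubring K where
  carrier := {z | N z ≤ 1}
  mul_mem' {y z} hy hz := by
    change N (y * z) ≤ 1
    rw [map_mul]
    exact mul_le_one₀ hy (N.nonneg _) hz
  one_mem' := by change N 1 ≤ 1; simp
  add_mem' {y z} hy hz := (hN y z).trans (max_le hy hz)
  zero_mem' := by change N 0 ≤ 1; simp
  neg_mem' {z} hz := by change N (-z) ≤ 1; rwa [N.map_neg]
  mem_or_inv_mem' z := by
    change N z ≤ 1 ∨ N z⁻¹ ≤ 1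
    rw [map_inv₀]
    rcases le_total (N z) 1 with h | h
    · exact Or.inl h
    · exact Or.inr (inv_le_one_of_one_le₀ h)

namespace AbsoluteValue

variable {K : Type*} [Field K] (N : AbsoluteValue K ℝ) (hN : IsNonarchimedean N)

theorem mem_toValuationSubring {z : K} : z ∈ N.toValuationSubring hN ↔ N z ≤ 1 := Iff.rfl

theorem valuation_lt_one_iff {z : K} : (N.toValuationSubring hN).valuation z < 1 ↔ N z < 1 := by
  rcases eq_or_ne z 0 with rfl | hz
  · simp
  rw [(N.toValuationSubring hN).valuation_lt_one_iff_inv_notMem hz, mem_toValuationSubring,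
    map_inv₀, not_le, one_lt_inv₀ (N.pos hz)]

theorem valuation_eq_one_iff {z : K} : (N.toValuationSubring hN).valuation z = 1 ↔ N z = 1 := by
  rw [le_antisymm_iff, le_antisymm_iff, ← not_lt (a := (N.toValuationSubring hN).valuation z),
    ← not_lt (a := N z), valuation_lt_one_iff, ValuationSubring.valuation_le_one_iff,
    mem_toValuationSubring]

end AbsoluteValue

end

noncomputable section

theorem Polynomial.eventually_gaussNorm_sub_one_lt {κ : Type*} [Field κ] (v : AbsoluteValue κ ℝ)
    {p : Polynomial κ} (hp : p.coeff 0 = 1) :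
    ∀ᶠ n : ℕ in Filter.atTop, (p - 1).gaussNorm v ((2 : ℝ)⁻¹ ^ n) < 1 := by
  obtain ⟨n₀, hn₀⟩ := pow_unbounded_of_one_lt ((p - 1).gaussNorm v 1) (one_lt_two (α := ℝ))
  filter_upwards [Filter.eventually_ge_atTop n₀] with n hn
  have hc : (0 : ℝ) < 2⁻¹ ^ n := by positivity
  obtain ⟨i, hi⟩ := (p - 1).exists_eq_gaussNorm v ((2 : ℝ)⁻¹ ^ n)
  rw [hi]
  rcases Nat.eq_zero_or_pos i with rfl | hi0
  · simp [hp]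
  have h1 := (p - 1).le_gaussNorm v zero_le_one i
  rw [one_pow, mul_one] at h1
  have h2 : ((2 : ℝ)⁻¹ ^ n) ^ i ≤ 2⁻¹ ^ n :=
    pow_le_of_le_one hc.le (pow_le_one₀ (by norm_num) (by norm_num)) hi0.ne'
  have h3 : (2 : ℝ) ^ n₀ ≤ 2 ^ n := pow_le_pow_right₀ one_le_two hn
  calc v ((p - 1).coeff i) * ((2 : ℝ)⁻¹ ^ n) ^ i ≤ v ((p - 1).coeff i) * 2⁻¹ ^ n :=
        mul_le_mul_of_nonneg_left h2 (v.nonneg _)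
    _ < 2 ^ n * 2⁻¹ ^ n := mul_lt_mul_of_pos_right (by linarith) hc
    _ = 1 := by rw [← mul_pow]; norm_num

theorem AbsoluteValue.sub_one_lt_of_div {E : Type*} [Field E] {N : AbsoluteValue E ℝ}
    (hN : IsNonarchimedean N) {p q : E} (hp : N (p - 1) < 1) (hq : N (q - 1) < 1) :
    N (p / q - 1) < 1 := by
  let G := N.toValuationSubring hN
  have hq1 : N q = 1 := (N.valuation_eq_one_iff hN).1
    (G.valuation_eq_one_of_sub ((N.valuation_lt_one_iff hN).2 hq))
  have hq0 : q ≠ 0 := N.ne_zero_iff.1 (by rw [hq1]; exact one_ne_zero)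
  have e : p / q - 1 = ((p - 1) - (q - 1)) / q := by field_simp; ring
  rw [e, map_div₀, hq1, div_one]
  exact (N.valuation_lt_one_iff hN).1 (Valuation.map_sub_lt _ ((N.valuation_lt_one_iff hN).2 hp)
    ((N.valuation_lt_one_iff hN).2 hq))

namespace ValuationSubring.LocalParam

open IsLocalRing

variable {K κ E : Type*} [Field K] [Field κ] [Field E] [Algebra κ E]
  {A : ValuationSubring K} {φ : K →+* E} {t : E} (h : A.LocalParam (κ := κ) φ t)
include h

theorem exists_dyadic [NumberField κ] {x₁ x₂ z : K} (hx₁ : x₁ ∈ A.oneUnitSq)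
    (hx₂ : x₂ ∈ A.oneUnitSq) (hz0 : z ≠ 0) (hz : z ∉ A.unitSq) :
    ∃ η : ValuationSubring K, η.valuation 2 < 1 ∧ (∃ s : ResidueField η, IsAbsTranscendental s) ∧
      x₁ ∈ η.oneUnitSq ∧ x₂ ∈ η.oneUnitSq ∧ z ∉ η.unitSq := by
  have ht := h.transcendental
  obtain ⟨v, hv, hv2, hvpow⟩ := NumberField.exists_dyadic_absoluteValue κ
  obtain ⟨m₁, y₁, hm₁, hy₁, rfl⟩ := hx₁
  obtain ⟨m₂, y₂, hm₂, hy₂, rfl⟩ := hx₂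
  obtain ⟨-, p₁, q₁, hp₁, hq₁, e₁⟩ := h.isLeading_one_of_sub hm₁
  obtain ⟨-, p₂, q₂, hp₂, hq₂, e₂⟩ := h.isLeading_one_of_sub hm₂
  obtain ⟨c, j, hcj⟩ := h.exists_isLeading hz0
  rw [h.mem_unitSq_iff hcj, Int.not_even_iff_odd] at hz
  obtain ⟨hc0, p₃, q₃, hp₃, hq₃, e₃⟩ := hcj
  obtain ⟨ϖ, d, hd0, p₄, q₄, hp₄, hq₄, e₄⟩ := h.exists_uniformizer
  have key : ∀ {p : Polynomial κ}, p.coeff 0 = 1 → _ := fun hp =>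
    Polynomial.eventually_gaussNorm_sub_one_lt v hp
  obtain ⟨n₀, hn₀⟩ := Filter.eventually_atTop.1
    ((key hp₁).and ((key hq₁).and ((key hp₂).and ((key hq₂).and ((key hp₃).and ((key hq₃).and
      ((key hp₄).and (key hq₄))))))))
  obtain ⟨i, hi⟩ := hvpow c hc0
  obtain ⟨n, hn, hodd⟩ : ∃ n ≥ n₀, Odd (i - n * j) := by
    rcases Int.even_or_odd (i - n₀ * j) with he | ho
    · refine ⟨n₀ + 1, Nat.le_succ _, ?_⟩
      push_cast
      rw [show i - (n₀ + 1) * j = (i - n₀ * j) - j by ring]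
      exact he.sub_odd hz
    · exact ⟨n₀, le_refl _, ho⟩
  obtain ⟨hp₁', hq₁', hp₂', hq₂', hp₃', hq₃', hp₄', hq₄'⟩ := hn₀ n hn
  set C : ℝ := 2⁻¹ ^ n with hC
  have hC0 : 0 < C := by positivity
  obtain ⟨N, hN, hNg⟩ := v.exists_gaussNorm ht h.exists_div hv hC0
  have hNp : ∀ {p : Polynomial κ}, (p - 1).gaussNorm v C < 1 → N (Polynomial.aeval t p - 1) < 1 := by
    intro p hp
    rwa [← hNg, map_sub, map_one] at hp
  have hNpq : ∀ {p q : Polynomial κ}, (p - 1).gaussNorm v C < 1 → (q - 1).gaussNorm v C < 1 →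
      N (Polynomial.aeval t p / Polynomial.aeval t q - 1) < 1 := fun hp hq =>
    AbsoluteValue.sub_one_lt_of_div hN (hNp hp) (hNp hq)
  have hN1 : ∀ {w : E}, N (w - 1) < 1 → N w = 1 := fun hw => (N.valuation_eq_one_iff hN).1
    ((N.toValuationSubring hN).valuation_eq_one_of_sub ((N.valuation_lt_one_iff hN).2 hw))
  have hNc : ∀ a : κ, N (algebraMap κ E a) = v a := by
    intro a
    have := hNg (Polynomial.C a)
    rwa [Polynomial.aeval_C, Polynomial.gaussNorm_C] at this
  have hNt : N t = C := by
    have := hNg (Polynomial.monomial 1 1)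
    rw [Polynomial.gaussNorm_monomial] at this
    simpa using this
  have hCz : C = (2 : ℝ) ^ (-(n : ℤ)) := by rw [hC, zpow_neg, zpow_natCast, inv_pow]
  have hNpow : ∀ w : E, w ≠ 0 → ∃ m : ℤ, N w = 2 ^ m := by
    have hpoly : ∀ P : Polynomial κ, Polynomial.aeval t P ≠ 0 →
        ∃ m : ℤ, N (Polynomial.aeval t P) = 2 ^ m := by
      intro P hP
      obtain ⟨l, hl⟩ := P.exists_eq_gaussNorm v C
      rw [← hNg] at hl
      have h0 : P.coeff l ≠ 0 := by
        intro h0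
        rw [h0, map_zero, zero_mul] at hl
        exact hP (N.eq_zero.1 hl)
      obtain ⟨m, hm⟩ := hvpow _ h0
      refine ⟨m + -(n : ℤ) * l, ?_⟩
      rw [hl, hm, hCz, zpow_add₀ two_ne_zero, zpow_mul, zpow_natCast]
    intro w hw
    obtain ⟨F, G, rfl⟩ := h.exists_div w
    obtain ⟨m, hm⟩ := hpoly F (fun h0 => hw (by rw [h0, zero_div]))
    obtain ⟨m', hm'⟩ := hpoly G (fun h0 => hw (by rw [h0, div_zero]))
    exact ⟨m - m', by rw [map_div₀, hm, hm', zpow_sub₀ two_ne_zero]⟩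
  let N' : AbsoluteValue K ℝ := N.comp φ.injective
  have hN'φ : ∀ w, N' w = N (φ w) := fun w => rfl
  have hN' : IsNonarchimedean N' := fun a b => by
    rw [hN'φ, map_add]; exact hN _ _
  let η := N'.toValuationSubring hN'
  have hlt : ∀ {w : K}, η.valuation w < 1 ↔ N (φ w) < 1 := N'.valuation_lt_one_iff hN'
  have heq : ∀ {w : K}, η.valuation w = 1 ↔ N (φ w) = 1 := N'.valuation_eq_one_iff hN'
  have h2η : η.valuation 2 < 1 := by
    rw [hlt, map_ofNat, ← map_ofNat (algebraMap κ E), hNc]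
    exact hv2
  refine ⟨η, h2η, ?_, ⟨m₁, y₁, ?_, hy₁, rfl⟩, ⟨m₂, y₂, ?_, hy₂, rfl⟩, ?_⟩
  · obtain ⟨e, he⟩ := hvpow 2 two_ne_zero
    have he0 : e < 0 := by
      by_contra! h0
      rw [he] at hv2
      exact absurd (one_le_zpow₀ one_le_two h0) hv2.not_ge
    obtain ⟨e', rfl⟩ : ∃ e' : ℕ, e = -(e' : ℤ) := ⟨e.natAbs, by omega⟩
    have he'0 : 0 < e' := by omega
    have hϖ0 : φ ϖ ≠ 0 := by
      intro h0
      rw [e₄, zpow_one] at h0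
      have h1 := hN1 (hNpq hp₄' hq₄')
      have ht0 : t ≠ 0 := N.ne_zero_iff.1 (by rw [hNt]; exact hC0.ne')
      have hw0 := N.ne_zero_iff.1 (by rw [h1]; exact one_ne_zero)
      exact mul_ne_zero (mul_ne_zero ((map_ne_zero _).2 hd0) ht0) hw0 h0
    obtain ⟨g, hg⟩ := hNpow _ hϖ0
    let s : K := ϖ ^ e' * 2 ^ g
    have hs1 : N (φ s) = 1 := by
      have h2 : N (2 : E) = 2 ^ (-(e' : ℤ)) := by
        rw [← map_ofNat (algebraMap κ E), hNc]
        exact he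
      simp only [s, map_mul, map_pow, map_zpow₀, map_ofNat, hg, h2]
      rw [← zpow_natCast, ← zpow_mul, ← zpow_mul, ← zpow_add₀ two_ne_zero]
      rw [show g * (e' : ℤ) + -(e' : ℤ) * g = 0 by ring, zpow_zero]
    have hsη : s ∈ η := (η.valuation_le_one_iff _).1 (heq.2 hs1).le
    let d' : κ := d ^ e' * 2 ^ g
    let m : E := algebraMap κ E d' * t ^ e'
    obtain ⟨w, hw⟩ : ∃ w, w = Polynomial.aeval t p₄ / Polynomial.aeval t q₄ := ⟨_, rfl⟩
    have hw1 : N (w - 1) < 1 := hw ▸ hNpq hp₄' hq₄'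
    have hsm : φ s = m * w ^ e' := by
      simp only [s, m, d', map_mul, map_pow, map_zpow₀, map_ofNat, e₄, zpow_one, ← hw]
      ring
    have hNm : N m = 1 := by
      have := congrArg N hsm
      rwa [hs1, map_mul, map_pow, hN1 hw1, one_pow, mul_one, eq_comm] at this
    let G := N.toValuationSubring hN
    have hGle : ∀ {w : E}, N w = 1 → w ∈ G := fun hw =>
      (G.valuation_le_one_iff _).1 ((N.valuation_eq_one_iff hN).2 hw).le
    have hwres : residue G ⟨w, hGle (hN1 hw1)⟩ = 1 := by
      rw [G.residue_eq_one_iff]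
      exact (N.valuation_lt_one_iff hN).2 hw1
    have hres : residue G ⟨φ s, hGle hs1⟩ = residue G ⟨m, hGle hNm⟩ := by
      have : (⟨φ s, hGle hs1⟩ : G) = ⟨m, hGle hNm⟩ * ⟨w, hGle (hN1 hw1)⟩ ^ e' := Subtype.ext hsm
      rw [this, map_mul, map_pow, hwres, one_pow, mul_one]
    refine ⟨residue η ⟨s, hsη⟩, fun f hf i => ?_⟩
    rw [← map_aeval_int, η.residue_eq_zero_iff] at hf
    have hf1 : N (Polynomial.aeval (φ s) f) < 1 := by
      have h1 := hlt.1 hf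
      have h2 : ((Polynomial.aeval (⟨s, hsη⟩ : η) f : η) : K) = Polynomial.aeval s f :=
        map_aeval_int η.subtype _ f
      rwa [h2, map_aeval_int] at h1
    have hf2 : N (Polynomial.aeval m f) < 1 := by
      have h1 : residue G (Polynomial.aeval (⟨φ s, hGle hs1⟩ : G) f) = 0 := by
        rw [G.residue_eq_zero_iff]
        have h2 : ((Polynomial.aeval (⟨φ s, hGle hs1⟩ : G) f : G) : E) = Polynomial.aeval (φ s) f :=
          map_aeval_int G.subtype _ f
        rw [h2]
        exact (N.valuation_lt_one_iff hN).2 hf1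
      rw [map_aeval_int, hres, ← map_aeval_int, G.residue_eq_zero_iff] at h1
      have h2 : ((Polynomial.aeval (⟨m, hGle hNm⟩ : G) f : G) : E) = Polynomial.aeval m f :=
        map_aeval_int G.subtype _ f
      rw [h2] at h1
      exact (N.valuation_lt_one_iff hN).1 h1
    let Q : Polynomial κ :=
      Polynomial.expand κ e' ((f.map (Int.castRingHom κ)).comp (Polynomial.C d' * Polynomial.X))
    have hQ : Polynomial.aeval t Q = Polynomial.aeval m f := by
      simp only [Q, Polynomial.expand_aeval, Polynomial.aeval_comp]
      simp only [map_mul, Polynomial.aeval_C, Polynomial.aeval_X]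
      rw [Polynomial.aeval_def, Polynomial.eval₂_map, Polynomial.aeval_def]
      congr 1
      exact RingHom.ext_int _ _
    have hQi : Q.coeff (i * e') = f.coeff i * d' ^ i := by
      simp only [Q, Polynomial.coeff_expand_mul he'0, Polynomial.comp_C_mul_X_coeff,
        Polynomial.coeff_map, eq_intCast]
    have h1 := Q.le_gaussNorm v hC0.le (i * e')
    rw [← hNg, hQ, hQi, map_mul] at h1
    have h2 : v (d' ^ i) * C ^ (i * e') = 1 := by
      have : N (m ^ i) = 1 := by rw [map_pow, hNm, one_pow]
      rw [← this]
      simp only [m, mul_pow, map_mul, map_pow, hNc, hNt]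
      rw [← pow_mul C e' i, mul_comm i e']
    rw [mul_assoc, h2, mul_one] at h1
    have h3 : ((f.coeff i : ℤ) : ResidueField η) = residue η ((f.coeff i : ℤ) : η) := by
      rw [map_intCast]
    rw [h3, η.residue_eq_zero_iff]
    have h4 : (((f.coeff i : ℤ) : η) : K) = ((f.coeff i : ℤ) : K) := by simp
    rw [h4, hlt, map_intCast, ← map_intCast (algebraMap κ E), hNc]
    exact h1.trans_lt hf2
  · rw [hlt, map_sub, map_one, e₁]
    simpa using hNpq hp₁' hq₁'
  · rw [hlt, map_sub, map_one, e₂]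
    simpa using hNpq hp₂' hq₂'
  · rintro ⟨u, y, hu, hy, rfl⟩
    rw [heq] at hu
    obtain ⟨m, hm⟩ := hNpow (φ y) (by simpa using hy)
    have h1 := congrArg N e₃
    rw [map_mul, map_mul, map_mul, map_mul, map_zpow₀, map_pow, map_pow, hu, hm, hNc, hNt, hi,
      hN1 (hNpq hp₃' hq₃'), hCz, one_mul, mul_one, ← zpow_mul, ← zpow_add₀ two_ne_zero,
      ← zpow_natCast, ← zpow_mul] at h1
    have h2 := zpow_right_injective₀ (two_pos (α := ℝ)) (by norm_num) h1
    push_cast at h2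
    rw [show i - n * j = i + -n * j by ring, ← h2] at hodd
    exact (Int.not_odd_iff_even.2 ⟨m, by ring⟩) hodd

end ValuationSubring.LocalParam

end

noncomputable section

namespace ValuationSubring

open IsLocalRing

theorem NonrigidElt.exists_isAbsTranscendental {F : Type*} [Field F] (B : ValuationSubring F)
    {H : Set F} {g : F} (hg : NonrigidElt B.oneUnitSq H g) {p : ℕ} (hp : p.Prime)
    (hB : B.valuation (p : F) < 1) : ∃ s : ResidueField B, IsAbsTranscendental s := by
  by_contra! hE
  exact B.not_nonrigidElt hg fun x y hx hy =>
    isSquare_mul_of_not_isAbsTranscendental hp (B.natCast_residue_eq_zero hB) hE hx hy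

variable {l L : Type*} [Field l] [NumberField l] [Field L] [CharZero L] [Algebra l L]
  {B : ValuationSubring L}

theorem isPlace_or_exists_prime (l : Type*) [Field l] [NumberField l] [Algebra l L]
    (hB : B ≠ ⊤) :
    B.IsPlace l ∨ ∃ p : ℕ, p.Prime ∧ B.valuation (p : L) < 1 := by
  by_cases h : ∃ p : ℕ, p.Prime ∧ B.valuation (p : L) < 1
  · exact Or.inr h
  push Not at h
  have hle : ∀ n : ℕ, B.valuation (n : L) ≤ 1 := fun n =>
    (B.valuation_le_one_iff _).2 (natCast_mem B n)
  have h1 : ∀ n : ℕ, n ≠ 0 → B.valuation (n : L) = 1 := by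
    intro n
    induction n using Nat.recOnMul with
    | zero => simp
    | one => simp
    | prime p hp => exact fun _ => le_antisymm (hle p) (h p hp)
    | mul a b ha hb =>
      intro hab
      rw [Nat.cast_mul, map_mul, ha (left_ne_zero_of_mul hab), hb (right_ne_zero_of_mul hab), one_mul]
  have hQ : ∀ q : ℚ, algebraMap ℚ L q ∈ B := by
    intro q
    rw [eq_ratCast, Rat.cast_def, div_eq_mul_inv]
    refine MulMemClass.mul_mem (intCast_mem B _) ?_
    rw [← B.valuation_le_one_iff, map_inv₀, h1 _ q.den_nz, inv_one]
  exact Or.inl ⟨hB, fun c => B.mem_of_isAlgebraic hQ ((Algebra.IsAlgebraic.isAlgebraic (R := ℚ) c).algHom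
    (RingHom.toRatAlgHom (algebraMap l L)))⟩

theorem mem_oneUnitSq_of_two_lt_one {L : Type*} [Field L] [CharZero L] {B : ValuationSubring L}
    {p : ℕ} (hp : p.Prime) (hp2 : p ≠ 2) (hB : B.valuation 2 < 1) {z : L} (hz : z ≠ 0) {n : ℕ}
    (h₁ : 1 + (p : L) ^ (2 * n) * z / 4 ∈ B.oneUnitSq)
    (h₂ : 1 + (p : L) ^ (2 * n) / z ∈ B.oneUnitSq) : z ∈ B.oneUnitSq := by
  have hp0 : (p : L) ≠ 0 := Nat.cast_ne_zero.2 hp.ne_zero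
  have hpv : B.valuation (p : L) = 1 := by
    obtain ⟨m, rfl⟩ := hp.odd_of_ne_two hp2
    refine B.valuation_eq_one_of_sub ?_
    push_cast
    rw [add_sub_cancel_right, map_mul]
    exact lt_of_le_of_lt (mul_le_of_le_one_right zero_le
      ((B.valuation_le_one_iff _).2 (natCast_mem B m))) hB
  have hpow : B.valuation ((p : L) ^ (2 * n)) = 1 := by rw [map_pow, hpv, one_pow]
  have hpow0 : (p : L) ^ (2 * n) ≠ 0 := pow_ne_zero _ hp0
  have hT := B.isSqGroup_oneUnitSq
  have h4 : B.valuation 4 < 1 := by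
    rw [show (4 : L) = 2 * 2 by norm_num, map_mul]
    exact lt_of_le_of_lt (mul_le_of_le_one_left zero_le hB.le) hB
  by_cases hzB : z⁻¹ ∈ B
  · have hm : 1 + 4 * z⁻¹ / (p : L) ^ (2 * n) ∈ B.oneUnitSq := by
      refine B.one_add_mem_oneUnitSq ?_
      rw [map_div₀, map_mul, hpow, div_one]
      exact lt_of_le_of_lt (mul_le_of_le_one_right zero_le ((B.valuation_le_one_iff _).2 hzB)) h4
    refine hT.of_mul_right hm (hT.mem_of_eq h₁ (z := 2 / (p : L) ^ n)
      (div_ne_zero two_ne_zero (pow_ne_zero _ hp0)) ?_)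
    rw [pow_mul'] at *
    field_simp
    ring
  · have hzB' : B.valuation z < 1 := (B.valuation_lt_one_iff_inv_notMem hz).2 hzB
    have hm : 1 + z / (p : L) ^ (2 * n) ∈ B.oneUnitSq := by
      refine B.one_add_mem_oneUnitSq ?_
      rwa [map_div₀, hpow, div_one]
    refine hT.of_mul_right hm (hT.mem_of_eq h₂ (z := z / (p : L) ^ n)
      (div_ne_zero hz (pow_ne_zero _ hp0)) ?_)
    rw [pow_mul'] at *
    field_simp
    ring

end ValuationSubring

open IsLocalRing ValuationSubring

variable {l L : Type*} [Field l] [NumberField l] [Field L] [CharZero L] [Algebra l L]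
  {a b : l} {x y : L}

theorem ConicModel.hasNonuniversalForm_residueField (h : ConicModel l a b x y) (ha : a ≠ 0)
    (hb : b ≠ 0) {B : ValuationSubring L} (hB : B.IsPlace l) :
    HasNonuniversalForm (ResidueField B) := by
  obtain ⟨κ, E, _, _, _, _, φ, t, hA⟩ := h.exists_localParam ha hb hB
  have := hA.numberField_residueField
  exact NumberField.hasNonuniversalForm _

theorem ConicModel.isNice (h : ConicModel l a b x y) (ha : a ≠ 0)
    (hb : b ≠ 0) {B : ValuationSubring L} (hB : B.IsPlace l) : B.IsNice := by
  obtain ⟨κ, E, _, _, _, _, φ, t, hA⟩ := h.exists_localParam ha hb hB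
  exact hA.isNice

theorem ConicModel.valuation_two_lt_one (h : ConicModel l a b x y) (ha : a ≠ 0)
    (hb : b ≠ 0) {B : ValuationSubring L} (hB : B ≠ ⊤) {H : Set L} {g : L}
    (hg : NonrigidElt B.oneUnitSq H g) (hH : B.unitSq ⊆ H) (hu : IsUniversalPair B.oneUnitSq H) :
    B.valuation 2 < 1 := by
  have hF := h.isAbsFunctionField hb
  rcases isPlace_or_exists_prime l hB with hp | ⟨p, hp, hpB⟩
  · exact absurd hu (B.not_isUniversalPair (h.hasNonuniversalForm_residueField ha hb hp) hH)
  · obtain ⟨s, hs⟩ := NonrigidElt.exists_isAbsTranscendental B hg hp hpB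
    by_cases hp2 : p = 2
    · subst hp2
      exact_mod_cast hpB
    · exact absurd hu
        (B.not_isUniversalPair (B.hasNonuniversalForm_residueField hF hp hp2 hpB hs) hH)

namespace IsWittRel

variable {k K : Type*} [Field k] [NumberField k] [Field K] [CharZero K] [Algebra k K]
  {c d : k} {x' y' : K} {R : K → L → Prop} (hR : IsWittRel R)
include hR

theorem exists_isPlace (hK : ConicModel k c d x' y') (hc : c ≠ 0) (hd : d ≠ 0)
    (hL : ConicModel l a b x y) (ha : a ≠ 0) (hb : b ≠ 0) {A : ValuationSubring K}
    (hA : A.IsPlace k) :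
    ∃ B : ValuationSubring L, B.IsPlace l ∧ B.oneUnitSq = relImage R A.oneUnitSq ∧
      B.unitSq = relImage R A.unitSq := by
  have hFL := hL.isAbsFunctionField hb
  have hFK := hK.isAbsFunctionField hd
  have hAn := hK.isNice hc hd hA
  obtain ⟨B, hBt, hB1, hBu⟩ := hR.exists_transfer hAn
  have hAT := A.isSqGroup_oneUnitSq
  have hAH := A.isSqGroup_unitSq
  have hHsq := hR.isSqGroup_relImage hAH
  obtain ⟨z, hz0, hz⟩ := hAn.nontrivial
  obtain ⟨w, hzw⟩ := hR.total_left hz0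
  have hw0 := hR.ne_right hzw
  have hwH : w ∉ relImage R A.unitSq := fun h => hz ((hR.mem_relImage hAH hzw).1 h)
  obtain ⟨g, hg⟩ := hAn.nonrigid
  obtain ⟨g', hg'⟩ := hR.nonrigidElt hAT hAH hg
  rw [← hB1] at hg'
  rcases isPlace_or_exists_prime l hBt with hp | ⟨p, hp, hpB⟩
  · refine ⟨B, hp, hB1, unitSq_eq_of_subset hHsq hBu ⟨w, hw0, hwH⟩ ?_⟩
    exact (hL.isNice ha hb hp).index
  exfalso
  obtain ⟨s, hs⟩ := NonrigidElt.exists_isAbsTranscendental B hg' hp hpB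
  have hBu' : B.unitSq = relImage R A.unitSq :=
    unitSq_eq_of_subset hHsq hBu ⟨w, hw0, hwH⟩ (B.index_of_prime hFL hp hpB hs)
  by_cases hp2 : p = 2
  · subst hp2
    have h2 := hR.flip.isUniversalPair B.isSqGroup_oneUnitSq
      (B.isUniversalPair_of_two hFL (by exact_mod_cast hpB) hs)
    rw [hB1, hBu', hR.relImage_flip hAT, hR.relImage_flip hAH] at h2
    exact A.not_isUniversalPair (hK.hasNonuniversalForm_residueField hc hd hA) subset_rfl h2
  obtain ⟨E₀, _, hunif⟩ := B.exists_isUniformized hFL hp hpB hs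
  have hp0 : (p : L) ≠ 0 := Nat.cast_ne_zero.2 hp.ne_zero
  obtain ⟨n₁, hn₁⟩ := hunif.arch hp0 hpB (w / 4)
  obtain ⟨n₂, hn₂⟩ := hunif.arch hp0 hpB w⁻¹
  obtain ⟨n, hn⟩ : ∃ n, n = n₁ + n₂ + 1 := ⟨_, rfl⟩
  have hbig : ∀ {v : L} {m : ℕ}, B.valuation (v * p ^ m) ≤ 1 → m < n →
      1 + v * (p : L) ^ (2 * n) ∈ B.oneUnitSq := by
    intro v m hv hm
    refine B.one_add_mem_oneUnitSq ?_
    obtain ⟨r, hr⟩ : ∃ r, 2 * n = m + (r + 1) := ⟨2 * n - m - 1, by omega⟩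
    rw [hr, pow_add, ← mul_assoc, map_mul]
    refine lt_of_le_of_lt (mul_le_of_le_one_left zero_le hv) ?_
    rw [map_pow]
    exact pow_lt_one₀ zero_le hpB (by omega)
  have hX₁ := hbig hn₁ (by omega)
  have hX₂ := hbig hn₂ (by omega)
  rw [hB1] at hX₁ hX₂
  obtain ⟨x₁, hx₁, hr₁⟩ := hX₁
  obtain ⟨x₂, hx₂, hr₂⟩ := hX₂
  obtain ⟨κ, E, _, _, _, _, φ, t, hAl⟩ := hK.exists_localParam hc hd hA
  obtain ⟨η, hη2, ⟨s', hs'⟩, hη₁, hη₂, hηz⟩ := hAl.exists_dyadic hx₁ hx₂ hz0 hz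
  have hηn := η.isNice_of_two hFK hη2 hs'
  have hηT := η.isSqGroup_oneUnitSq
  obtain ⟨B', hBt', hB1', hBu''⟩ := hR.exists_transfer hηn
  obtain ⟨e, he⟩ := hηn.nonrigid
  obtain ⟨e', he'⟩ := hR.nonrigidElt hηT η.isSqGroup_unitSq he
  have hu := hR.isUniversalPair hηT (η.isUniversalPair_of_two hFK hη2 hs')
  rw [← hB1'] at he' hu
  have hB'2 := hL.valuation_two_lt_one ha hb hBt' he' hBu'' hu
  have hwB : w ∈ B'.oneUnitSq := by
    refine mem_oneUnitSq_of_two_lt_one hp hp2 hB'2 hw0 (n := n) ?_ ?_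
    · rw [mul_div_assoc, mul_comm, hB1']
      exact ⟨x₁, hη₁, hr₁⟩
    · rw [div_eq_mul_inv, mul_comm, hB1']
      exact ⟨x₂, hη₂, hr₂⟩
  rw [hB1'] at hwB
  exact hηz (η.oneUnitSq_subset ((hR.mem_relImage hηT hzw).1 hwB))

end IsWittRel

end

noncomputable section

namespace ConicModel

variable {k : Type*} [Field k] {a b : k} {K : Type*} [Field K] [Algebra k K] {x y : K}

theorem exists_adjoin_eq_top [CharZero K] (h : ConicModel k a b x y) (ha : a ≠ 0) {x₀ y₀ : k}
    (h₀ : a * x₀ ^ 2 + b * y₀ ^ 2 = 1) :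
    ∃ τ : K, Transcendental k τ ∧ IntermediateField.adjoin k {τ} = ⊤ := by
  have hx0 : x - algebraMap k K x₀ ≠ 0 := by
    intro h1
    rw [sub_eq_zero] at h1
    exact h.transcendental (h1 ▸ isAlgebraic_algebraMap x₀)
  have e₀ := congrArg (algebraMap k K) h₀
  simp only [map_add, map_mul, map_pow, map_one] at e₀
  have ha' : algebraMap k K a ≠ 0 := (map_ne_zero _).2 ha
  have e := h.eq
  have htr := h.transcendental
  have hadj := h.adjoin_eq
  obtain ⟨τ, hτ⟩ : ∃ τ, τ = (y - algebraMap k K y₀) / (x - algebraMap k K x₀) := ⟨_, rfl⟩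
  obtain ⟨r, hr⟩ : ∃ r, r = x - algebraMap k K x₀ := ⟨_, rfl⟩
  rw [← hr] at hx0 hτ
  have hx : x = algebraMap k K x₀ + r := by rw [hr]; ring
  have hy : y = algebraMap k K y₀ + τ * r := by rw [hτ]; field_simp; ring
  have key : r * (algebraMap k K a + algebraMap k K b * τ ^ 2) =
      -2 * (algebraMap k K a * algebraMap k K x₀ + algebraMap k K b * algebraMap k K y₀ * τ) := by
    apply mul_left_cancel₀ hx0
    rw [hx, hy] at e
    linear_combination e - e₀
  have hne : algebraMap k K a + algebraMap k K b * τ ^ 2 ≠ 0 := by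
    intro h1
    rw [h1, mul_zero] at key
    have h2 : algebraMap k K a * algebraMap k K x₀ + algebraMap k K b * algebraMap k K y₀ * τ = 0 := by
      simpa using mul_eq_zero.1 key.symm
    apply ha'
    linear_combination (-algebraMap k K a) * e₀ +
      (algebraMap k K b * (algebraMap k K y₀) ^ 2) * h1 +
      (algebraMap k K a * algebraMap k K x₀ - algebraMap k K b * algebraMap k K y₀ * τ) * h2
  have hr' : r = -2 * (algebraMap k K a * algebraMap k K x₀ +
      algebraMap k K b * algebraMap k K y₀ * τ) / (algebraMap k K a + algebraMap k K b * τ ^ 2) := by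
    rw [eq_div_iff hne, key]
  have hmem : ∀ M : IntermediateField k K, τ ∈ M → x ∈ M ∧ y ∈ M := by
    intro M hM
    have h2 : (2 : K) ∈ M := ofNat_mem M 2
    have hrM : r ∈ M := by
      rw [hr']
      refine div_mem (mul_mem (neg_mem h2) (add_mem (mul_mem ?_ ?_) (mul_mem (mul_mem ?_ ?_) hM)))
        (add_mem ?_ (mul_mem ?_ (pow_mem hM 2))) <;> exact M.algebraMap_mem _
    rw [hx, hy]
    exact ⟨add_mem (M.algebraMap_mem _) hrM, add_mem (M.algebraMap_mem _) (mul_mem hM hrM)⟩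
  refine ⟨τ, fun hτa => htr ?_, ?_⟩
  · exact mem_algebraicClosure_iff.1 (hmem (algebraicClosure k K) (mem_algebraicClosure_iff.2 hτa)).1
  · rw [eq_top_iff, ← hadj, IntermediateField.adjoin_le_iff]
    have := hmem _ (IntermediateField.mem_adjoin_simple_self k τ)
    rintro z (rfl | rfl)
    exacts [this.1, this.2]

theorem nonempty_algEquiv_ratFunc [CharZero K] (h : ConicModel k a b x y) (ha : a ≠ 0) {x₀ y₀ : k}
    (h₀ : a * x₀ ^ 2 + b * y₀ ^ 2 = 1) : Nonempty (K ≃ₐ[k] RatFunc k) := by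
  obtain ⟨τ, hτ, hadj⟩ := h.exists_adjoin_eq_top ha h₀
  exact ⟨((RatFunc.algEquivOfTranscendental τ hτ).trans
    ((IntermediateField.equivOfEq hadj).trans IntermediateField.topEquiv)).symm⟩

end ConicModel

end

noncomputable section

namespace ValuationSubring

theorem valuation_eq_one_iff_mem {F : Type*} [Field F] (A : ValuationSubring F) {u : F}
    (hu : u ≠ 0) : A.valuation u = 1 ↔ u ∈ A ∧ u⁻¹ ∈ A := by
  have h1 : u⁻¹ ∈ A ↔ 1 ≤ A.valuation u := by
    rw [← not_lt, A.valuation_lt_one_iff_inv_notMem hu, not_not]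
  rw [h1, ← A.valuation_le_one_iff]
  exact le_antisymm_iff

theorem valuation_eq_one_of_comap {F Ω : Type*} [Field F] [Field Ω] {W : ValuationSubring Ω}
    {φ : F →+* Ω} {u : F} (hu : (W.comap φ).valuation u = 1) : W.valuation (φ u) = 1 := by
  have hu0 := (W.comap φ).ne_zero_of_valuation_eq_one hu
  rw [valuation_eq_one_iff_mem _ hu0] at hu
  rw [valuation_eq_one_iff_mem _ ((map_ne_zero φ).2 hu0), ← map_inv₀]
  exact hu

theorem map_mem_unitSq {F Ω : Type*} [Field F] [Field Ω] {W : ValuationSubring Ω}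
    {φ : F →+* Ω} {f : F} (hf : f ∈ (W.comap φ).unitSq) : φ f ∈ W.unitSq := by
  obtain ⟨u, y, hu, hy, rfl⟩ := hf
  exact ⟨φ u, φ y, valuation_eq_one_of_comap hu, (map_ne_zero φ).2 hy, by rw [map_mul, map_pow]⟩

theorem valuation_algebraMap_eq_one {k F : Type*} [Field k] [Field F] [Algebra k F]
    {A : ValuationSubring F} (hA : A.IsPlace k) {c : k} (hc : c ≠ 0) :
    A.valuation (algebraMap k F c) = 1 := by
  rw [valuation_eq_one_iff_mem _ ((map_ne_zero _).2 hc), ← map_inv₀]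
  exact ⟨hA.algebraMap_mem c, hA.algebraMap_mem c⁻¹⟩

end ValuationSubring

namespace RatFunc

variable {k : Type*} [Field k]

open IsDedekindDomain WithZero

theorem exists_isPlace {p : Polynomial k} (hp : Irreducible p) :
    ∃ W : ValuationSubring (RatFunc k), W.IsPlace k ∧
      W.valuation (algebraMap (Polynomial k) (RatFunc k) p) < 1 ∧
      ∀ P : Polynomial k, P ≠ 0 → algebraMap (Polynomial k) (RatFunc k) P ∈ W.unitSq → p ∣ P →
        p ^ 2 ∣ P := by
  have hp0 := hp.ne_zero
  let I : HeightOneSpectrum (Polynomial k) := ⟨Ideal.span {p},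
    (Ideal.span_singleton_prime hp0).2 hp.prime, by simpa using hp0⟩
  let v := I.valuation (RatFunc k)
  have hlt : ∀ w, v.valuationSubring.valuation w < 1 ↔ v w < 1 := fun w =>
    (v.isEquiv_valuation_valuationSubring.lt_one_iff_lt_one).symm
  have hv : ∀ P : Polynomial k, v (algebraMap (Polynomial k) (RatFunc k) P) = I.intValuation P :=
    fun P => I.valuation_of_algebraMap (K := RatFunc k) P
  have hvp : v (algebraMap (Polynomial k) (RatFunc k) p) < 1 := by
    rw [hv, I.intValuation_lt_one_iff_mem]
    exact Ideal.mem_span_singleton_self p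
  have hvC : ∀ P : Polynomial k, algebraMap (Polynomial k) (RatFunc k) P ∈ v.valuationSubring := by
    intro P
    rw [Valuation.mem_valuationSubring_iff, hv]
    exact I.intValuation_le_one P
  refine ⟨v.valuationSubring, ⟨fun htop => ?_, fun c => ?_⟩, (hlt _).2 hvp, ?_⟩
  · have := (hlt _).2 hvp
    rw [ValuationSubring.valuation_lt_one_iff_inv_notMem _ (RatFunc.algebraMap_ne_zero hp0),
      htop] at this
    exact this trivial
  · exact hvC (Polynomial.C c)
  · intro P hP hPu hpP
    obtain ⟨u, y, hu, hy, e⟩ := hPu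
    have hu1 : v u = 1 := (v.isEquiv_valuation_valuationSubring.eq_one_iff_eq_one).2 hu
    have hP1 : I.intValuation P < 1 := by
      rw [I.intValuation_lt_one_iff_mem]
      exact Ideal.mem_span_singleton.2 hpP
    have hy0 : v y ≠ 0 := (Valuation.ne_zero_iff _).2 hy
    have h1 : I.intValuation P = v y ^ 2 := by rw [← hv, e, map_mul, map_pow, hu1, one_mul]
    obtain ⟨m, hm⟩ : ∃ m : ℤ, v y = exp m := ⟨log (v y), (exp_log hy0).symm⟩
    rw [hm, ← exp_nsmul] at h1
    have h2 : I.intValuation P ≤ exp (-((2 : ℕ) : ℤ)) := by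
      rw [h1, ← exp_zero, exp_lt_exp] at hP1
      rw [h1, exp_le_exp]
      simp only [nsmul_eq_mul] at hP1 ⊢
      push_cast at hP1 ⊢
      omega
    rw [I.intValuation_le_pow_iff_mem] at h2
    have h3 : I.asIdeal = Ideal.span {p} := rfl
    rw [h3, Ideal.span_singleton_pow] at h2
    exact Ideal.mem_span_singleton.1 h2

theorem exists_eq_C_mul_sq_of_polynomial (n : ℕ) {P : Polynomial k} (hn : P.natDegree ≤ n)
    (hP : P ≠ 0)
    (h : ∀ W : ValuationSubring (RatFunc k), W.IsPlace k →
      algebraMap (Polynomial k) (RatFunc k) P ∈ W.unitSq) :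
    ∃ (c : k) (g : Polynomial k), c ≠ 0 ∧ g ≠ 0 ∧ P = Polynomial.C c * g ^ 2 := by
  induction n using Nat.strong_induction_on generalizing P with
  | _ n ih =>
  by_cases hu : IsUnit P
  · obtain ⟨c, hc, rfl⟩ := Polynomial.isUnit_iff.1 hu
    exact ⟨c, 1, hc.ne_zero, one_ne_zero, by simp⟩
  obtain ⟨p, hp, hpP⟩ := WfDvdMonoid.exists_irreducible_factor hu hP
  obtain ⟨W, hW, -, hWP⟩ := exists_isPlace hp
  obtain ⟨Q, rfl⟩ := hWP P hP (h W hW) hpP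
  have hQ0 := right_ne_zero_of_mul hP
  have hdeg := hp.natDegree_pos
  rw [Polynomial.natDegree_mul (pow_ne_zero _ hp.ne_zero) hQ0, Polynomial.natDegree_pow] at hn
  obtain ⟨c, g, hc, hg, rfl⟩ := ih Q.natDegree (by omega) le_rfl hQ0 fun W hW =>
    W.isSqGroup_unitSq.mem_of_eq (h W hW)
      (z := (algebraMap (Polynomial k) (RatFunc k) p)⁻¹)
      (inv_ne_zero (RatFunc.algebraMap_ne_zero hp.ne_zero)) (by
        have := RatFunc.algebraMap_ne_zero hp.ne_zero
        rw [map_mul, map_pow]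
        field_simp)
  exact ⟨c, p * g, hc, mul_ne_zero hp.ne_zero hg, by ring⟩

end RatFunc

section RationalFunctionField

variable {k F : Type*} [Field k] [Field F] [Algebra k F] (e : F ≃ₐ[k] RatFunc k)
include e

theorem exists_eq_algebraMap_mul_sq_of_ratFunc {f : F} (hf : f ≠ 0)
    (h : ∀ A : ValuationSubring F, A.IsPlace k → f ∈ A.unitSq) :
    ∃ (c : k) (g : F), c ≠ 0 ∧ g ≠ 0 ∧ f = algebraMap k F c * g ^ 2 := by
  have hef : e f ≠ 0 := (map_ne_zero e).2 hf
  have hd : algebraMap (Polynomial k) (RatFunc k) (e f).denom ≠ 0 :=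
    RatFunc.algebraMap_ne_zero (e f).denom_ne_zero
  have hnd := (e f).num_div_denom
  have hN : algebraMap (Polynomial k) (RatFunc k) ((e f).num * (e f).denom) =
      e f * algebraMap (Polynomial k) (RatFunc k) (e f).denom ^ 2 := by
    conv_rhs => rw [← hnd]
    rw [map_mul]
    field_simp
    rw [hnd]
  obtain ⟨c, g, hc, hg, hP⟩ := RatFunc.exists_eq_C_mul_sq_of_polynomial _ le_rfl
    (mul_ne_zero (RatFunc.num_ne_zero hef) (e f).denom_ne_zero) (fun W hW => by
      refine W.isSqGroup_unitSq.mem_of_eq (ValuationSubring.map_mem_unitSq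
        (φ := (e : F →+* RatFunc k)) (h (W.comap e) ⟨fun htop => hW.ne_top ?_, fun c => ?_⟩)) hd hN
      · rw [eq_top_iff]
        intro z _
        have : e.symm z ∈ W.comap (e : F →+* RatFunc k) := by rw [htop]; trivial
        simpa using this
      · simpa using hW.algebraMap_mem c)
  refine ⟨c, e.symm (algebraMap _ _ g / algebraMap _ _ (e f).denom), hc, ?_, ?_⟩
  · rw [Ne, map_eq_zero]
    exact div_ne_zero (RatFunc.algebraMap_ne_zero hg) hd
  · apply e.injective
    rw [hP] at hN
    rw [map_mul, map_pow, AlgEquiv.apply_symm_apply, AlgEquiv.commutes]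
    rw [map_mul, map_pow] at hN
    rw [div_pow, ← mul_div_assoc, eq_div_iff (pow_ne_zero 2 hd), ← hN]
    rfl

theorem exists_isPlace_of_ratFunc : ∃ A : ValuationSubring F, A.IsPlace k ∧
    ∀ q ∈ A.unitSq, ∃ c : k, c ≠ 0 ∧ q * algebraMap k F c ∈ A.oneUnitSq := by
  obtain ⟨W, hW, hWX, -⟩ := RatFunc.exists_isPlace (k := k) Polynomial.irreducible_X
  rw [RatFunc.algebraMap_X] at hWX
  let A := W.comap (e : F →+* RatFunc k)
  have hA : A.IsPlace k := ⟨fun htop => hW.ne_top (by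
      rw [eq_top_iff]
      intro z _
      have : e.symm z ∈ A := by rw [htop]; trivial
      simpa [A] using this), fun c => by simpa [A] using hW.algebraMap_mem c⟩
  refine ⟨A, hA, ?_⟩
  rintro q ⟨u, y, hu, hy, rfl⟩
  have hu0 := A.ne_zero_of_valuation_eq_one hu
  have hone : ∀ {p : Polynomial k}, p.coeff 0 = 1 →
      W.valuation (Polynomial.aeval RatFunc.X p - 1) < 1 := by
    intro p hp
    have h1 := congrArg (Polynomial.aeval (RatFunc.X : RatFunc k)) p.divX_mul_X_add
    rw [hp, map_add, map_mul, Polynomial.aeval_X, map_one, map_one] at h1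
    rw [← h1, add_sub_cancel_right, map_mul]
    refine lt_of_le_of_lt (mul_le_of_le_one_left zero_le ((W.valuation_le_one_iff _).2 ?_)) hWX
    have hXW : (RatFunc.X : RatFunc k) ∈ W := (W.valuation_le_one_iff _).1 hWX.le
    rw [Polynomial.aeval_eq_sum_range]
    refine sum_mem fun i _ => ?_
    rw [Algebra.smul_def]
    exact MulMemClass.mul_mem (hW.algebraMap_mem _) (pow_mem hXW i)
  have hX : Transcendental k (RatFunc.X : RatFunc k) := RatFunc.transcendental_X
  obtain ⟨c, n, hc, p, r, hp, hr, hlead⟩ := IsLeading.exists_of_div hX (z := e u)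
    (F := (e u).num) (G := (e u).denom) (by
      rw [RatFunc.aeval_X_left_eq_algebraMap, RatFunc.aeval_X_left_eq_algebraMap,
        RatFunc.num_div_denom]) ((map_ne_zero e).2 hu0)
  have hvp := W.valuation_eq_one_of_sub (hone hp)
  have hvr := W.valuation_eq_one_of_sub (hone hr)
  have hvc := ValuationSubring.valuation_algebraMap_eq_one hW hc
  have hvu : W.valuation (e u) = 1 :=
    ValuationSubring.valuation_eq_one_of_comap (φ := (e : F →+* RatFunc k)) hu
  have hX0 : (RatFunc.X : RatFunc k) ≠ 0 := RatFunc.X_ne_zero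
  have hn : n = 0 := by
    have h1 := congrArg W.valuation hlead
    rw [hvu, map_mul, map_mul, map_div₀, hvp, hvr, hvc, one_mul, div_one, mul_one, map_zpow₀] at h1
    rcases lt_trichotomy n 0 with h | h | h
    · exact absurd h1.symm (one_lt_zpow_of_neg₀ (W.valuation_pos hX0) hWX h).ne'
    · exact h
    · exact absurd h1.symm (zpow_lt_one₀ (W.valuation_pos hX0) hWX h).ne
  rw [hn, zpow_zero, mul_one] at hlead
  have hck : algebraMap k F c ≠ 0 := (map_ne_zero _).2 hc
  refine ⟨c, hc, u / algebraMap k F c, y * algebraMap k F c, ?_, mul_ne_zero hy hck, ?_⟩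
  · have h1 : e (u / algebraMap k F c - 1) ∈ W ∧ W.valuation (e (u / algebraMap k F c - 1)) < 1 := by
      have hck' : algebraMap k (RatFunc k) c ≠ 0 := (map_ne_zero _).2 hc
      have hr0 := W.ne_zero_of_valuation_eq_one hvr
      have h2 : e (u / algebraMap k F c - 1) = ((Polynomial.aeval RatFunc.X p - 1) -
          (Polynomial.aeval RatFunc.X r - 1)) / Polynomial.aeval RatFunc.X r := by
        rw [map_sub, map_div₀, hlead, AlgEquiv.commutes, map_one]
        field_simp
        ring
      have h3 : W.valuation (e (u / algebraMap k F c - 1)) < 1 := by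
        rw [h2, map_div₀, hvr, div_one]
        exact Valuation.map_sub_lt _ (hone hp) (hone hr)
      exact ⟨(W.valuation_le_one_iff _).1 h3.le, h3⟩
    by_cases h0 : u / algebraMap k F c - 1 = 0
    · rw [h0, map_zero]
      exact zero_lt_one
    rw [ValuationSubring.valuation_lt_one_iff_inv_notMem _ h0]
    intro h4
    have h5 : (e (u / algebraMap k F c - 1))⁻¹ ∈ W := by
      rw [← map_inv₀]
      exact h4
    exact (ValuationSubring.valuation_lt_one_iff_inv_notMem _ ((map_ne_zero e).2 h0)).1 h1.2 h5
  · field_simp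

end RationalFunctionField

end

noncomputable section

theorem Polynomial.eq_zero_of_sq_mul_eq_C_mul_sq {k : Type*} [Field k] {a c : k} (ha : a ≠ 0)
    (hns : ¬ IsSquare a) {P Q : Polynomial k}
    (h : P ^ 2 * (1 - Polynomial.C a * Polynomial.X ^ 2) = Polynomial.C c * Q ^ 2) : P = 0 := by
  by_contra hP
  obtain ⟨π, hπ⟩ : ∃ π, π = 1 - Polynomial.C a * Polynomial.X ^ 2 := ⟨_, rfl⟩
  have hdeg : π.natDegree = 2 := by
    have : π = Polynomial.C (-a) * Polynomial.X ^ 2 + Polynomial.C 0 * Polynomial.X +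
      Polynomial.C 1 := by rw [hπ]; simp; ring
    rw [this]
    exact Polynomial.natDegree_quadratic (neg_ne_zero.2 ha)
  have hirr : Irreducible π := by
    refine Polynomial.irreducible_of_degree_le_three_of_not_isRoot (by rw [hdeg]; decide)
      fun r hr => ?_
    have h1 : 1 - a * r ^ 2 = 0 := by simpa [hπ] using hr
    have hr0 : r ≠ 0 := by rintro rfl; simp at h1
    exact hns ⟨r⁻¹, by field_simp; linear_combination -h1⟩
  rw [← hπ] at h
  have hQ : Polynomial.C c * Q ^ 2 ≠ 0 := h ▸ mul_ne_zero (pow_ne_zero 2 hP) hirr.ne_zero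
  have hc : c ≠ 0 := by rintro rfl; simp at hQ
  have hQ0 : Q ≠ 0 := by rintro rfl; simp at hQ
  have hfin : ∀ {R : Polynomial k}, R ≠ 0 → FiniteMultiplicity π R := fun hR =>
    FiniteMultiplicity.of_not_isUnit hirr.not_isUnit hR
  have h1 := congrArg (multiplicity π) h
  rw [multiplicity_mul hirr.prime (hfin (h ▸ hQ)), multiplicity_mul hirr.prime (hfin hQ),
    (hfin hP).multiplicity_pow hirr.prime, (hfin hQ0).multiplicity_pow hirr.prime,
    multiplicity_self, multiplicity_of_isUnit_right hirr.not_isUnit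
      (Polynomial.isUnit_C.2 hc.isUnit)] at h1
  omega

theorem IntermediateField.exists_eq_add_mul_of_mem_adjoin {F Ω : Type*} [Field F] [Field Ω]
    [Algebra F Ω] {s : Ω} {d : F} (hs : s ^ 2 = algebraMap F Ω d) {z : Ω}
    (hz : z ∈ IntermediateField.adjoin F {s}) :
    ∃ u v : F, z = algebraMap F Ω u + algebraMap F Ω v * s := by
  have halg : IsAlgebraic F s :=
    IsAlgebraic.of_pow (n := 2) (by norm_num) (hs ▸ isAlgebraic_algebraMap d)
  rw [← IntermediateField.mem_toSubalgebra,
    IntermediateField.adjoin_simple_toSubalgebra_of_isAlgebraic halg] at hz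
  induction hz using Algebra.adjoin_induction with
  | mem w hw => exact ⟨0, 1, by rw [Set.mem_singleton_iff.1 hw]; simp⟩
  | algebraMap r => exact ⟨r, 0, by simp⟩
  | add w₁ w₂ _ _ h₁ h₂ =>
    obtain ⟨u₁, v₁, rfl⟩ := h₁
    obtain ⟨u₂, v₂, rfl⟩ := h₂
    exact ⟨u₁ + u₂, v₁ + v₂, by simp only [map_add]; ring⟩
  | mul w₁ w₂ _ _ h₁ h₂ =>
    obtain ⟨u₁, v₁, rfl⟩ := h₁
    obtain ⟨u₂, v₂, rfl⟩ := h₂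
    refine ⟨u₁ * u₂ + v₁ * v₂ * d, u₁ * v₂ + v₁ * u₂, ?_⟩
    simp only [map_add, map_mul, ← hs]
    ring

namespace ConicModel

variable {l : Type*} [Field l] {a b : l} {L : Type*} [Field L] [Algebra l L] {x y : L}

theorem exists_eq_algebraMap_of_sq (h : ConicModel l a b x y) (ha : a ≠ 0) (hb : b ≠ 0)
    (hns : ¬ IsSquare a) [CharZero L] {q : L} {D : l} (hq : q ^ 2 = algebraMap l L D) :
    ∃ d : l, q = algebraMap l L d := by
  have hb' : algebraMap l L b ≠ 0 := (map_ne_zero _).2 hb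
  have hinj : Function.Injective (Polynomial.aeval x : Polynomial l →ₐ[l] L) :=
    transcendental_iff_injective.1 h.transcendental
  let E := IntermediateField.adjoin l {x}
  have hxE : x ∈ E := IntermediateField.mem_adjoin_simple_self l x
  have hfrac : ∀ {z : L}, z ∈ E → ∃ P Q : Polynomial l, Q ≠ 0 ∧
      z * Polynomial.aeval x Q = Polynomial.aeval x P := by
    intro z hz
    obtain ⟨P, Q, e⟩ := (IntermediateField.mem_adjoin_simple_iff l z).1 hz
    by_cases hQ : Q = 0
    · exact ⟨0, 1, one_ne_zero, by rw [e, hQ]; simp⟩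
    · have : Polynomial.aeval x Q ≠ 0 := (map_ne_zero_iff _ hinj).2 hQ
      exact ⟨P, Q, hQ, by rw [e]; field_simp⟩
  have hy2 : y ^ 2 = (1 - algebraMap l L a * x ^ 2) / algebraMap l L b := by
    rw [eq_div_iff hb']
    linear_combination h.eq
  have hy2E : y ^ 2 ∈ E := by
    rw [hy2]
    exact div_mem (sub_mem (one_mem _) (mul_mem (E.algebraMap_mem a) (pow_mem hxE 2)))
      (E.algebraMap_mem b)
  have hyE : y ∉ E := by
    intro hyE
    obtain ⟨P, Q, hQ, e⟩ := hfrac hyE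
    refine hQ (Polynomial.eq_zero_of_sq_mul_eq_C_mul_sq ha hns (Q := P) (c := b) (hinj ?_))
    simp only [map_mul, map_pow, map_sub, map_one, Polynomial.aeval_X, Polynomial.aeval_C]
    rw [← e]
    linear_combination (-(Polynomial.aeval x Q) ^ 2) * h.eq
  have htop : q ∈ IntermediateField.adjoin E {y} := by
    have h1 : (IntermediateField.adjoin E {y}).restrictScalars l = ⊤ := by
      rw [eq_top_iff, ← h.adjoin_eq, IntermediateField.adjoin_le_iff]
      rintro z (rfl | rfl)
      · exact (IntermediateField.adjoin E {y}).algebraMap_mem ⟨_, hxE⟩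
      · exact IntermediateField.mem_adjoin_simple_self E _
    have : q ∈ (IntermediateField.adjoin E {y}).restrictScalars l := by rw [h1]; trivial
    exact this
  obtain ⟨⟨u, hu⟩, ⟨v, hv⟩, e⟩ := IntermediateField.exists_eq_add_mul_of_mem_adjoin
    (F := E) (d := ⟨y ^ 2, hy2E⟩) rfl htop
  change q = u + v * y at e
  have huv : u = 0 ∨ v = 0 := by
    by_contra hne
    push Not at hne
    apply hyE
    have h1 : y = (algebraMap l L D - u ^ 2 - v ^ 2 * y ^ 2) / (2 * u * v) := by
      have h2 : (2 : L) ≠ 0 := two_ne_zero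
      have := hne.1
      have := hne.2
      field_simp
      rw [← hq, e]
      ring
    rw [h1]
    exact div_mem (sub_mem (sub_mem (E.algebraMap_mem D) (pow_mem hu 2))
      (mul_mem (pow_mem hv 2) hy2E)) (mul_mem (mul_mem (ofNat_mem E 2) hu) hv)
  rcases huv with rfl | rfl
  · obtain ⟨P, Q, hQ, e'⟩ := hfrac hv
    have hP : P = 0 := by
      refine Polynomial.eq_zero_of_sq_mul_eq_C_mul_sq ha hns (Q := Q) (c := D * b) (hinj ?_)
      simp only [map_mul, map_pow, map_sub, map_one, Polynomial.aeval_X, Polynomial.aeval_C]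
      rw [← e', ← hq, e]
      linear_combination (-(v * Polynomial.aeval x Q) ^ 2) * h.eq
    rw [hP, map_zero, mul_eq_zero] at e'
    have : v = 0 := e'.resolve_right ((map_ne_zero_iff _ hinj).2 hQ)
    exact ⟨0, by rw [e, this]; simp⟩
  · rw [zero_mul, add_zero] at e
    obtain ⟨P, Q, hQ, e'⟩ := hfrac hu
    have h1 : P ^ 2 = Polynomial.C D * Q ^ 2 := by
      apply hinj
      simp only [map_mul, map_pow, Polynomial.aeval_C]
      rw [← e', ← hq, e]
      ring
    have h2 := congrArg Polynomial.leadingCoeff h1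
    rw [Polynomial.leadingCoeff_mul, Polynomial.leadingCoeff_pow, Polynomial.leadingCoeff_pow,
      Polynomial.leadingCoeff_C] at h2
    have hQl : Q.leadingCoeff ≠ 0 := Polynomial.leadingCoeff_ne_zero.2 hQ
    have h3 : D = (P.leadingCoeff / Q.leadingCoeff) ^ 2 := by field_simp; exact h2.symm
    rw [h3, map_pow] at hq
    rcases sq_eq_sq_iff_eq_or_eq_neg.1 hq with h4 | h4
    · exact ⟨_, h4⟩
    · exact ⟨-(P.leadingCoeff / Q.leadingCoeff), by rw [h4, map_neg]⟩

end ConicModel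

end

noncomputable section

namespace ConicModel

variable {l : Type*} [Field l] {a b : l} {L : Type*} [Field L] [Algebra l L] {x y : L}

theorem exists_eq_algebraMap_mul_sq_of_sqrt [CharZero L] (h : ConicModel l a b x y) (ha : a ≠ 0)
    (hb : b ≠ 0) (hns : ¬ IsSquare a) {L' : Type*} [Field L'] [Algebra L L'] [Algebra l L']
    [IsScalarTower l L L'] {s : L'} (hs : s ^ 2 = algebraMap l L' a)
    (hspan : ∀ z : L', ∃ u v : L, z = algebraMap L L' u + algebraMap L L' v * s)
    [Algebra.IsAlgebraic L L'] {f : L} (hf : f ≠ 0)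
    (hfu : ∀ A : ValuationSubring L, A.IsPlace l → f ∈ A.unitSq) :
    ∃ (c : l) (g : L), c ≠ 0 ∧ g ≠ 0 ∧ f = algebraMap l L c * g ^ 2 := by
  have hchar : CharZero L' := charZero_of_injective_algebraMap (algebraMap L L').injective
  have ha' : algebraMap l L' a ≠ 0 := (map_ne_zero _).2 ha
  have hs0 : s ≠ 0 := by
    rintro rfl
    apply ha'
    rw [← hs]
    ring
  let l' := IntermediateField.adjoin l {s}
  have hsl' : s ∈ l' := IntermediateField.mem_adjoin_simple_self l s
  have halg : IsAlgebraic l s :=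
    IsAlgebraic.of_pow (n := 2) (by norm_num) (hs ▸ isAlgebraic_algebraMap a)
  have hl'alg : Algebra.IsAlgebraic l l' := IntermediateField.isAlgebraic_adjoin_simple
    halg.isIntegral
  have hM : ConicModel l' (algebraMap l l' a) (algebraMap l l' b) (algebraMap L L' x)
      (algebraMap L L' y) := by
    refine ⟨?_, ?_, ?_⟩
    · rw [← IsScalarTower.algebraMap_apply l l' L', ← IsScalarTower.algebraMap_apply l l' L',
        IsScalarTower.algebraMap_apply l L L', IsScalarTower.algebraMap_apply l L L' b,
        ← map_pow, ← map_pow, ← map_mul, ← map_mul, ← map_add, h.eq, map_one]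
    · intro hx
      have h1 : IsAlgebraic l (algebraMap L L' x) := hx.restrictScalars l
      exact h.transcendental ((isAlgebraic_algebraMap_iff (algebraMap L L').injective).1 h1)
    · let M := IntermediateField.adjoin l' {algebraMap L L' x, algebraMap L L' y}
      have hLM : ∀ z : L, algebraMap L L' z ∈ M := by
        have h1 : (M.restrictScalars l).comap (IsScalarTower.toAlgHom l L L') = ⊤ := by
          rw [eq_top_iff, ← h.adjoin_eq, IntermediateField.adjoin_le_iff]
          rintro z (rfl | rfl)
          · exact IntermediateField.subset_adjoin l' _ (Or.inl rfl)
          · exact IntermediateField.subset_adjoin l' _ (Or.inr rfl)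
        intro z
        have : z ∈ (M.restrictScalars l).comap (IsScalarTower.toAlgHom l L L') := by
          rw [h1]; trivial
        exact this
      rw [eq_top_iff]
      intro z _
      obtain ⟨u, v, rfl⟩ := hspan z
      exact add_mem (hLM u) (mul_mem (hLM v) (M.algebraMap_mem ⟨s, hsl'⟩))
  have hal' : algebraMap l l' a ≠ 0 := (map_ne_zero _).2 ha
  have hsl'2 : (⟨s, hsl'⟩ : l') ^ 2 = algebraMap l l' a := Subtype.ext hs
  obtain ⟨e⟩ := hM.nonempty_algEquiv_ratFunc hal' (x₀ := (⟨s, hsl'⟩ : l')⁻¹) (y₀ := 0) (by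
    rw [inv_pow, hsl'2, mul_inv_cancel₀ hal']; ring)
  obtain ⟨⟨c, hcl'⟩, g, hc0, hg0, hfg⟩ := exists_eq_algebraMap_mul_sq_of_ratFunc e
    (f := algebraMap L L' f) ((map_ne_zero _).2 hf) (fun W hW => by
      refine ValuationSubring.map_mem_unitSq (hfu (W.comap (algebraMap L L')) ⟨?_, ?_⟩)
      · intro htop
        apply hW.ne_top
        rw [eq_top_iff]
        intro z _
        refine W.mem_of_isAlgebraic (M := L) (fun m => ?_) (Algebra.IsAlgebraic.isAlgebraic z)
        have : m ∈ W.comap (algebraMap L L') := by rw [htop]; trivial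
        exact this
      · intro c
        have := hW.algebraMap_mem (algebraMap l l' c)
        rw [← IsScalarTower.algebraMap_apply l l' L', IsScalarTower.algebraMap_apply l L L'] at this
        exact this)
  change algebraMap L L' f = c * g ^ 2 at hfg
  obtain ⟨c₁, c₂, rfl⟩ := IntermediateField.exists_eq_add_mul_of_mem_adjoin hs hcl'
  obtain ⟨h₁, h₂, hh⟩ := hspan g⁻¹
  have hindep : ∀ u v : L, algebraMap L L' u + algebraMap L L' v * s = 0 → u = 0 ∧ v = 0 := by
    intro u v huv
    have hv : v = 0 := by
      by_contra hv
      have hv' : algebraMap L L' v ≠ 0 := (map_ne_zero _).2 hv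
      have h1 : s = algebraMap L L' (-u / v) := by
        rw [map_div₀, map_neg]
        field_simp
        linear_combination huv
      have h2 : (-u / v) ^ 2 = algebraMap l L a := by
        apply (algebraMap L L').injective
        rw [map_pow, ← h1, hs, IsScalarTower.algebraMap_apply l L L']
      obtain ⟨d, hd⟩ := h.exists_eq_algebraMap_of_sq ha hb hns h2
      rw [hd, ← map_pow] at h2
      exact hns ⟨d, by rw [← (algebraMap l L).injective h2, sq]⟩
    rw [hv] at huv
    exact ⟨by simpa using huv, hv⟩
  have key : algebraMap L L' f * (g⁻¹) ^ 2 =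
      algebraMap l L' c₁ + algebraMap l L' c₂ * s := by
    rw [hfg]
    field_simp
  rw [hh, IsScalarTower.algebraMap_apply l L L', IsScalarTower.algebraMap_apply l L L'] at key
  rw [IsScalarTower.algebraMap_apply l L L'] at hs
  obtain ⟨e₁, e₂⟩ := hindep (f * (h₁ ^ 2 + algebraMap l L a * h₂ ^ 2) - algebraMap l L c₁)
    (2 * f * h₁ * h₂ - algebraMap l L c₂) (by
      simp only [map_sub, map_mul, map_add, map_pow, map_ofNat]
      rw [← hs]
      linear_combination key)
  have hal : algebraMap l L a ≠ 0 := (map_ne_zero _).2 ha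
  have hne : h₁ ≠ 0 ∨ h₂ ≠ 0 := by
    by_contra hcon
    push Not at hcon
    rw [hcon.1, hcon.2] at hh
    exact hg0 (by simpa using hh)
  have hfin : ∀ (C : l) (w : L), w ≠ 0 → f * w ^ 2 = algebraMap l L C →
      ∃ (c : l) (g : L), c ≠ 0 ∧ g ≠ 0 ∧ f = algebraMap l L c * g ^ 2 := by
    intro C w hw hC
    refine ⟨C, w⁻¹, ?_, inv_ne_zero hw, ?_⟩
    · rintro rfl
      rw [map_zero] at hC
      exact mul_ne_zero hf (pow_ne_zero 2 hw) hC
    · rw [← hC]; field_simp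
  by_cases hh₂ : h₂ = 0
  · refine hfin c₁ h₁ (hne.resolve_right (not_not.2 hh₂)) ?_
    rw [hh₂] at e₁
    linear_combination e₁
  by_cases hh₁ : h₁ = 0
  · refine hfin (c₁ / a) h₂ hh₂ ?_
    rw [hh₁] at e₁
    rw [map_div₀, eq_div_iff hal]
    linear_combination e₁
  · have h2 : (2 : L) ≠ 0 := two_ne_zero
    have hc₂ : algebraMap l L c₂ ≠ 0 := by
      rw [← sub_eq_zero.1 e₂]
      exact mul_ne_zero (mul_ne_zero (mul_ne_zero h2 hf) hh₁) hh₂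
    obtain ⟨d, hd⟩ := h.exists_eq_algebraMap_of_sq ha hb hns
      (q := algebraMap l L c₂ * (h₁ / h₂) - algebraMap l L c₁) (D := c₁ ^ 2 - a * c₂ ^ 2) (by
        rw [← sub_eq_zero.1 e₂, ← sub_eq_zero.1 e₁, map_sub, map_mul, map_pow, map_pow,
          ← sub_eq_zero.1 e₂, ← sub_eq_zero.1 e₁]
        field_simp
        ring)
    have hr : h₁ / h₂ = algebraMap l L ((d + c₁) / c₂) := by
      rw [map_div₀, map_add, eq_div_iff hc₂, ← hd]
      ring
    refine hfin (c₂ / (2 * ((d + c₁) / c₂))) h₂ hh₂ ?_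
    rw [map_div₀, map_mul, ← hr, ← sub_eq_zero.1 e₂, map_ofNat]
    field_simp

theorem exists_eq_algebraMap_mul_sq [CharZero L] (h : ConicModel l a b x y) (ha : a ≠ 0)
    (hb : b ≠ 0) (hns : ¬ IsSquare a) {f : L} (hf : f ≠ 0)
    (hfu : ∀ A : ValuationSubring L, A.IsPlace l → f ∈ A.unitSq) :
    ∃ (c : l) (g : L), c ≠ 0 ∧ g ≠ 0 ∧ f = algebraMap l L c * g ^ 2 := by
  obtain ⟨s, hs⟩ := IsAlgClosed.exists_pow_nat_eq
    (algebraMap L (AlgebraicClosure L) (algebraMap l L a)) (n := 2) (by norm_num)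
  let L' := IntermediateField.adjoin L {s}
  have halg : IsAlgebraic L s := Algebra.IsAlgebraic.isAlgebraic s
  have hL'alg : Algebra.IsAlgebraic L L' := IntermediateField.isAlgebraic_adjoin_simple
    halg.isIntegral
  let _ : Algebra l L' := ((algebraMap L L').comp (algebraMap l L)).toAlgebra
  have : IsScalarTower l L L' := IsScalarTower.of_algebraMap_eq fun _ => rfl
  refine h.exists_eq_algebraMap_mul_sq_of_sqrt ha hb hns (L' := L')
    (s := ⟨s, IntermediateField.mem_adjoin_simple_self L s⟩) (Subtype.ext hs) ?_ hf hfu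
  rintro ⟨z, hz⟩
  obtain ⟨u, v, e⟩ := IntermediateField.exists_eq_add_mul_of_mem_adjoin hs hz
  exact ⟨u, v, Subtype.ext e⟩

end ConicModel

end

noncomputable section

open IsLocalRing in
theorem IsWittRel.nonempty_algEquiv_ratFunc {k l : Type*} [Field k] [NumberField k] [Field l]
    [NumberField l] {K L : Type*} [Field K] [Field L] [Algebra k K] [Algebra l L] [CharZero K]
    [CharZero L] {R : K → L → Prop} (hR : IsWittRel R) {c d : k} {x' y' : K}
    (hK : ConicModel k c d x' y') (hc : c ≠ 0) (hd : d ≠ 0) {a b : l} {x y : L}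
    (hL : ConicModel l a b x y) (ha : a ≠ 0) (hb : b ≠ 0) (e : K ≃ₐ[k] RatFunc k) :
    Nonempty (L ≃ₐ[l] RatFunc l) := by
  by_cases hns : IsSquare a
  · obtain ⟨r, rfl⟩ := hns
    have hr : r ≠ 0 := left_ne_zero_of_mul ha
    exact hL.nonempty_algEquiv_ratFunc ha (x₀ := r⁻¹) (y₀ := 0) (by field_simp; ring)
  obtain ⟨A, hA, hAc⟩ := exists_isPlace_of_ratFunc e
  obtain ⟨B, hB, hB1, hBu⟩ := hR.exists_isPlace hK hc hd hL ha hb hA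
  let φ : l →+* B := (algebraMap l L).codRestrict B hB.algebraMap_mem
  let _ : Algebra l (ResidueField B) := ((residue B).comp φ).toAlgebra
  have hφ : ∀ r : l, algebraMap l (ResidueField B) r = residue B (φ r) := fun _ => rfl
  have hnum : NumberField (ResidueField B) := by
    obtain ⟨κ, E, _, _, _, _, ψ, t, hψ⟩ := hL.exists_localParam ha hb hB
    exact hψ.numberField_residueField
  have hconst : ∀ r : k, r ≠ 0 → ∃ (r' : l) (g : L), r' ≠ 0 ∧ g ≠ 0 ∧
      R (algebraMap k K r) (algebraMap l L r' * g ^ 2) := by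
    intro r hr
    obtain ⟨f, hf⟩ := hR.total_left ((map_ne_zero (algebraMap k K)).2 hr)
    obtain ⟨r', g, hr', hg, rfl⟩ := hL.exists_eq_algebraMap_mul_sq ha hb hns (hR.ne_right hf)
      fun B' hB' => by
        obtain ⟨A', hA', -, hAu⟩ := hR.flip.exists_isPlace hL ha hb hK hc hd hB'
        rw [← hR.flip.mem_relImage B'.isSqGroup_unitSq hf, ← hAu]
        exact A'.mem_unitSq_of_valuation (ValuationSubring.valuation_algebraMap_eq_one hA' hr)
    exact ⟨r', g, hr', hg, hf⟩
  have hsurj : Function.Surjective (algebraMap l (ResidueField B)) := by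
    apply NumberField.algebraMap_surjective_of_sq
    intro z hz
    obtain ⟨u, rfl⟩ := residue_surjective z
    have hu1 : B.valuation (u : L) = 1 := (B.residue_ne_zero_iff u).1 hz
    have hu : (u : L) ∈ relImage R A.unitSq := hBu ▸ B.mem_unitSq_of_valuation hu1
    obtain ⟨q, hq, hqu⟩ := hu
    obtain ⟨r, hr, hqr⟩ := hAc q hq
    obtain ⟨r', g, hr', hg, hrr'⟩ := hconst r hr
    have h1 : (u : L) * (algebraMap l L r' * g ^ 2) ∈ B.oneUnitSq := by
      rw [hB1]
      exact ⟨_, hqr, hR.mul hqu hrr'⟩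
    have h2 : ((u * φ r' : B) : L) ∈ B.oneUnitSq :=
      B.isSqGroup_oneUnitSq.mem_of_eq h1 (inv_ne_zero hg) (by
        change (u : L) * algebraMap l L r' = _
        field_simp)
    have hr1 : B.valuation (algebraMap l L r') = 1 :=
      ValuationSubring.valuation_algebraMap_eq_one hB hr'
    rw [B.mem_oneUnitSq_iff_isSquare (by
      change B.valuation ((u : L) * algebraMap l L r') = 1
      rw [map_mul, hu1, hr1, one_mul]), map_mul, ← hφ] at h2
    obtain ⟨s, hs⟩ := h2
    refine ⟨r'⁻¹, s, ?_⟩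
    have := (map_ne_zero (algebraMap l (ResidueField B))).2 hr'
    rw [map_inv₀, sq, ← hs]
    field_simp
  obtain ⟨a', b', x₁, y₁, ha', -, hM, hx₁, hy₁⟩ := hL.exists_model_of_isPlace ha hb hB
  obtain ⟨x₀, hx₀⟩ := hsurj (residue B ⟨x₁, hx₁⟩)
  obtain ⟨y₀, hy₀⟩ := hsurj (residue B ⟨y₁, (B.valuation_le_one_iff _).1 hy₁.le⟩)
  refine hM.nonempty_algEquiv_ratFunc ha' (x₀ := x₀) (y₀ := y₀) ?_
  apply (algebraMap l (ResidueField B)).injective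
  rw [map_add, map_mul, map_mul, map_pow, map_pow, hx₀, hy₀, hφ, hφ, ← map_pow, ← map_pow,
    ← map_mul, ← map_mul, ← map_add, map_one, ← map_one (residue B)]
  exact congrArg _ (Subtype.ext hM.eq)

theorem nonempty_algEquiv_ratFunc_iff {k K : Type*} [Field k] [Field K] [Algebra k K] :
    Nonempty (K ≃ₐ[k] RatFunc k) ↔
      ∃ e : K ≃+* RatFunc k, ∀ r : k, e (algebraMap k K r) = RatFunc.C r :=
  ⟨fun ⟨e⟩ => ⟨e, fun r => by simp [RatFunc.algebraMap_eq_C]⟩,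
    fun ⟨e, he⟩ => ⟨AlgEquiv.ofRingEquiv (f := e) fun r => by rw [he, RatFunc.algebraMap_eq_C]⟩⟩

end

/-- Let `k, ℓ` be number fields, `K = k_{a,b}` and `L = ℓ_{c,d}`.  If `K` and `L` are Witt
equivalent, then `K` is purely transcendental over `k` (i.e. `k`-isomorphic to `k(t)`) if
and only if `L` is purely transcendental over `ℓ`. -/
theorem wittEquiv_conic_purelyTranscendental_iff
    (k : Type*) [Field k] [NumberField k] (l : Type*) [Field l] [NumberField l]
    (a b : k) (ha : a ≠ 0) (hb : b ≠ 0) (c d : l) (hc : c ≠ 0) (hd : d ≠ 0)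
    (K : Type*) [Field K] (ι : k →+* K) (hK : IsConicFunctionField k a b K ι)
    (L : Type*) [Field L] (ι' : l →+* L) (hL : IsConicFunctionField l c d L ι')
    (hWE : WittEquivalent K L) :
    (∃ e : K ≃+* RatFunc k, ∀ r : k, e (ι r) = RatFunc.C r) ↔
      (∃ e' : L ≃+* RatFunc l, ∀ r : l, e' (ι' r) = RatFunc.C r) := by
  let _ : Algebra k K := ι.toAlgebra
  let _ : Algebra l L := ι'.toAlgebra
  have _ : CharZero K := charZero_of_injective_ringHom ι.injective
  have _ : CharZero L := charZero_of_injective_ringHom ι'.injective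
  obtain ⟨α, hα⟩ := hWE
  have hR := hα.exists_rel
  obtain ⟨x, y, hxy⟩ := IsConicFunctionField.exists_model hb hK
  obtain ⟨x', y', hxy'⟩ := IsConicFunctionField.exists_model hd hL
  change (∃ e : K ≃+* RatFunc k, ∀ r : k, e (algebraMap k K r) = RatFunc.C r) ↔
    (∃ e' : L ≃+* RatFunc l, ∀ r : l, e' (algebraMap l L r) = RatFunc.C r)
  rw [← nonempty_algEquiv_ratFunc_iff, ← nonempty_algEquiv_ratFunc_iff]
  exact ⟨fun ⟨e⟩ => hR.nonempty_algEquiv_ratFunc hxy ha hb hxy' hc hd e,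
    fun ⟨e⟩ => hR.flip.nonempty_algEquiv_ratFunc hxy' hc hd hxy ha hb e⟩

end
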